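/- Let N ≥ 3, 0 ≤ k ≤ N−2 and σ ∈ (0,2). Then the best Hardy–Sobolev constant S_{N,σ} is attained: there exists w ∈ D^{1,2}(ℝ^N) with ∫_{ℝ^N} |z|^{−σ} |w|^{2*_σ} dx = 1 and ∫_{ℝ^N} |∇w|² dx = S_{N,σ}; moreover w can be chosen positive. -/

import Mathlib

open MeasureTheory Filter Metric Set Bornology

noncomputable section

abbrev Euc (N : ℕ) := EuclideanSpace ℝ (Fin N)

/-- Euclidean norm of the `z`-component (the last `N - k` coordinates) of `x ∈ ℝ^N`. -/
def zNorm (N k : ℕ) (x : Euc N) : ℝ :=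
  Real.sqrt (∑ i : Fin N, if k ≤ (i : ℕ) then (x i) ^ 2 else 0)

/-- Euclidean norm of the `t`-component (the first `k` coordinates) of `x ∈ ℝ^N`. -/
def tNorm (N k : ℕ) (x : Euc N) : ℝ :=
  Real.sqrt (∑ i : Fin N, if (i : ℕ) < k then (x i) ^ 2 else 0)

/-- The critical Hardy–Sobolev exponent `2*_σ = 2(N-σ)/(N-2)`. -/
def twoStar (N : ℕ) (σ : ℝ) : ℝ := 2 * ((N : ℝ) - σ) / ((N : ℝ) - 2)

/-- Dirichlet energy `∫ |∇v|²`. -/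
def gradL2 (N : ℕ) (v : Euc N → ℝ) : ℝ := ∫ x, ‖fderiv ℝ v x‖ ^ 2

/-- Hardy–Sobolev integral `∫ |z|^{-σ} |v|^{2*_σ}`. -/
def hsInt (N k : ℕ) (σ : ℝ) (v : Euc N → ℝ) : ℝ :=
  ∫ x, zNorm N k x ^ (-σ) * |v x| ^ twoStar N σ

/-- Membership in `D^{1,2}(ℝ^N)`, the completion of `C_c^∞(ℝ^N)` for the norm
`v ↦ (∫ |∇v|²)^{1/2}`: `v` is a limit of smooth compactly supported functions, with
gradients converging in `L²` (and, via the Sobolev embedding of the completion,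
the functions converging in `L^{2N/(N-2)}`). -/
def MemD12 (N : ℕ) (v : Euc N → ℝ) : Prop :=
  ∃ φ : ℕ → Euc N → ℝ,
    (∀ n, ContDiff ℝ (⊤ : ℕ∞) (φ n) ∧ HasCompactSupport (φ n)) ∧
    Tendsto (fun n => eLpNorm (fun x => v x - φ n x)
      (ENNReal.ofReal (2 * (N : ℝ) / ((N : ℝ) - 2))) volume) atTop (nhds 0) ∧
    Tendsto (fun n => eLpNorm (fun x => fderiv ℝ v x - fderiv ℝ (φ n) x) 2 volume)
      atTop (nhds 0)

/-- The best constant `S_{N,σ}` in the cylindrical Hardy–Sobolev inequality. -/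
def Sconst (N k : ℕ) (σ : ℝ) : ℝ :=
  sInf {s : ℝ | ∃ v, MemD12 N v ∧ hsInt N k σ v = 1 ∧ s = gradL2 N v}

/-- A (positive) ground state for `S_{N,σ}`. -/
def GroundState (N k : ℕ) (σ : ℝ) (w : Euc N → ℝ) : Prop :=
  MemD12 N w ∧ (∀ x, 0 < w x) ∧ hsInt N k σ w = 1 ∧ gradL2 N w = Sconst N k σ

/-- Membership in `H¹₀(Ω)`: limit of smooth functions compactly supported in `Ω`,
in the `H¹` norm. -/
def MemH10 (N : ℕ) (Ω : Set (Euc N)) (u : Euc N → ℝ) : Prop :=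
  ∃ φ : ℕ → Euc N → ℝ,
    (∀ n, ContDiff ℝ (⊤ : ℕ∞) (φ n) ∧ HasCompactSupport (φ n) ∧ tsupport (φ n) ⊆ Ω) ∧
    Tendsto (fun n => eLpNorm (fun x => u x - φ n x) 2 volume) atTop (nhds 0) ∧
    Tendsto (fun n => eLpNorm (fun x => fderiv ℝ u x - fderiv ℝ (φ n) x) 2 volume)
      atTop (nhds 0)

/-- Coercivity of the operator `-Δ + h` on `H¹₀(Ω)`. -/
def CoerciveOp (N : ℕ) (Ω : Set (Euc N)) (h : Euc N → ℝ) : Prop :=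
  ∃ c > 0, ∀ u, MemH10 N Ω u →
    c * ∫ x in Ω, (‖fderiv ℝ u x‖ ^ 2 + u x ^ 2) ≤
      ∫ x in Ω, (‖fderiv ℝ u x‖ ^ 2 + h x * u x ^ 2)

/-- The Hardy–Sobolev quotient of `u` on `Ω` with singularity `Γ` and potential `h`. -/
def hsQuot (N : ℕ) (σ : ℝ) (Ω Γ : Set (Euc N)) (h : Euc N → ℝ) (u : Euc N → ℝ) : ℝ :=
  ((∫ x in Ω, ‖fderiv ℝ u x‖ ^ 2) + ∫ x in Ω, h x * u x ^ 2) /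
    (∫ x in Ω, infDist x Γ ^ (-σ) * |u x| ^ twoStar N σ) ^ (2 / twoStar N σ)

/-- The best constant `μ_{h,σ}(Ω,Γ)`. -/
def muHS (N : ℕ) (σ : ℝ) (Ω Γ : Set (Euc N)) (h : Euc N → ℝ) : ℝ :=
  sInf {m : ℝ | ∃ u, MemH10 N Ω u ∧ ¬ (u =ᵐ[volume.restrict Ω] (0 : Euc N → ℝ)) ∧
    m = hsQuot N σ Ω Γ h u}

/-- The pointwise Laplacian of `f : ℝ^N → ℝ`. -/
def lapl (N : ℕ) (f : Euc N → ℝ) (x : Euc N) : ℝ :=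
  ∑ i : Fin N, fderiv ℝ (fun y => fderiv ℝ f y (EuclideanSpace.single i 1)) x
    (EuclideanSpace.single i 1)

open scoped ENNReal NNReal Topology
set_option linter.unusedVariables false
set_option linter.deprecated false


abbrev Sm {N : ℕ} (φ : Euc N → ℝ) : Prop := ContDiff ℝ (⊤ : ℕ∞) φ ∧ HasCompactSupport φ

def zP (N k : ℕ) : Euc N →L[ℝ] Euc N :=
  LinearMap.toContinuousLinearMap
    { toFun := fun x => WithLp.toLp 2 (fun i => if k ≤ (i : ℕ) then x i else 0)
      map_add' := by intro x y; ext i; simp; split_ifs <;> simp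
      map_smul' := by intro c x; ext i; simp }

lemma zP_apply {N k : ℕ} (x : Euc N) (i : Fin N) :
    zP N k x i = if k ≤ (i : ℕ) then x i else 0 := by
  simp [zP]

lemma zNorm_eq {N k : ℕ} (x : Euc N) : zNorm N k x = ‖zP N k x‖ := by
  rw [EuclideanSpace.norm_eq, zNorm]
  congr 1
  apply Finset.sum_congr rfl
  intro i _
  rw [zP_apply]
  split_ifs <;> simp

lemma zNorm_nonneg {N k : ℕ} (x : Euc N) : 0 ≤ zNorm N k x := by
  rw [zNorm_eq]; positivity

lemma zP_norm_le {N k : ℕ} (x : Euc N) : ‖zP N k x‖ ≤ ‖x‖ := by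
  rw [← zNorm_eq, EuclideanSpace.norm_eq, zNorm]
  apply Real.sqrt_le_sqrt
  apply Finset.sum_le_sum
  intro i _
  split_ifs
  · simp
  · positivity

lemma zP_idem {N k : ℕ} (x : Euc N) : zP N k (zP N k x) = zP N k x := by
  ext i
  simp only [zP_apply]
  split_ifs <;> rfl

lemma continuous_zNorm (N k : ℕ) : Continuous (zNorm N k) := by
  have : zNorm N k = fun x => ‖zP N k x‖ := by ext x; exact zNorm_eq x
  rw [this]; fun_prop

lemma measurable_zNorm (N k : ℕ) : Measurable (zNorm N k) := (continuous_zNorm N k).measurable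

lemma zNorm_sub_le {N k : ℕ} (x y : Euc N) : |zNorm N k x - zNorm N k y| ≤ ‖x - y‖ := by
  rw [zNorm_eq, zNorm_eq]
  refine (abs_norm_sub_norm_le _ _).trans ?_
  rw [← map_sub]
  exact zP_norm_le _

lemma zNorm_null {N k : ℕ} (hk : k < N) : ∀ᵐ x : Euc N, 0 < zNorm N k x := by
  have h : volume ((LinearMap.ker (zP N k).toLinearMap : Submodule ℝ (Euc N)) : Set (Euc N)) = 0 := by
    apply Measure.addHaar_submodule
    intro htop
    have h1 : (EuclideanSpace.single (⟨k, hk⟩ : Fin N) (1 : ℝ)) ∈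
        (LinearMap.ker (zP N k).toLinearMap : Submodule ℝ (Euc N)) := by rw [htop]; trivial
    have h2 : zP N k (EuclideanSpace.single (⟨k, hk⟩ : Fin N) (1 : ℝ)) = 0 := h1
    have h3 := zP_apply (k := k) (EuclideanSpace.single (⟨k, hk⟩ : Fin N) (1 : ℝ)) ⟨k, hk⟩
    rw [h2] at h3
    simp at h3
  rw [ae_iff]
  refine measure_mono_null ?_ h
  intro x hx
  simp only [mem_setOf_eq, not_lt] at hx
  have : zNorm N k x = 0 := le_antisymm hx (zNorm_nonneg x)
  rw [zNorm_eq, norm_eq_zero] at this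
  exact this

/-- The weight `|z|^{-σ}`. -/
def wt (N k : ℕ) (σ : ℝ) (x : Euc N) : ℝ≥0∞ := ENNReal.ofReal (zNorm N k x ^ (-σ))

lemma measurable_wt (N k : ℕ) (σ : ℝ) : Measurable (wt N k σ) :=
  ((measurable_zNorm N k).pow_const _).ennreal_ofReal

lemma wt_ne_top {N k : ℕ} {σ : ℝ} (x : Euc N) : wt N k σ x ≠ ⊤ := ENNReal.ofReal_ne_top

lemma wt_pos {N k : ℕ} {σ : ℝ} {x : Euc N} (hx : 0 < zNorm N k x) : 0 < wt N k σ x := by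
  rw [wt, ENNReal.ofReal_pos]; positivity

/-- Hardy-Sobolev integral over a set. -/
def AE (N k : ℕ) (σ : ℝ) (u : Euc N → ℝ) (Ω : Set (Euc N)) : ℝ≥0∞ :=
  ∫⁻ x in Ω, wt N k σ x * ‖u x‖ₑ ^ twoStar N σ

/-- Dirichlet energy. -/
def DE {N : ℕ} (u : Euc N → ℝ) : ℝ≥0∞ := ∫⁻ x, ‖fderiv ℝ u x‖ₑ ^ 2

lemma twoStar_gt {N : ℕ} {σ : ℝ} (hN : 3 ≤ N) (hσ : σ < 2) : 2 < twoStar N σ := by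
  have : (3 : ℝ) ≤ N := by exact_mod_cast hN
  rw [twoStar, lt_div_iff₀ (by linarith)]; linarith

lemma twoStar_pos {N : ℕ} {σ : ℝ} (hN : 3 ≤ N) (hσ : σ < 2) : 0 < twoStar N σ :=
  by linarith [twoStar_gt hN hσ]

lemma twoStar_comb {N : ℕ} (hN : 3 ≤ N) (a b θ : ℝ) :
    twoStar N (θ * a + (1 - θ) * b) = θ * twoStar N a + (1 - θ) * twoStar N b := by
  have : (3 : ℝ) ≤ N := by exact_mod_cast hN
  have h : (N : ℝ) - 2 ≠ 0 := by linarith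
  simp only [twoStar]; field_simp; ring

lemma wt_comb {N k : ℕ} {a b θ : ℝ} (h0 : 0 ≤ θ) (h1 : θ ≤ 1) {x : Euc N}
    (hx : 0 < zNorm N k x) :
    wt N k (θ * a + (1 - θ) * b) x = wt N k a x ^ θ * wt N k b x ^ (1 - θ) := by
  rw [wt, wt, wt, ENNReal.ofReal_rpow_of_pos (by positivity),
    ENNReal.ofReal_rpow_of_pos (by positivity), ← ENNReal.ofReal_mul (by positivity),
    ← Real.rpow_mul hx.le, ← Real.rpow_mul hx.le, ← Real.rpow_add hx]
  congr 2; ring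

lemma AE_interp {N k : ℕ} (hN : 3 ≤ N) (hk : k < N) {a b θ : ℝ} (h0 : 0 ≤ θ) (h1 : θ ≤ 1)
    (ha : a < 2) (hb : b < 2)
    {u : Euc N → ℝ} (hu : AEStronglyMeasurable u volume) (Ω : Set (Euc N)) :
    AE N k (θ * a + (1 - θ) * b) u Ω ≤ AE N k a u Ω ^ θ * AE N k b u Ω ^ (1 - θ) := by
  unfold AE
  have hm : ∀ c : ℝ, AEMeasurable (fun x => wt N k c x * ‖u x‖ₑ ^ twoStar N c) (volume.restrict Ω) := by
    intro c
    exact ((measurable_wt N k c).aemeasurable).mul (hu.restrict.enorm.pow_const _)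
  refine le_trans (le_of_eq ?_) (ENNReal.lintegral_mul_norm_pow_le (hm a) (hm b) h0
    (by linarith : 0 ≤ 1 - θ) (by ring))
  apply lintegral_congr_ae
  filter_upwards [ae_restrict_of_ae (zNorm_null hk)] with x hx
  rw [wt_comb h0 h1 hx, twoStar_comb hN, ENNReal.mul_rpow_of_nonneg _ _ h0,
    ENNReal.mul_rpow_of_nonneg _ _ (by linarith : 0 ≤ 1 - θ), ← ENNReal.rpow_mul, ← ENNReal.rpow_mul,
    ENNReal.rpow_add_of_nonneg _ _ (mul_nonneg h0 (twoStar_pos hN ha).le)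
      (mul_nonneg (by linarith) (twoStar_pos hN hb).le), mul_comm θ, mul_comm (1 - θ)]
  ring

lemma Sm.cont {N : ℕ} {φ : Euc N → ℝ} (h : Sm φ) : Continuous φ := h.1.continuous
lemma Sm.c1 {N : ℕ} {φ : Euc N → ℝ} (h : Sm φ) : ContDiff ℝ 1 φ := h.1.of_le (by norm_cast)
lemma Sm.diff {N : ℕ} {φ : Euc N → ℝ} (h : Sm φ) : Differentiable ℝ φ := h.c1.differentiable (by norm_num)
lemma Sm.contD {N : ℕ} {φ : Euc N → ℝ} (h : Sm φ) : Continuous (fderiv ℝ φ) :=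
  h.c1.continuous_fderiv (by norm_num)
lemma Sm.asm {N : ℕ} {φ : Euc N → ℝ} (h : Sm φ) : AEStronglyMeasurable φ volume :=
  h.cont.aestronglyMeasurable

/-- Sobolev exponent -/
lemma sob {N : ℕ} (hN : 3 ≤ N) : ∃ C : ℝ≥0, ∀ φ : Euc N → ℝ, Sm φ →
    eLpNorm φ (ENNReal.ofReal (2 * (N : ℝ) / ((N : ℝ) - 2))) volume ≤
      C * eLpNorm (fderiv ℝ φ) 2 volume := by
  have hN' : (3 : ℝ) ≤ N := by exact_mod_cast hN
  refine ⟨SNormLESNormFDerivOfEqConst ℝ (volume : Measure (Euc N)) 2, fun φ hφ => ?_⟩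
  have := eLpNorm_le_eLpNorm_fderiv_of_eq (μ := (volume : Measure (Euc N))) hφ.c1 hφ.2 (p := 2)
    (p' := Real.toNNReal (2 * (N : ℝ) / ((N : ℝ) - 2))) (by norm_num) (by simp; omega)
    (by
      rw [Real.coe_toNNReal _ (div_nonneg (by linarith) (by linarith))]
      simp
      field_simp)
  exact this

lemma twoStar_zero {N : ℕ} : twoStar N 0 = 2 * (N : ℝ) / ((N : ℝ) - 2) := by simp [twoStar]

lemma eLpNorm_two_eq {N : ℕ} {F : Type*} [NormedAddCommGroup F] (g : Euc N → F) :
    eLpNorm g 2 volume = (∫⁻ x, ‖g x‖ₑ ^ 2) ^ (1 / 2 : ℝ) := by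
  rw [eLpNorm_eq_lintegral_rpow_enorm_toReal (by norm_num) (by norm_num)]
  simp

lemma AE_zero_eq {N k : ℕ} (hN : 3 ≤ N) (u : Euc N → ℝ) :
    AE N k 0 u univ = eLpNorm u (ENNReal.ofReal (2 * (N : ℝ) / ((N : ℝ) - 2))) volume
      ^ twoStar N 0 := by
  have hN' : (3 : ℝ) ≤ N := by exact_mod_cast hN
  have hp : 0 < twoStar N 0 := twoStar_pos hN (by norm_num)
  rw [← twoStar_zero, eLpNorm_eq_lintegral_rpow_enorm_toReal (by simpa using hp) (by simp),
    ENNReal.toReal_ofReal hp.le, ← ENNReal.rpow_mul, one_div, inv_mul_cancel₀ hp.ne']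
  simp [AE, wt]

/-- Sobolev in AE form, on bounded energy. -/
lemma AE_zero_bdd {N k : ℕ} (hN : 3 ≤ N) (M : ℝ≥0) : ∃ C : ℝ≥0, ∀ φ : Euc N → ℝ, Sm φ →
    DE φ ≤ M → AE N k 0 φ univ ≤ C := by
  obtain ⟨C, hC⟩ := sob hN
  have hp : 0 < twoStar N 0 := twoStar_pos hN (by norm_num)
  refine ⟨(C * M ^ (1/2 : ℝ)) ^ twoStar N 0, fun φ hφ h => ?_⟩
  rw [AE_zero_eq hN]
  rw [ENNReal.coe_rpow_of_nonneg _ hp.le]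
  gcongr
  refine (hC φ hφ).trans ?_
  rw [eLpNorm_two_eq]
  push_cast
  rw [ENNReal.coe_rpow_of_nonneg _ (by norm_num)]
  gcongr
  exact h


lemma ennreal_absorb {a K : ℝ≥0∞} {t : ℝ} (ha : a ≠ ⊤) (h : a ≤ K * a ^ t) (ht : 0 ≤ t) (ht1 : t < 1) :
    a ≤ K ^ (1 / (1 - t)) := by
  rcases eq_or_ne a 0 with h0 | h0
  · rw [h0]; exact zero_le
  have h1 : a ^ (1 - t) ≤ K := by
    have e : a ^ (1 - t) = a * a ^ (-t) := by
      rw [sub_eq_add_neg, ENNReal.rpow_add _ _ h0 ha, ENNReal.rpow_one]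
    have e2 : a ^ t * a ^ (-t) = 1 := by
      rw [← ENNReal.rpow_add _ _ h0 ha]; simp
    calc a ^ (1 - t) = a * a ^ (-t) := e
      _ ≤ K * a ^ t * a ^ (-t) := by gcongr
      _ = K := by rw [mul_assoc, e2, mul_one]
  calc a = (a ^ (1 - t)) ^ (1 / (1 - t)) := by
        rw [← ENNReal.rpow_mul, mul_one_div_cancel (by linarith), ENNReal.rpow_one]
    _ ≤ _ := by
        apply ENNReal.rpow_le_rpow h1
        apply div_nonneg <;> linarith

/-- regularized square -/
def Wr (N k : ℕ) (ε : ℝ) (x : Euc N) : ℝ := ‖zP N k x‖ ^ 2 + ε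

lemma Wr_pos {N k : ℕ} {ε : ℝ} (hε : 0 < ε) (x : Euc N) : 0 < Wr N k ε x := by
  unfold Wr; positivity

lemma contDiff_Wr (N k : ℕ) (ε : ℝ) {n} : ContDiff ℝ n (Wr N k ε) := by
  unfold Wr
  exact ((contDiff_norm_sq ℝ).comp (zP N k).contDiff).add contDiff_const

lemma zP_inner_single {N k : ℕ} (x : Euc N) (i : Fin N) :
    inner ℝ (zP N k x) (zP N k (EuclideanSpace.single i 1)) = zP N k x i := by
  rw [PiLp.inner_apply]
  simp only [zP_apply, RCLike.inner_apply, conj_trivial]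
  rw [Finset.sum_eq_single i]
  · simp; intro h1 h2; omega
  · intro j _ hj
    simp [hj]
  · simp

lemma zP_single_sum {N k : ℕ} (hk : k ≤ N) :
    ∑ i : Fin N, zP N k (EuclideanSpace.single i 1) i = (N : ℝ) - k := by
  simp only [zP_apply, EuclideanSpace.single_apply, if_true]
  rw [Finset.sum_ite]
  simp only [Finset.sum_const_zero, add_zero, Finset.sum_const, nsmul_eq_mul, mul_one]
  have h2 : (Finset.univ.filter (fun i : Fin N => k ≤ (i : ℕ))).card = N - k := by
    have h1 := Fin.card_filter_val_lt (n := N) (m := k)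
    have h3 := Finset.card_filter_add_card_filter_not (s := (Finset.univ : Finset (Fin N)))
      (fun i : Fin N => (i : ℕ) < k)
    simp only [not_lt, Finset.card_univ, Fintype.card_fin] at h3
    omega
  rw [h2, Nat.cast_sub hk]

lemma fderiv_Gi {N k : ℕ} {ε s : ℝ} (hε : 0 < ε) (x : Euc N) (i : Fin N) :
    fderiv ℝ (fun y => Wr N k ε y ^ (-s) * zP N k y i) x (EuclideanSpace.single i 1) =
      Wr N k ε x ^ (-s) * zP N k (EuclideanSpace.single i 1) i
        - 2 * s * Wr N k ε x ^ (-s - 1) * (zP N k x i) ^ 2 := by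
  have hW : HasFDerivAt (Wr N k ε) (2 • (innerSL ℝ (zP N k x)).comp (zP N k)) x := by
    have := ((zP N k).hasFDerivAt (x := x)).norm_sq.add_const ε
    exact this
  have h1 := hW.rpow_const (p := -s) (Or.inl (Wr_pos hε x).ne')
  have h2 : HasFDerivAt (fun y => zP N k y i) ((EuclideanSpace.proj i).comp (zP N k)) x :=
    ((EuclideanSpace.proj (𝕜 := ℝ) i).comp (zP N k)).hasFDerivAt (x := x)
  have h4 : fderiv ℝ (fun y => Wr N k ε y ^ (-s) * zP N k y i) x = _ := (h1.mul h2).fderiv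
  rw [h4]
  have h3 := zP_inner_single (k := k) x i
  simp only [ContinuousLinearMap.add_apply, ContinuousLinearMap.smul_apply, ContinuousLinearMap.comp_apply,
    innerSL_apply_apply, h3, smul_eq_mul]
  simp
  ring

lemma div_ge {N k : ℕ} (hk : k + 2 ≤ N) {ε σ : ℝ} (hε : 0 < ε) (hσ : 0 ≤ σ) (x : Euc N) :
    (2 - σ) * Wr N k ε x ^ (-(σ/2)) ≤
    ∑ i : Fin N, fderiv ℝ (fun y => Wr N k ε y ^ (-(σ/2)) * zP N k y i) x
      (EuclideanSpace.single i 1) := by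
  simp_rw [fderiv_Gi hε]
  rw [Finset.sum_sub_distrib, ← Finset.mul_sum, ← Finset.mul_sum, zP_single_sum (by omega)]
  have h1 : ∑ i : Fin N, (zP N k x i) ^ 2 = ‖zP N k x‖ ^ 2 := by
    rw [EuclideanSpace.norm_sq_eq]; simp
  rw [h1]
  have hW := Wr_pos (k := k) hε x
  have h2 : Wr N k ε x ^ (-(σ/2) - 1) * ‖zP N k x‖ ^ 2 ≤ Wr N k ε x ^ (-(σ/2)) := by
    rw [Real.rpow_sub_one hW.ne', div_mul_eq_mul_div, div_le_iff₀ hW]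
    gcongr
    unfold Wr; linarith
  have h3 : (2 : ℝ) ≤ N - k := by
    have : ((k + 2 : ℕ) : ℝ) ≤ N := by exact_mod_cast hk
    push_cast at this; linarith
  have h4 : 0 ≤ Wr N k ε x ^ (-(σ/2)) := by positivity
  nlinarith

lemma HS_reg_real {N k : ℕ} (hk : k + 2 ≤ N) {ε σ q : ℝ} (hε : 0 < ε) (hσ : 1 ≤ σ) (hq : 1 < q)
    {φ : Euc N → ℝ} (hφ : Sm φ) :
    (2 - σ) * ∫ x, Wr N k ε x ^ (-(σ/2)) * ‖φ x‖ ^ q ≤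
      ∫ x, q * (Wr N k ε x ^ ((1 - σ)/2) * (‖φ x‖ ^ (q - 1) * ‖fderiv ℝ φ x‖)) := by
  set f : Euc N → ℝ := fun x => ‖φ x‖ ^ q with hf
  have hf1 : ContDiff ℝ 1 f := hφ.c1.norm_rpow hq
  have hfs : HasCompactSupport f := by
    apply hφ.2.comp_left (g := fun t : ℝ => ‖t‖ ^ q)
    simp [Real.zero_rpow (by linarith : q ≠ 0)]
  have hfd : HasCompactSupport (fderiv ℝ f) := hfs.fderiv ℝ
  have hfdc : Continuous (fderiv ℝ f) := hf1.continuous_fderiv (by norm_num)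
  have hWc : ∀ s : ℝ, Continuous (fun x => Wr N k ε x ^ s) := fun s =>
    (contDiff_Wr N k ε (n := 0)).continuous.rpow_const (fun x => Or.inl (Wr_pos hε x).ne')
  have hG : ∀ i, ContDiff ℝ 1 (fun y => Wr N k ε y ^ (-(σ/2)) * zP N k y i) := by
    intro i
    apply ContDiff.mul
    · exact (contDiff_Wr N k ε).rpow_const_of_ne (fun x => (Wr_pos hε x).ne')
    · exact ((EuclideanSpace.proj (𝕜 := ℝ) i).comp (zP N k)).contDiff
  have hGd : ∀ i, Continuous (fderiv ℝ (fun y => Wr N k ε y ^ (-(σ/2)) * zP N k y i)) :=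
    fun i => (hG i).continuous_fderiv (by norm_num)
  have I1 : ∀ i, Integrable (fun x => f x * fderiv ℝ (fun y => Wr N k ε y ^ (-(σ/2)) * zP N k y i) x
      (EuclideanSpace.single i 1)) := fun i =>
    (hf1.continuous.mul ((hGd i).clm_apply continuous_const)).integrable_of_hasCompactSupport
      hfs.mul_right
  have hcs : ∀ v : Euc N, HasCompactSupport (fun x => fderiv ℝ f x v) := fun v =>
    hfd.comp_left (g := fun L : Euc N →L[ℝ] ℝ => L v) (by simp)
  have I2 : ∀ i, Integrable (fun x => fderiv ℝ f x (EuclideanSpace.single i 1) *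
      (Wr N k ε x ^ (-(σ/2)) * zP N k x i)) := fun i =>
    ((hfdc.clm_apply continuous_const).mul (hG i).continuous).integrable_of_hasCompactSupport
      (hcs _).mul_right
  have ibp : ∀ i, ∫ x, f x * fderiv ℝ (fun y => Wr N k ε y ^ (-(σ/2)) * zP N k y i) x
      (EuclideanSpace.single i 1) = - ∫ x, fderiv ℝ f x (EuclideanSpace.single i 1) *
      (Wr N k ε x ^ (-(σ/2)) * zP N k x i) := by
    intro i
    apply integral_mul_fderiv_eq_neg_fderiv_mul_of_integrable (I2 i) (I1 i)
    · exact (hf1.continuous.mul (hG i).continuous).integrable_of_hasCompactSupport hfs.mul_right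
    · exact fun x _ => hf1.differentiable (by norm_num) x
    · exact fun x _ => (hG i).differentiable (by norm_num) x
  calc (2 - σ) * ∫ x, Wr N k ε x ^ (-(σ/2)) * ‖φ x‖ ^ q
      = ∫ x, f x * ((2 - σ) * Wr N k ε x ^ (-(σ/2))) := by
        rw [← integral_const_mul]; congr 1; ext x; simp only [hf]; ring
    _ ≤ ∫ x, f x * ∑ i : Fin N, fderiv ℝ (fun y => Wr N k ε y ^ (-(σ/2)) * zP N k y i) x
      (EuclideanSpace.single i 1) := by
        apply integral_mono
        · exact (hf1.continuous.mul (continuous_const.mul (hWc _))).integrable_of_hasCompactSupport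
            hfs.mul_right
        · simp_rw [Finset.mul_sum]
          exact integrable_finset_sum _ (fun i _ => I1 i)
        · intro x
          apply mul_le_mul_of_nonneg_left (div_ge hk hε (by linarith) x)
          simp only [hf]; positivity
    _ = ∫ x, - ∑ i : Fin N, fderiv ℝ f x (EuclideanSpace.single i 1) *
      (Wr N k ε x ^ (-(σ/2)) * zP N k x i) := by
        simp_rw [Finset.mul_sum]
        rw [integral_finset_sum _ (fun i _ => I1 i), integral_neg,
          integral_finset_sum _ (fun i _ => I2 i), ← Finset.sum_neg_distrib]
        exact Finset.sum_congr rfl (fun i _ => ibp i)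
    _ ≤ _ := by
        apply integral_mono
        · exact (integrable_finset_sum _ (fun i _ => I2 i)).neg
        · apply Continuous.integrable_of_hasCompactSupport
          · exact continuous_const.mul ((hWc _).mul
              ((hφ.cont.norm.rpow_const (fun x => Or.inr (by linarith))).mul hφ.contD.norm))
          · apply HasCompactSupport.mul_left
            apply HasCompactSupport.mul_left
            apply HasCompactSupport.mul_left
            exact (hφ.2.fderiv ℝ).norm
        · intro x
          have e1 : ∑ i : Fin N, fderiv ℝ f x (EuclideanSpace.single i 1) *
              (Wr N k ε x ^ (-(σ/2)) * zP N k x i) = Wr N k ε x ^ (-(σ/2)) *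
                fderiv ℝ f x (zP N k x) := by
            have : zP N k x = ∑ i : Fin N, zP N k x i • EuclideanSpace.single i (1 : ℝ) := by
              ext j
              simp [Finset.sum_apply, Pi.single_apply]
            conv_rhs => rw [this]
            rw [map_sum, Finset.mul_sum]
            apply Finset.sum_congr rfl
            intro i _
            rw [map_smul, smul_eq_mul]; ring
          have hW := Wr_pos (k := k) hε x
          have e2 : ‖fderiv ℝ f x‖ ≤ q * ‖φ x‖ ^ (q - 1) * ‖fderiv ℝ φ x‖ :=
            norm_fderiv_norm_rpow_le hφ.diff hq
          have e3 : ‖zP N k x‖ ≤ Wr N k ε x ^ (1/2 : ℝ) := by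
            rw [← Real.sqrt_eq_rpow]
            apply Real.le_sqrt_of_sq_le
            unfold Wr; linarith
          have e4 : Wr N k ε x ^ ((1 - σ)/2) = Wr N k ε x ^ (-(σ/2)) * Wr N k ε x ^ (1/2 : ℝ) := by
            rw [← Real.rpow_add hW]; congr 1; ring
          simp only [e1]
          calc -(Wr N k ε x ^ (-(σ/2)) * fderiv ℝ f x (zP N k x))
              ≤ Wr N k ε x ^ (-(σ/2)) * ‖fderiv ℝ f x (zP N k x)‖ := by
                rw [← mul_neg]
                apply mul_le_mul_of_nonneg_left _ (by positivity)
                exact neg_le_abs _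
            _ ≤ Wr N k ε x ^ (-(σ/2)) * ((q * ‖φ x‖ ^ (q - 1) * ‖fderiv ℝ φ x‖) *
                  Wr N k ε x ^ (1/2 : ℝ)) := by
                gcongr
                refine ((fderiv ℝ f x).le_opNorm _).trans ?_
                gcongr
            _ = _ := by rw [e4]; ring

lemma HS_pt {N : ℕ} (hN : 3 ≤ N) {σ W : ℝ} (hσ : 1 ≤ σ) (hσ2 : σ < 2) (hW : 0 < W) (a : ℝ≥0∞) :
    ((ENNReal.ofReal (W ^ (-(σ/2))) * a ^ twoStar N σ) ^ ((2 * σ - 2) / σ) *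
      (a ^ twoStar N 0) ^ (1 - (2 * σ - 2) / σ)) ^ (1/2 : ℝ) =
    ENNReal.ofReal (W ^ ((1 - σ)/2)) * a ^ (twoStar N σ - 1) := by
  have hθ0 : 0 ≤ (2 * σ - 2) / σ := div_nonneg (by linarith) (by linarith)
  have hθ1 : (2 * σ - 2) / σ < 1 := by rw [div_lt_one (by linarith)]; linarith
  have hq := twoStar_gt hN hσ2
  have hN' : (3 : ℝ) ≤ N := by exact_mod_cast hN
  have h1 : (N : ℝ) - 2 ≠ 0 := by linarith
  have h2 : σ ≠ 0 := by linarith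
  have e1 : -(σ/2) * ((2 * σ - 2) / σ) * (1/2) = (1 - σ)/2 := by field_simp; ring
  have e2 : (twoStar N σ * ((2 * σ - 2) / σ) + twoStar N 0 * (1 - (2 * σ - 2) / σ)) * (1/2)
      = twoStar N σ - 1 := by rw [twoStar, twoStar]; field_simp; ring
  rw [ENNReal.mul_rpow_of_nonneg _ _ hθ0, ENNReal.ofReal_rpow_of_pos (Real.rpow_pos_of_pos hW _),
    ← Real.rpow_mul hW.le, mul_assoc, ← ENNReal.rpow_mul, ← ENNReal.rpow_mul,
    ← ENNReal.rpow_add_of_nonneg _ _ (mul_nonneg (by linarith) hθ0)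
      (mul_nonneg (twoStar_pos hN (by norm_num)).le (by linarith)),
    ENNReal.mul_rpow_of_nonneg _ _ (by norm_num),
    ENNReal.ofReal_rpow_of_pos (Real.rpow_pos_of_pos hW _),
    ← Real.rpow_mul hW.le, ← ENNReal.rpow_mul, e1, e2]

set_option maxHeartbeats 1000000 in
lemma HS_one {N k : ℕ} (hN : 3 ≤ N) (hk : k + 2 ≤ N) {σ : ℝ} (hσ : 1 ≤ σ) (hσ2 : σ < 2) (M : ℝ≥0) :
    ∃ C : ℝ≥0, ∀ φ : Euc N → ℝ, Sm φ → DE φ ≤ M → AE N k σ φ univ ≤ C := by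
  obtain ⟨C0, hC0⟩ := AE_zero_bdd (k := k) hN M
  set q := twoStar N σ with hq
  have hq2 : 2 < q := twoStar_gt hN hσ2
  set θ : ℝ := (2 * σ - 2) / σ with hθ
  have hθ0 : 0 ≤ θ := div_nonneg (by linarith) (by linarith)
  have hθ1 : θ < 1 := by rw [hθ, div_lt_one (by linarith)]; linarith
  set K : ℝ≥0 := Real.toNNReal (q / (2 - σ)) * M ^ (1/2 : ℝ) * C0 ^ ((1 - θ) * (1/2)) with hK
  refine ⟨K ^ (1 / (1 - θ/2)), fun φ hφ hD => ?_⟩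
  -- regularized bound
  have key : ∀ ε : ℝ, 0 < ε → ∫⁻ x, ENNReal.ofReal (Wr N k ε x ^ (-(σ/2))) * ‖φ x‖ₑ ^ q ≤
      (K : ℝ≥0∞) ^ (1 / (1 - θ/2)) := by
    intro ε hε
    have hWc : ∀ s : ℝ, Continuous (fun x => Wr N k ε x ^ s) := fun s =>
      (contDiff_Wr N k ε (n := 0)).continuous.rpow_const (fun x => Or.inl (Wr_pos hε x).ne')
    have hcq : Continuous (fun x => ‖φ x‖ ^ q) := hφ.cont.norm.rpow_const (fun x => Or.inr (by linarith))
    have hcq1 : Continuous (fun x => ‖φ x‖ ^ (q - 1)) :=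
      hφ.cont.norm.rpow_const (fun x => Or.inr (by linarith))
    have hIntg : Integrable (fun x => Wr N k ε x ^ (-(σ/2)) * ‖φ x‖ ^ q) := by
      apply Continuous.integrable_of_hasCompactSupport
      · exact (hWc _).mul hcq
      · apply HasCompactSupport.mul_left
        apply hφ.2.comp_left (g := fun t : ℝ => ‖t‖ ^ q)
        simp [Real.zero_rpow (by linarith : q ≠ 0)]
    have hint2 : Integrable (fun x => q * (Wr N k ε x ^ ((1 - σ)/2) *
        (‖φ x‖ ^ (q - 1) * ‖fderiv ℝ φ x‖))) := by
      apply Continuous.integrable_of_hasCompactSupport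
      · exact continuous_const.mul ((hWc _).mul (hcq1.mul hφ.contD.norm))
      · apply HasCompactSupport.mul_left
        apply HasCompactSupport.mul_left
        apply HasCompactSupport.mul_left
        exact (hφ.2.fderiv ℝ).norm
    have e1 : ∫⁻ x, ENNReal.ofReal (Wr N k ε x ^ (-(σ/2))) * ‖φ x‖ₑ ^ q =
        ENNReal.ofReal (∫ x, Wr N k ε x ^ (-(σ/2)) * ‖φ x‖ ^ q) := by
      rw [ofReal_integral_eq_lintegral_ofReal hIntg
        (ae_of_all _ (fun x => mul_nonneg (Real.rpow_nonneg (Wr_pos hε x).le _) (by positivity)))]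
      congr 1; ext x
      rw [ENNReal.ofReal_mul (Real.rpow_nonneg (Wr_pos hε x).le _),
        ← ENNReal.ofReal_rpow_of_nonneg (norm_nonneg _) (by linarith), ofReal_norm]
    set Aε := ∫⁻ x, ENNReal.ofReal (Wr N k ε x ^ (-(σ/2))) * ‖φ x‖ₑ ^ q with hA
    have hAtop : Aε ≠ ⊤ := by rw [e1]; exact ENNReal.ofReal_ne_top
    have step1 : Aε ≤ ENNReal.ofReal (q / (2 - σ)) * ∫⁻ x, ‖fderiv ℝ φ x‖ₑ *
        (ENNReal.ofReal (Wr N k ε x ^ ((1 - σ)/2)) * ‖φ x‖ₑ ^ (q - 1)) := by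
      have h := HS_reg_real hk hε hσ (by linarith : 1 < q) hφ
      have h' : ∫ x, Wr N k ε x ^ (-(σ/2)) * ‖φ x‖ ^ q ≤ (1 / (2 - σ)) *
          ∫ x, q * (Wr N k ε x ^ ((1 - σ)/2) * (‖φ x‖ ^ (q - 1) * ‖fderiv ℝ φ x‖)) := by
        rw [one_div, ← div_eq_inv_mul, le_div_iff₀ (by linarith)]
        linarith
      rw [e1]
      refine (ENNReal.ofReal_le_ofReal h').trans (le_of_eq ?_)
      rw [integral_const_mul, ← mul_assoc, one_div_mul_eq_div,
        ENNReal.ofReal_mul (div_nonneg (by linarith) (by linarith))]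
      congr 1
      rw [ofReal_integral_eq_lintegral_ofReal]
      · congr 1; ext x
        rw [ENNReal.ofReal_mul (Real.rpow_nonneg (Wr_pos hε x).le _),
          ENNReal.ofReal_mul (by positivity),
          ← ENNReal.ofReal_rpow_of_nonneg (norm_nonneg _) (by linarith), ofReal_norm, ofReal_norm]
        ring
      · have := hint2.const_mul (1/q)
        refine this.congr (ae_of_all _ fun x => ?_)
        have : q ≠ 0 := by linarith
        simp only; field_simp
      · exact ae_of_all _ (fun x => mul_nonneg (Real.rpow_nonneg (Wr_pos hε x).le _) (by positivity))
    have m1 : AEMeasurable (fun x => ‖fderiv ℝ φ x‖ₑ ^ 2) volume :=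
      (hφ.contD.enorm.measurable.pow_const 2).aemeasurable
    have m3 : Measurable (fun x => ENNReal.ofReal (Wr N k ε x ^ (-(σ/2))) * ‖φ x‖ₑ ^ q) :=
      (hWc _).measurable.ennreal_ofReal.mul (hφ.cont.enorm.measurable.pow_const _)
    have m4 : Measurable (fun x => ‖φ x‖ₑ ^ twoStar N 0) := hφ.cont.enorm.measurable.pow_const _
    have step2 : ∫⁻ x, ‖fderiv ℝ φ x‖ₑ *
        (ENNReal.ofReal (Wr N k ε x ^ ((1 - σ)/2)) * ‖φ x‖ₑ ^ (q - 1)) ≤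
        (DE φ) ^ (1/2 : ℝ) * (Aε ^ θ * (AE N k 0 φ univ) ^ (1 - θ)) ^ (1/2 : ℝ) := by
      have h1 := ENNReal.lintegral_mul_norm_pow_le m1 (g := fun x =>
        (ENNReal.ofReal (Wr N k ε x ^ (-(σ/2))) * ‖φ x‖ₑ ^ q) ^ θ * (‖φ x‖ₑ ^ twoStar N 0) ^ (1 - θ))
        ((m3.pow_const _).mul (m4.pow_const _)).aemeasurable (p := 1/2) (q := 1/2) (by norm_num) (by norm_num) (by norm_num)
      have h2 := ENNReal.lintegral_mul_norm_pow_le (μ := volume) m3.aemeasurable m4.aemeasurable hθ0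
        (by linarith : 0 ≤ 1 - θ) (by ring)
      have hA0 : AE N k 0 φ univ = ∫⁻ x, ‖φ x‖ₑ ^ twoStar N 0 := by simp [AE, wt]
      refine le_trans (le_of_eq ?_) (h1.trans ?_)
      · congr 1; ext x
        have hW := Wr_pos (k := k) hε x
        congr 1
        · rw [← ENNReal.rpow_natCast, ← ENNReal.rpow_mul]; simp
        · exact (HS_pt hN hσ hσ2 hW _).symm
      · unfold DE
        rw [hA0]
        gcongr
    have hθ2 : (0:ℝ) ≤ (1 - θ) * (1/2) := by nlinarith
    have step3 : Aε ≤ K * Aε ^ (θ/2) := by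
      refine (step1.trans (mul_le_mul_right step2 _)).trans ?_
      rw [ENNReal.mul_rpow_of_nonneg _ _ (by norm_num : (0:ℝ) ≤ 1/2), ← ENNReal.rpow_mul,
        ← ENNReal.rpow_mul, hK]
      push_cast
      rw [ENNReal.coe_rpow_of_nonneg _ (by norm_num), ENNReal.coe_rpow_of_nonneg _ hθ2,
        mul_one_div θ 2]
      calc _ ≤ ENNReal.ofReal (q / (2 - σ)) * ((M : ℝ≥0∞) ^ (1/2 : ℝ) * (Aε ^ (θ/2) *
            (C0 : ℝ≥0∞) ^ ((1 - θ) * (1/2)))) := by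
            gcongr
            exact hC0 φ hφ hD
        _ = _ := by rw [ENNReal.ofReal]; ring
    exact ennreal_absorb hAtop step3 (by linarith) (by linarith)
  -- Fatou
  rw [ENNReal.coe_rpow_of_nonneg _ (by apply div_nonneg <;> linarith)]
  set εn : ℕ → ℝ := fun n => 1 / ((n : ℝ) + 1)
  have hεn : ∀ n, 0 < εn n := fun n => by positivity
  have hlim : AE N k σ φ univ ≤ ∫⁻ x, liminf (fun n => ENNReal.ofReal (Wr N k (εn n) x ^ (-(σ/2)))
      * ‖φ x‖ₑ ^ q) atTop := by
    unfold AE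
    rw [Measure.restrict_univ]
    apply lintegral_mono_ae
    filter_upwards [zNorm_null (N := N) (k := k) (by omega)] with x hx
    apply le_of_eq
    symm
    apply Tendsto.liminf_eq
    apply ENNReal.Tendsto.mul_const
    · rw [wt]
      apply ENNReal.tendsto_ofReal
      have e : zNorm N k x ^ (-σ) = (‖zP N k x‖ ^ 2 + 0) ^ (-(σ/2)) := by
        rw [zNorm_eq, add_zero, ← Real.rpow_natCast, ← Real.rpow_mul (norm_nonneg _)]
        congr 1; push_cast; ring
      rw [e]
      unfold Wr
      apply Tendsto.rpow_const
      · exact tendsto_const_nhds.add tendsto_one_div_add_atTop_nhds_zero_nat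
      · left
        rw [zNorm_eq] at hx
        positivity
    · right
      exact ENNReal.rpow_ne_top_of_nonneg (by linarith) enorm_ne_top
  refine hlim.trans ((lintegral_liminf_le ?_).trans ?_)
  · intro n
    exact ((((contDiff_Wr N k (εn n) (n := 0)).continuous.rpow_const
      (fun x => Or.inl (Wr_pos (hεn n) x).ne')).measurable.ennreal_ofReal).mul
        (hφ.cont.enorm.measurable.pow_const _))
  · refine (liminf_le_liminf (v := fun _ => (K : ℝ≥0∞) ^ (1 / (1 - θ/2)))
      (Eventually.of_forall fun n => key (εn n) (hεn n))).trans ?_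
    rw [liminf_const]

lemma HS_bdd {N k : ℕ} (hN : 3 ≤ N) (hk : k + 2 ≤ N) {σ : ℝ} (hσ : 0 ≤ σ) (hσ2 : σ < 2) (M : ℝ≥0) :
    ∃ C : ℝ≥0, ∀ φ : Euc N → ℝ, Sm φ → DE φ ≤ M → AE N k σ φ univ ≤ C := by
  obtain ⟨C0, hC0⟩ := AE_zero_bdd (k := k) hN M
  obtain ⟨C1, hC1⟩ := HS_one hN hk (σ := (σ + 2)/2) (by linarith) (by linarith) M
  set θ := σ / ((σ + 2)/2) with hθ
  have hθ0 : 0 ≤ θ := by positivity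
  have hθ1 : θ ≤ 1 := by rw [hθ, div_le_one (by linarith)]; linarith
  have hθ2 : 0 ≤ 1 - θ := by linarith
  refine ⟨C1 ^ θ * C0 ^ (1 - θ), fun φ hφ hD => ?_⟩
  have h := AE_interp hN (by omega : k < N) hθ0 hθ1 (by linarith : (σ + 2)/2 < 2) (by norm_num : (0:ℝ) < 2)
    hφ.asm univ
  have e : θ * ((σ + 2)/2) + (1 - θ) * 0 = σ := by rw [hθ]; field_simp; ring
  rw [e] at h
  refine h.trans ?_
  push_cast
  rw [ENNReal.coe_rpow_of_nonneg _ hθ0, ENNReal.coe_rpow_of_nonneg _ hθ2]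
  gcongr
  · exact hC1 φ hφ hD
  · exact hC0 φ hφ hD


/-- local balls -/
def Bl (N k : ℕ) (y : Euc N) : Set (Euc N) := {x | ‖x - y‖ < zNorm N k y / 4}
def Bl2 (N k : ℕ) (y : Euc N) : Set (Euc N) := {x | ‖x - y‖ ≤ zNorm N k y / 2}

lemma measurableSet_Bl {N k : ℕ} : MeasurableSet {p : Euc N × Euc N | p.1 ∈ Bl N k p.2} := by
  refine measurableSet_lt (f := fun p : Euc N × Euc N => ‖p.1 - p.2‖) (g := fun p => zNorm N k p.2 / 4) ?_ ?_
  · exact (continuous_fst.sub continuous_snd).norm.measurable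
  · exact (((continuous_zNorm N k).comp continuous_snd).div_const _).measurable

lemma measurableSet_Bl2 {N k : ℕ} : MeasurableSet {p : Euc N × Euc N | p.1 ∈ Bl2 N k p.2} := by
  refine measurableSet_le (f := fun p : Euc N × Euc N => ‖p.1 - p.2‖) (g := fun p => zNorm N k p.2 / 2) ?_ ?_
  · exact (continuous_fst.sub continuous_snd).norm.measurable
  · exact (((continuous_zNorm N k).comp continuous_snd).div_const _).measurable

lemma cov_upper {N k : ℕ} (hN : 3 ≤ N) : ∃ C : ℝ≥0, ∀ x : Euc N, 0 < zNorm N k x →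
    ∫⁻ y, {y | x ∈ Bl2 N k y}.indicator (fun y => wt N k N y) y ≤ C := by
  have : Nontrivial (Euc N) := by
    have : Nonempty (Fin N) := ⟨⟨0, by omega⟩⟩
    infer_instance
  refine ⟨(Real.toNNReal ((2/3 : ℝ) ^ (-(N:ℝ)))) * (volume (ball (0 : Euc N) 1)).toNNReal, fun x hx => ?_⟩
  set z := zNorm N k x with hz
  have h1 : ∀ y, {y | x ∈ Bl2 N k y}.indicator (fun y => wt N k N y) y ≤
      (closedBall x z).indicator (fun _ => ENNReal.ofReal ((2/3 * z) ^ (-(N:ℝ)))) y := by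
    intro y
    by_cases hy : y ∈ {y | x ∈ Bl2 N k y}
    · have hy' : ‖x - y‖ ≤ zNorm N k y / 2 := hy
      have h2 := zNorm_sub_le (k := k) x y
      rw [abs_le] at h2
      have h3 : y ∈ closedBall x z := by
        rw [mem_closedBall, dist_comm, dist_eq_norm]; linarith
      rw [indicator_of_mem hy, indicator_of_mem h3, wt]
      apply ENNReal.ofReal_le_ofReal
      apply Real.rpow_le_rpow_of_nonpos (by positivity) (by linarith) (by simp)
    · rw [indicator_of_notMem hy]; exact zero_le
  refine (lintegral_mono h1).trans ?_
  rw [lintegral_indicator measurableSet_closedBall, setLIntegral_const, Measure.addHaar_closedBall _ _ hx.le,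
    ← mul_assoc, ← ENNReal.ofReal_mul (by positivity)]
  have e : (2/3 * z) ^ (-(N:ℝ)) * z ^ Module.finrank ℝ (Euc N) = (2/3 : ℝ) ^ (-(N:ℝ)) := by
    rw [finrank_euclideanSpace_fin, Real.mul_rpow (by norm_num) hx.le, mul_assoc,
      Real.rpow_neg hx.le, Real.rpow_natCast, inv_mul_cancel₀ (by positivity), mul_one]
  rw [e]
  push_cast
  rw [ENNReal.coe_toNNReal (measure_ball_lt_top).ne]
  rfl

lemma cov_lower {N k : ℕ} (hN : 3 ≤ N) : ∃ c : ℝ≥0, 0 < c ∧ ∀ x : Euc N, 0 < zNorm N k x →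
    c ≤ ∫⁻ y, {y | x ∈ Bl N k y}.indicator (fun y => wt N k N y) y := by
  have : Nontrivial (Euc N) := by
    have : Nonempty (Fin N) := ⟨⟨0, by omega⟩⟩
    infer_instance
  refine ⟨(Real.toNNReal ((6/5 : ℝ) ^ (-(N:ℝ)) * (1/5) ^ N)) * (volume (ball (0 : Euc N) 1)).toNNReal, ?_,
    fun x hx => ?_⟩
  · apply mul_pos
    · rw [Real.toNNReal_pos]; positivity
    · apply ENNReal.toNNReal_pos (measure_ball_pos _ _ (by norm_num)).ne' (measure_ball_lt_top).ne
  set z := zNorm N k x with hz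
  have h1 : ∀ y, (ball x (z/5)).indicator (fun _ => ENNReal.ofReal ((6/5 * z) ^ (-(N:ℝ)))) y ≤
      {y | x ∈ Bl N k y}.indicator (fun y => wt N k N y) y := by
    intro y
    by_cases hy : y ∈ ball x (z/5)
    · have hy' := hy
      rw [mem_ball, dist_comm, dist_eq_norm] at hy'
      have h2 := zNorm_sub_le (k := k) x y
      rw [abs_le] at h2
      have h3 : y ∈ {y | x ∈ Bl N k y} := by
        change ‖x - y‖ < zNorm N k y / 4
        linarith
      rw [indicator_of_mem hy, indicator_of_mem h3, wt]
      apply ENNReal.ofReal_le_ofReal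
      apply Real.rpow_le_rpow_of_nonpos (by linarith) (by linarith) (by simp)
    · rw [indicator_of_notMem hy]; exact zero_le
  refine le_trans ?_ (lintegral_mono h1)
  rw [lintegral_indicator measurableSet_ball, setLIntegral_const, Measure.addHaar_ball _ x (by positivity : 0 ≤ z/5),
    ← mul_assoc, ← ENNReal.ofReal_mul (by positivity)]
  have e : (6/5 * z) ^ (-(N:ℝ)) * (z/5) ^ Module.finrank ℝ (Euc N) = (6/5 : ℝ) ^ (-(N:ℝ)) * (1/5) ^ N := by
    rw [finrank_euclideanSpace_fin, Real.mul_rpow (by norm_num) hx.le, mul_assoc, div_pow,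
      Real.rpow_neg hx.le, Real.rpow_natCast, one_div_pow]
    field_simp
  rw [e]
  push_cast
  rw [ENNReal.coe_toNNReal (measure_ball_lt_top).ne]
  rfl

/-- the local gradient density -/
def Gd (N k : ℕ) (c1 c2 : ℝ≥0) (φ : Euc N → ℝ) (x : Euc N) : ℝ≥0∞ :=
  c1 * (‖fderiv ℝ φ x‖ₑ * ‖φ x‖ₑ ^ (twoStar N 1 - 1)) + c2 * (wt N k 1 x * ‖φ x‖ₑ ^ twoStar N 1)

lemma Gd_meas {N k : ℕ} {c1 c2 : ℝ≥0} {φ : Euc N → ℝ} (hφ : Sm φ) : Measurable (Gd N k c1 c2 φ) := by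
  unfold Gd
  exact ((hφ.contD.enorm.measurable.mul (hφ.cont.enorm.measurable.pow_const _)).const_mul _).add
    (((measurable_wt N k 1).mul (hφ.cont.enorm.measurable.pow_const _)).const_mul _)

lemma exists_bump (N : ℕ) : ∃ χ : Euc N → ℝ, Sm χ ∧ (∀ x, ‖x‖ ≤ 1/4 → χ x = 1) ∧
    (∀ x, 1/2 ≤ ‖x‖ → χ x = 0) ∧ (∀ x, 1/2 < ‖x‖ → fderiv ℝ χ x = 0) ∧ (∀ x, 0 ≤ χ x ∧ χ x ≤ 1) ∧
    ∃ K : ℝ≥0, ∀ x, ‖fderiv ℝ χ x‖ ≤ K := by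
  let b : ContDiffBump (0 : Euc N) := ⟨1/4, 1/2, by norm_num, by norm_num⟩
  have hb : Sm (b : Euc N → ℝ) := ⟨b.contDiff, b.hasCompactSupport⟩
  refine ⟨b, hb, fun x hx => ?_, fun x hx => ?_, fun x hx => ?_, fun x => ⟨b.nonneg, b.le_one⟩, ?_⟩
  · apply b.one_of_mem_closedBall; rw [mem_closedBall, dist_zero_right]; exact hx
  · apply b.zero_of_le_dist; rw [dist_zero_right]; exact hx
  · have : x ∉ tsupport (b : Euc N → ℝ) := by
      rw [b.tsupport_eq, mem_closedBall, dist_zero_right, not_le]; exact hx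
    exact image_eq_zero_of_notMem_tsupport (fun h => this (tsupport_fderiv_subset ℝ h))
  · obtain ⟨C, hC⟩ := hb.contD.bounded_above_of_compact_support (hb.2.fderiv ℝ)
    exact ⟨Real.toNNReal C, fun x => (hC x).trans (Real.le_coe_toNNReal C)⟩

lemma loc_gns {N k : ℕ} (hN : 3 ≤ N) : ∃ c1 c2 : ℝ≥0, ∀ φ : Euc N → ℝ, Sm φ → ∀ y : Euc N,
    AE N k 0 φ (Bl N k y) ^ (1 - 1 / (N:ℝ)) ≤ ∫⁻ x in Bl2 N k y, Gd N k c1 c2 φ x := by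
  obtain ⟨χ, hχ, hχ1, hχ0, hχd, hχb, K, hK⟩ := exists_bump N
  have hN' : (3 : ℝ) ≤ N := by exact_mod_cast hN
  set m := twoStar N 1 with hm
  have hm2 : 2 < m := twoStar_gt hN (by norm_num)
  set p : ℝ := N / (N - 1) with hp
  have hconj : Real.HolderConjugate (Module.finrank ℝ (Euc N)) p := by
    rw [finrank_euclideanSpace_fin, Real.holderConjugate_iff]
    refine ⟨by linarith, ?_⟩
    rw [hp]; field_simp; ring
  set C0 := lintegralPowLePowLIntegralFDerivConst (volume : Measure (Euc N)) p with hC0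
  set C1 : ℝ≥0 := C0 ^ (1 - 1/(N:ℝ)) with hC1
  refine ⟨C1 * Real.toNNReal m, C1 * (Real.toNNReal (3/2) * K), fun φ hφ y => ?_⟩
  have hexp : 0 < 1 - 1/(N:ℝ) := by
    rw [sub_pos, div_lt_one (by linarith)]; linarith
  rcases (zNorm_nonneg (k := k) y).eq_or_lt with h0 | hr
  · have : Bl N k y = ∅ := by
      ext x; simp only [Bl, ← h0, mem_setOf_eq, mem_empty_iff_false, iff_false, not_lt]; simp
    rw [this, AE]
    simp only [Measure.restrict_empty, lintegral_zero_measure]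
    rw [ENNReal.zero_rpow_of_pos hexp]; exact zero_le
  set r := zNorm N k y with hrr
  set g : Euc N → ℝ := fun x => ‖φ x‖ ^ m with hg
  set χy : Euc N → ℝ := fun x => χ (r⁻¹ • (x - y)) with hχy
  have hg1 : ContDiff ℝ 1 g := hφ.c1.norm_rpow (by linarith)
  have hgs : HasCompactSupport g := by
    apply hφ.2.comp_left (g := fun t : ℝ => ‖t‖ ^ m)
    simp [Real.zero_rpow (by linarith : m ≠ 0)]
  have hχy1 : ContDiff ℝ 1 χy := hχ.c1.comp ((contDiff_id.sub contDiff_const).const_smul r⁻¹)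
  have hder : ∀ x, HasFDerivAt χy (r⁻¹ • fderiv ℝ χ (r⁻¹ • (x - y))) x := by
    intro x
    have h1 : HasFDerivAt (fun x : Euc N => r⁻¹ • (x - y)) (r⁻¹ • ContinuousLinearMap.id ℝ (Euc N)) x :=
      ((hasFDerivAt_id x).sub_const y).const_smul r⁻¹
    have h2 := (hχ.diff (r⁻¹ • (x - y))).hasFDerivAt.comp x h1
    refine h2.congr_fderiv ?_
    ext v; simp
  have hf := lintegral_pow_le_pow_lintegral_fderiv (volume : Measure (Euc N)) (hχy1.mul hg1)
    (hgs.mul_left (f := χy)) hconj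
  have hpp : p * (1 - 1/(N:ℝ)) = 1 := by rw [hp]; field_simp; rw [div_self (by linarith)]
  have hnorm : ∀ x, ‖r⁻¹ • (x - y)‖ = ‖x - y‖ / r := by
    intro x; rw [norm_smul, norm_inv, Real.norm_of_nonneg hr.le]; field_simp
  -- lower bound
  have hlow : AE N k 0 φ (Bl N k y) ≤ ∫⁻ x, ‖(χy * g) x‖ₑ ^ p := by
    unfold AE
    have hmeas : MeasurableSet (Bl N k y) := by
      have := isOpen_ball (x := y) (ε := r/4) |>.measurableSet
      convert this using 1
      ext x; simp [Bl, dist_eq_norm, hrr]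
    rw [← lintegral_indicator hmeas]
    apply lintegral_mono
    intro x
    by_cases hx : x ∈ Bl N k y
    · rw [indicator_of_mem hx]
      have h1 : χy x = 1 := by
        apply hχ1
        rw [hnorm, div_le_iff₀ hr]
        have : ‖x - y‖ < r/4 := hx
        linarith
      simp only [Pi.mul_apply, h1, one_mul]
      apply le_of_eq
      have e1 : ‖g x‖ₑ = ‖φ x‖ₑ ^ m := by
        rw [hg, Real.enorm_eq_ofReal (by positivity), ← ENNReal.ofReal_rpow_of_nonneg (norm_nonneg _) (by linarith),
          ofReal_norm]
      have e2 : m * p = twoStar N 0 := by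
        rw [hm, hp, twoStar, twoStar]
        have : (N:ℝ) - 1 ≠ 0 := by linarith
        have : (N:ℝ) - 2 ≠ 0 := by linarith
        field_simp; ring
      rw [e1, ← ENNReal.rpow_mul, e2]
      simp [wt]
    · rw [indicator_of_notMem hx]; exact zero_le
  -- upper bound on gradient
  have hup : ∀ x, ‖fderiv ℝ (χy * g) x‖ₑ ≤ (Bl2 N k y).indicator
      (Gd N k (Real.toNNReal m) (Real.toNNReal (3/2) * K) φ) x := by
    intro x
    have e : fderiv ℝ (χy * g) x = χy x • fderiv ℝ g x + g x • (r⁻¹ • fderiv ℝ χ (r⁻¹ • (x - y))) :=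
      ((hder x).mul (hg1.differentiable (by norm_num) x).hasFDerivAt).fderiv
    by_cases hx : x ∈ Bl2 N k y
    · rw [indicator_of_mem hx]
      have hx' : ‖x - y‖ ≤ r/2 := hx
      have h2 := zNorm_sub_le (k := k) x y
      rw [abs_le] at h2
      have hzx : 0 < zNorm N k x := by linarith
      have hb : ‖fderiv ℝ (χy * g) x‖ ≤ m * (‖fderiv ℝ φ x‖ * ‖φ x‖ ^ (m - 1)) +
          (3/2 * K) * (zNorm N k x ^ (-1 : ℝ) * ‖φ x‖ ^ m) := by
        rw [e]
        refine (norm_add_le _ _).trans ?_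
        rw [norm_smul, norm_smul, norm_smul, norm_inv, Real.norm_of_nonneg hr.le]
        have i1 : ‖χy x‖ ≤ 1 := by
          rw [Real.norm_eq_abs, abs_le]; constructor <;> linarith [(hχb (r⁻¹ • (x - y))).1, (hχb (r⁻¹ • (x - y))).2]
        have i2 : ‖fderiv ℝ g x‖ ≤ m * ‖φ x‖ ^ (m - 1) * ‖fderiv ℝ φ x‖ :=
          norm_fderiv_norm_rpow_le hφ.diff (by linarith)
        have i3 : ‖g x‖ = ‖φ x‖ ^ m := by rw [hg, Real.norm_of_nonneg (by positivity)]
        have i4 : r⁻¹ ≤ 3/2 * zNorm N k x ^ (-1 : ℝ) := by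
          rw [Real.rpow_neg_one, ← div_eq_mul_inv, inv_le_iff_one_le_mul₀ hr, div_mul_eq_mul_div, le_div_iff₀ hzx]
          linarith
        have i5 := hK (r⁻¹ • (x - y))
        rw [i3]
        calc _ ≤ 1 * (m * ‖φ x‖ ^ (m - 1) * ‖fderiv ℝ φ x‖) +
              ‖φ x‖ ^ m * ((3/2 * zNorm N k x ^ (-1 : ℝ)) * K) := by gcongr
          _ = _ := by ring
      rw [← ofReal_norm]
      refine (ENNReal.ofReal_le_ofReal hb).trans (le_of_eq ?_)
      have hm0 : 0 ≤ m := by linarith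
      rw [ENNReal.ofReal_add (by positivity) (by positivity), ENNReal.ofReal_mul hm0,
        ENNReal.ofReal_mul (by positivity), ENNReal.ofReal_mul (by positivity), ENNReal.ofReal_mul (by positivity),
        ENNReal.ofReal_mul (by positivity), ofReal_norm,
        ← ENNReal.ofReal_rpow_of_nonneg (norm_nonneg _) (by linarith),
        ← ENNReal.ofReal_rpow_of_nonneg (norm_nonneg _) (by linarith), ofReal_norm, Gd, wt]
      simp only [ENNReal.ofReal_coe_nnreal, ENNReal.coe_mul]
      rfl
    · rw [indicator_of_notMem hx, e]
      have hx' : r/2 < ‖x - y‖ := by simpa [Bl2] using hx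
      have hx2 : 1/2 < ‖r⁻¹ • (x - y)‖ := by rw [hnorm, lt_div_iff₀ hr]; linarith
      have : χy x = 0 := hχ0 _ hx2.le
      rw [this, hχd _ hx2, smul_zero, smul_zero, zero_smul, add_zero, ← ofReal_norm, norm_zero, ENNReal.ofReal_zero]
  have hmeas2 : MeasurableSet (Bl2 N k y) := by
    have := isClosed_closedBall (x := y) (ε := r/2) |>.measurableSet
    convert this using 1
    ext x; simp [Bl2, dist_eq_norm, hrr]
  calc AE N k 0 φ (Bl N k y) ^ (1 - 1 / (N:ℝ))
      ≤ (C0 * (∫⁻ x, ‖fderiv ℝ (χy * g) x‖ₑ) ^ p) ^ (1 - 1 / (N:ℝ)) := by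
        gcongr; exact hlow.trans hf
    _ = C1 * ∫⁻ x, ‖fderiv ℝ (χy * g) x‖ₑ := by
        rw [ENNReal.mul_rpow_of_nonneg _ _ hexp.le, ← ENNReal.rpow_mul, hpp, ENNReal.rpow_one, hC1,
          ENNReal.coe_rpow_of_nonneg _ hexp.le]
    _ ≤ C1 * ∫⁻ x in Bl2 N k y, Gd N k (Real.toNNReal m) (Real.toNNReal (3/2) * K) φ x := by
        rw [← lintegral_indicator hmeas2]
        gcongr with x
        exact hup x
    _ = _ := by
        rw [← lintegral_const_mul' _ _ (by simp)]
        congr 1; ext x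
        simp only [Gd, ENNReal.coe_mul]; ring

lemma tonelli_swap {N k : ℕ} {G : Euc N → ℝ≥0∞} (hG : Measurable G)
    {B : Euc N → Set (Euc N)} (hB : MeasurableSet {p : Euc N × Euc N | p.1 ∈ B p.2}) :
    ∫⁻ y, wt N k N y * ∫⁻ x in B y, G x =
      ∫⁻ x, G x * ∫⁻ y, {y | x ∈ B y}.indicator (fun y => wt N k N y) y := by
  have hBy : ∀ y, MeasurableSet (B y) := fun y => measurable_prodMk_right hB
  have h1 : ∀ y, wt N k N y * ∫⁻ x in B y, G x =
      ∫⁻ x, {p : Euc N × Euc N | p.1 ∈ B p.2}.indicator (fun p => wt N k N p.2 * G p.1) (x, y) := by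
    intro y
    rw [← lintegral_const_mul _ hG, ← lintegral_indicator (hBy y)]
    rfl
  have h2 : ∀ x, G x * ∫⁻ y, {y | x ∈ B y}.indicator (fun y => wt N k N y) y =
      ∫⁻ y, {p : Euc N × Euc N | p.1 ∈ B p.2}.indicator (fun p => wt N k N p.2 * G p.1) (x, y) := by
    intro x
    rw [← lintegral_const_mul]
    · congr 1; ext y
      by_cases h : x ∈ B y
      · rw [indicator_of_mem (by exact h), indicator_of_mem (by exact h), mul_comm]
      · rw [indicator_of_notMem (by exact h), indicator_of_notMem (by exact h), mul_zero]
    · exact (measurable_wt N k N).indicator (measurable_prodMk_left hB)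
  simp_rw [h1, h2]
  rw [lintegral_lintegral_swap]
  apply Measurable.aemeasurable
  have : Measurable ({p : Euc N × Euc N | p.1 ∈ B p.2}.indicator (fun p => wt N k N p.2 * G p.1)) :=
    (((measurable_wt N k N).comp measurable_snd).mul (hG.comp measurable_fst)).indicator hB
  exact this.comp measurable_swap

lemma Gd_int {N k : ℕ} (hN : 3 ≤ N) (hk : k + 2 ≤ N) (c1 c2 M : ℝ≥0) :
    ∃ C : ℝ≥0, ∀ φ : Euc N → ℝ, Sm φ → DE φ ≤ M → ∫⁻ x, Gd N k c1 c2 φ x ≤ C := by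
  obtain ⟨C0, hC0⟩ := AE_zero_bdd (k := k) hN M
  obtain ⟨C1, hC1⟩ := HS_bdd hN hk (σ := 1) (by norm_num) (by norm_num) M
  have hN' : (3 : ℝ) ≤ N := by exact_mod_cast hN
  refine ⟨c1 * (M ^ (1/2:ℝ) * C0 ^ (1/2:ℝ)) + c2 * C1, fun φ hφ hD => ?_⟩
  unfold Gd
  have m1 : Measurable (fun x => ‖fderiv ℝ φ x‖ₑ * ‖φ x‖ₑ ^ (twoStar N 1 - 1)) :=
    hφ.contD.enorm.measurable.mul (hφ.cont.enorm.measurable.pow_const _)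
  have m2 : Measurable (fun x => wt N k 1 x * ‖φ x‖ₑ ^ twoStar N 1) :=
    (measurable_wt N k 1).mul (hφ.cont.enorm.measurable.pow_const _)
  rw [lintegral_add_left (m1.const_mul _), lintegral_const_mul _ m1, lintegral_const_mul _ m2]
  push_cast
  gcongr
  · have h1 := ENNReal.lintegral_mul_norm_pow_le (μ := (volume : Measure (Euc N)))
      (f := fun x => ‖fderiv ℝ φ x‖ₑ ^ 2) (g := fun x => ‖φ x‖ₑ ^ twoStar N 0)
      (hφ.contD.enorm.measurable.pow_const _).aemeasurable
      (hφ.cont.enorm.measurable.pow_const _).aemeasurable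
      (p := 1/2) (q := 1/2) (by norm_num) (by norm_num) (by norm_num)
    have hA0 : AE N k 0 φ univ = ∫⁻ x, ‖φ x‖ₑ ^ twoStar N 0 := by simp [AE, wt]
    refine le_trans (le_of_eq ?_) (h1.trans ?_)
    · congr 1; ext x
      congr 1
      · rw [← ENNReal.rpow_natCast, ← ENNReal.rpow_mul]; simp
      · rw [← ENNReal.rpow_mul]; congr 1
        rw [twoStar, twoStar]
        have : (N:ℝ) - 2 ≠ 0 := by linarith
        field_simp; ring
    · rw [← hA0, ENNReal.coe_rpow_of_nonneg _ (by norm_num), ENNReal.coe_rpow_of_nonneg _ (by norm_num)]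
      gcongr
      · exact hD
      · exact hC0 φ hφ hD
  · have := hC1 φ hφ hD
    simpa [AE] using this

lemma AE_loc {N k : ℕ} (hN : 3 ≤ N) (hk : k + 2 ≤ N) (M : ℝ≥0) :
    ∃ C : ℝ≥0, ∀ φ : Euc N → ℝ, Sm φ → DE φ ≤ M → ∀ δ : ℝ≥0∞, (∀ y, AE N k 1 φ (Bl N k y) ≤ δ) →
      AE N k (1/(N:ℝ)) φ univ ≤ C * δ ^ (1/(N:ℝ)) := by
  have hN' : (3 : ℝ) ≤ N := by exact_mod_cast hN
  obtain ⟨c1, c2, hloc⟩ := loc_gns (k := k) hN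
  obtain ⟨C, hC⟩ := Gd_int hN hk c1 c2 M
  obtain ⟨Cu, hCu⟩ := cov_upper (k := k) hN
  obtain ⟨cl, hcl, hCl⟩ := cov_lower (k := k) hN
  refine ⟨cl⁻¹ * (Cu * C), fun φ hφ hD δ hδ => ?_⟩
  have hθ0 : 0 ≤ 1/(N:ℝ) := by positivity
  have hθ1 : 1/(N:ℝ) ≤ 1 := by rw [div_le_one (by linarith)]; linarith
  set G0 : Euc N → ℝ≥0∞ := fun x => wt N k (1/(N:ℝ)) x * ‖φ x‖ₑ ^ twoStar N (1/(N:ℝ)) with hG0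
  have mG0 : Measurable G0 := (measurable_wt N k _).mul (hφ.cont.enorm.measurable.pow_const _)
  have mG : Measurable (Gd N k c1 c2 φ) := Gd_meas hφ
  have e1 : AE N k (1/(N:ℝ)) φ univ = ∫⁻ x, G0 x := by simp [AE, hG0]
  have h1 : (cl : ℝ≥0∞) * AE N k (1/(N:ℝ)) φ univ ≤ ∫⁻ y, wt N k N y * ∫⁻ x in Bl N k y, G0 x := by
    rw [tonelli_swap mG0 measurableSet_Bl, e1, ← lintegral_const_mul _ mG0]
    apply lintegral_mono_ae
    filter_upwards [zNorm_null (N := N) (k := k) (by omega)] with x hx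
    rw [mul_comm]
    gcongr
    exact hCl x hx
  have h2 : ∀ y, ∫⁻ x in Bl N k y, G0 x ≤ δ ^ (1/(N:ℝ)) * ∫⁻ x in Bl2 N k y, Gd N k c1 c2 φ x := by
    intro y
    have := AE_interp hN (by omega : k < N) hθ0 hθ1 (by norm_num : (1:ℝ) < 2) (by norm_num : (0:ℝ) < 2)
      hφ.asm (Bl N k y)
    rw [mul_one, mul_zero, add_zero] at this
    refine this.trans ?_
    gcongr
    · exact hδ y
    · exact hloc φ hφ y
  have h3 : ∫⁻ y, wt N k N y * ∫⁻ x in Bl2 N k y, Gd N k c1 c2 φ x ≤ Cu * C := by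
    rw [tonelli_swap mG measurableSet_Bl2]
    calc _ ≤ ∫⁻ x, Gd N k c1 c2 φ x * Cu := by
          apply lintegral_mono_ae
          filter_upwards [zNorm_null (N := N) (k := k) (by omega)] with x hx
          gcongr
          exact hCu x hx
      _ = Cu * ∫⁻ x, Gd N k c1 c2 φ x := by rw [lintegral_mul_const _ mG, mul_comm]
      _ ≤ _ := by gcongr; exact hC φ hφ hD
  have h4 : (cl : ℝ≥0∞) * AE N k (1/(N:ℝ)) φ univ ≤ δ ^ (1/(N:ℝ)) * (Cu * C) := by
    refine h1.trans ?_
    calc _ ≤ ∫⁻ y, δ ^ (1/(N:ℝ)) * (wt N k N y * ∫⁻ x in Bl2 N k y, Gd N k c1 c2 φ x) := by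
          apply lintegral_mono
          intro y
          simp only
          rw [mul_left_comm]
          gcongr
          exact h2 y
      _ = δ ^ (1/(N:ℝ)) * ∫⁻ y, (wt N k N y * ∫⁻ x in Bl2 N k y, Gd N k c1 c2 φ x) := by
          apply lintegral_const_mul
          apply (measurable_wt N k N).mul
          have : Measurable (fun y => ∫⁻ x, {p : Euc N × Euc N | p.1 ∈ Bl2 N k p.2}.indicator
              (fun p => Gd N k c1 c2 φ p.1) (x, y)) := by
            apply Measurable.lintegral_prod_left
            exact (mG.comp measurable_fst).indicator measurableSet_Bl2
          convert this using 2 with y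
          have hy : MeasurableSet (Bl2 N k y) := measurable_prodMk_right measurableSet_Bl2
          rw [← lintegral_indicator hy]
          rfl
      _ ≤ _ := by gcongr
  have hcl' : (cl : ℝ≥0∞) ≠ 0 := by simpa using hcl.ne'
  calc AE N k (1/(N:ℝ)) φ univ = (cl : ℝ≥0∞)⁻¹ * (cl * AE N k (1/(N:ℝ)) φ univ) := by
        rw [← mul_assoc, ENNReal.inv_mul_cancel hcl' (by simp), one_mul]
    _ ≤ (cl : ℝ≥0∞)⁻¹ * (δ ^ (1/(N:ℝ)) * (Cu * C)) := by gcongr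
    _ = _ := by push_cast; rw [ENNReal.coe_inv hcl.ne']; ring

lemma nonvanish {N k : ℕ} (hN : 3 ≤ N) (hk : k + 2 ≤ N) {σ : ℝ} (hσ : 0 < σ) (hσ2 : σ < 2) (M : ℝ≥0) :
    ∃ δ : ℝ≥0, 0 < δ ∧ ∀ φ : Euc N → ℝ, Sm φ → DE φ ≤ M → AE N k σ φ univ = 1 →
      ∃ y, 0 < zNorm N k y ∧ δ ≤ AE N k 1 φ (Bl N k y) := by
  have hN' : (3 : ℝ) ≤ N := by exact_mod_cast hN
  obtain ⟨C, hC⟩ := AE_loc hN hk M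
  -- interpolation
  have hIntg : ∃ (a : ℝ) (C2 : ℝ≥0), 0 < a ∧ ∀ φ : Euc N → ℝ, Sm φ → DE φ ≤ M →
      AE N k σ φ univ ≤ AE N k (1/(N:ℝ)) φ univ ^ a * C2 := by
    have hn0 : 0 < 1/(N:ℝ) := by positivity
    have hn1 : 1/(N:ℝ) < 2 := by rw [div_lt_iff₀ (by linarith)]; linarith
    rcases le_or_gt σ (1/(N:ℝ)) with h | h
    · obtain ⟨C0, hC0⟩ := AE_zero_bdd (k := k) hN M
      have ha1 : σ / (1/(N:ℝ)) ≤ 1 := by rw [div_le_one hn0]; exact h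
      have ha0 : 0 < σ / (1/(N:ℝ)) := by positivity
      refine ⟨σ / (1/(N:ℝ)), C0 ^ (1 - σ / (1/(N:ℝ))), ha0, fun φ hφ hD => ?_⟩
      have := AE_interp hN (by omega : k < N) ha0.le ha1 hn1 (by norm_num : (0:ℝ) < 2) hφ.asm univ
      rw [mul_zero, add_zero, div_mul_cancel₀ _ hn0.ne'] at this
      refine this.trans ?_
      rw [ENNReal.coe_rpow_of_nonneg _ (by linarith)]
      exact mul_le_mul_right (ENNReal.rpow_le_rpow (hC0 φ hφ hD) (by linarith)) _
    · set s := (σ + 2)/2 with hs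
      obtain ⟨C0, hC0⟩ := HS_bdd hN hk (σ := s) (by linarith) (by linarith) M
      set a := (s - σ) / (s - 1/(N:ℝ)) with ha
      have hd : 0 < s - 1/(N:ℝ) := by linarith
      have ha0 : 0 < a := div_pos (by linarith) hd
      have ha1 : a ≤ 1 := by rw [ha, div_le_one hd]; linarith
      refine ⟨a, C0 ^ (1 - a), ha0, fun φ hφ hD => ?_⟩
      have := AE_interp hN (by omega : k < N) ha0.le ha1 hn1 (by linarith : s < 2) hφ.asm univ
      have e : a * (1/(N:ℝ)) + (1 - a) * s = σ := by
        have : a * (s - 1/(N:ℝ)) = s - σ := div_mul_cancel₀ _ hd.ne'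
        linarith
      rw [e] at this
      refine this.trans ?_
      rw [ENNReal.coe_rpow_of_nonneg _ (by linarith)]
      exact mul_le_mul_right (ENNReal.rpow_le_rpow (hC0 φ hφ hD) (by linarith)) _
  obtain ⟨a, C2, ha, hC2⟩ := hIntg
  -- choose δ
  have hlim : Tendsto (fun δ : ℝ≥0 => ((C : ℝ≥0∞) * (δ : ℝ≥0∞) ^ (1/(N:ℝ))) ^ a * C2) (𝓝 0) (𝓝 0) := by
    have h1 : Tendsto (fun δ : ℝ≥0 => (δ : ℝ≥0∞) ^ (1/(N:ℝ))) (𝓝 0) (𝓝 0) := by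
      have := (ENNReal.continuous_rpow_const (y := 1/(N:ℝ))).tendsto 0
      rw [ENNReal.zero_rpow_of_pos (by positivity)] at this
      exact this.comp (by rw [← ENNReal.coe_zero]; exact ENNReal.tendsto_coe.2 tendsto_id)
    have h2 := ENNReal.Tendsto.const_mul (a := (C : ℝ≥0∞)) h1 (Or.inr (by simp))
    rw [mul_zero] at h2
    have h3 := ((ENNReal.continuous_rpow_const (y := a)).tendsto 0).comp h2
    rw [ENNReal.zero_rpow_of_pos ha] at h3
    have h4 := ENNReal.Tendsto.mul_const (b := (C2 : ℝ≥0∞)) h3 (Or.inr (by simp))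
    rw [zero_mul] at h4
    exact h4
  have hev := (hlim.eventually_lt_const (by norm_num : (0 : ℝ≥0∞) < 1))
  have hev2 : ∀ᶠ δ : ℝ≥0 in 𝓝[>] 0, ((C : ℝ≥0∞) * (δ : ℝ≥0∞) ^ (1/(N:ℝ))) ^ a * C2 < 1 :=
    hev.filter_mono nhdsWithin_le_nhds
  obtain ⟨δ, hδ1, hδ0⟩ := (hev2.and self_mem_nhdsWithin).exists
  refine ⟨δ, hδ0, fun φ hφ hD hA => ?_⟩
  by_contra! hcon
  have hall : ∀ y, AE N k 1 φ (Bl N k y) ≤ δ := by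
    intro y
    rcases (zNorm_nonneg (k := k) y).eq_or_lt with h0 | hr
    · have : Bl N k y = ∅ := by
        ext x; simp only [Bl, ← h0, mem_setOf_eq, mem_empty_iff_false, iff_false, not_lt]; simp
      rw [this, AE]; simp
    · exact (hcon y hr).le
  have h1 := hC φ hφ hD δ hall
  have h2 := hC2 φ hφ hD
  rw [hA] at h2
  refine absurd (h2.trans ?_) (not_le.2 hδ1)
  gcongr


/-- best constant over smooth functions -/
def SS (N k : ℕ) (σ : ℝ) : ℝ≥0∞ := sInf {d | ∃ φ : Euc N → ℝ, Sm φ ∧ AE N k σ φ univ = 1 ∧ d = DE φ}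

lemma Sm.smul {N : ℕ} {φ : Euc N → ℝ} (h : Sm φ) (c : ℝ) : Sm (fun x => c * φ x) :=
  ⟨contDiff_const.mul h.1, h.2.mul_left⟩

lemma DE_smul {N : ℕ} {φ : Euc N → ℝ} (h : Sm φ) (c : ℝ) :
    DE (fun x => c * φ x) = ‖c‖ₑ ^ 2 * DE φ := by
  unfold DE
  rw [← lintegral_const_mul _ (h.contD.enorm.measurable.pow_const _)]
  congr 1; ext x
  have : fderiv ℝ (fun x => c * φ x) x = c • fderiv ℝ φ x := by
    rw [fderiv_const_mul (h.diff x)]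
  rw [this, ← mul_pow, enorm_smul]

lemma AE_smul {N k : ℕ} (hN : 3 ≤ N) {σ : ℝ} (hσ : σ < 2) {φ : Euc N → ℝ} (c : ℝ) (Ω : Set (Euc N)) :
    AE N k σ (fun x => c * φ x) Ω = ‖c‖ₑ ^ twoStar N σ * AE N k σ φ Ω := by
  unfold AE
  have hp := twoStar_pos hN hσ
  rw [← lintegral_const_mul' _ _ (ENNReal.rpow_ne_top_of_nonneg hp.le enorm_ne_top)]
  congr 1; ext x
  rw [enorm_mul, ENNReal.mul_rpow_of_nonneg _ _ hp.le]; ring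

lemma DE_ne_top {N : ℕ} {φ : Euc N → ℝ} (h : Sm φ) : DE φ ≠ ⊤ := by
  have h1 : MemLp (fderiv ℝ φ) 2 volume :=
    h.contD.memLp_of_hasCompactSupport (h.2.fderiv ℝ)
  have h2 := h1.2
  rw [eLpNorm_two_eq] at h2
  intro h3
  unfold DE at h3
  rw [h3] at h2
  simp at h2

lemma AE_ne_top {N k : ℕ} (hN : 3 ≤ N) (hk : k + 2 ≤ N) {σ : ℝ} (hσ : 0 ≤ σ) (hσ2 : σ < 2)
    {φ : Euc N → ℝ} (h : Sm φ) : AE N k σ φ univ ≠ ⊤ := by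
  obtain ⟨C, hC⟩ := HS_bdd hN hk hσ hσ2 (DE φ).toNNReal
  have := hC φ h (by rw [ENNReal.coe_toNNReal (DE_ne_top h)])
  exact ne_top_of_le_ne_top (by simp) this

/-- normalization -/
lemma exists_norm {N k : ℕ} (hN : 3 ≤ N) (hk : k + 2 ≤ N) {σ : ℝ} (hσ : 0 ≤ σ) (hσ2 : σ < 2)
    {φ : Euc N → ℝ} (h : Sm φ) (h0 : AE N k σ φ univ ≠ 0) :
    ∃ c : ℝ, 0 < c ∧ AE N k σ (fun x => c * φ x) univ = 1 ∧
      DE (fun x => c * φ x) = (AE N k σ φ univ)⁻¹ ^ (2 / twoStar N σ) * DE φ := by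
  have hp := twoStar_pos hN hσ2
  have ht := AE_ne_top hN hk hσ hσ2 h
  set A := AE N k σ φ univ with hA
  have hc0 : A ^ (-(1 / twoStar N σ)) ≠ 0 := by
    simp [ENNReal.rpow_eq_zero_iff, h0, ht]
  have hct : A ^ (-(1 / twoStar N σ)) ≠ ⊤ := by
    simp [ENNReal.rpow_eq_top_iff, h0, ht]
  have e : ‖(A ^ (-(1 / twoStar N σ))).toReal‖ₑ = A ^ (-(1 / twoStar N σ)) := by
    rw [Real.enorm_eq_ofReal ENNReal.toReal_nonneg, ENNReal.ofReal_toReal hct]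
  refine ⟨(A ^ (-(1 / twoStar N σ))).toReal, ENNReal.toReal_pos hc0 hct, ?_, ?_⟩
  · rw [AE_smul hN hσ2, e, ← ENNReal.rpow_mul, neg_mul, one_div_mul_cancel hp.ne', ← hA,
      ENNReal.rpow_neg_one, ENNReal.inv_mul_cancel h0 ht]
  · rw [DE_smul h, e, ← ENNReal.rpow_natCast, ← ENNReal.rpow_mul, ENNReal.inv_rpow, ← ENNReal.rpow_neg]
    congr 2
    push_cast; ring

lemma SS_le {N k : ℕ} (hN : 3 ≤ N) (hk : k + 2 ≤ N) {σ : ℝ} (hσ : 0 ≤ σ) (hσ2 : σ < 2)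
    {φ : Euc N → ℝ} (h : Sm φ) : SS N k σ * AE N k σ φ univ ^ (2 / twoStar N σ) ≤ DE φ := by
  have hp := twoStar_pos hN hσ2
  rcases eq_or_ne (AE N k σ φ univ) 0 with h0 | h0
  · rw [h0, ENNReal.zero_rpow_of_pos (by positivity), mul_zero]; exact zero_le
  have ht := AE_ne_top hN hk hσ hσ2 h
  obtain ⟨c, hc, h1, h2⟩ := exists_norm hN hk hσ hσ2 h h0
  have h3 : SS N k σ ≤ DE (fun x => c * φ x) := sInf_le ⟨_, h.smul c, h1, rfl⟩
  rw [h2] at h3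
  calc _ ≤ ((AE N k σ φ univ)⁻¹ ^ (2 / twoStar N σ) * DE φ) * AE N k σ φ univ ^ (2 / twoStar N σ) := by
        gcongr
    _ = ((AE N k σ φ univ)⁻¹ * AE N k σ φ univ) ^ (2 / twoStar N σ) * DE φ := by
        rw [ENNReal.mul_rpow_of_nonneg _ _ (by positivity)]; ring
    _ = DE φ := by rw [ENNReal.inv_mul_cancel h0 ht]; simp

lemma SS_ne_top {N k : ℕ} (hN : 3 ≤ N) (hk : k + 2 ≤ N) {σ : ℝ} (hσ : 0 ≤ σ) (hσ2 : σ < 2) :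
    SS N k σ ≠ ⊤ := by
  have hp := twoStar_pos hN hσ2
  obtain ⟨χ, hχ, hχ1, hχ0, hχd, hχb, -⟩ := exists_bump N
  have h0 : AE N k σ χ univ ≠ 0 := by
    intro h
    have hmm : Measurable (fun x => wt N k σ x * ‖χ x‖ₑ ^ twoStar N σ) :=
      (measurable_wt N k σ).mul (hχ.cont.enorm.measurable.pow_const _)
    rw [AE, lintegral_eq_zero_iff hmm, Measure.restrict_univ] at h
    have h1 : ∀ᵐ x : Euc N, x ∉ ball (0 : Euc N) (1/4) := by
      filter_upwards [h, zNorm_null (N := N) (k := k) (by omega)] with x hx hz hxb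
      rw [mem_ball, dist_zero_right] at hxb
      have := hχ1 x hxb.le
      simp only [this, Pi.zero_apply, mul_eq_zero] at hx
      rcases hx with hx | hx
      · exact (wt_pos hz).ne' hx
      · simp at hx
    have h2 := measure_ball_pos (volume : Measure (Euc N)) 0 (by norm_num : (0:ℝ) < 1/4)
    rw [ae_iff] at h1
    simp only [not_not] at h1
    exact h2.ne' h1
  obtain ⟨c, hc, h1, h2⟩ := exists_norm hN hk hσ hσ2 hχ h0
  have h3 : SS N k σ ≤ DE (fun x => c * χ x) := sInf_le ⟨_, hχ.smul c, h1, rfl⟩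
  exact ne_top_of_le_ne_top (DE_ne_top (hχ.smul c)) h3

lemma SS_ne_zero {N k : ℕ} (hN : 3 ≤ N) (hk : k + 2 ≤ N) {σ : ℝ} (hσ : 0 ≤ σ) (hσ2 : σ < 2) :
    SS N k σ ≠ 0 := by
  have hp := twoStar_pos hN hσ2
  obtain ⟨C, hC⟩ := HS_bdd hN hk hσ hσ2 1
  set L : ℝ≥0 := C ^ (1 / twoStar N σ) + 1 with hL
  have hL0 : 0 < L := by positivity
  suffices h : ((L ^ 2 : ℝ≥0) : ℝ≥0∞)⁻¹ ≤ SS N k σ by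
    intro h0
    rw [h0] at h
    have h1 := nonpos_iff_eq_zero.1 h
    rw [ENNReal.inv_eq_zero] at h1
    exact ENNReal.coe_ne_top h1
  apply le_sInf
  rintro d ⟨φ, hφ, hA, rfl⟩
  by_contra! hlt
  have e : ‖(L : ℝ)‖ₑ = L := by
    rw [Real.enorm_eq_ofReal (NNReal.coe_nonneg L), ENNReal.ofReal_coe_nnreal]
  have h1 := hC _ (hφ.smul (L : ℝ)) (by
    rw [DE_smul hφ, e]
    calc (L : ℝ≥0∞) ^ 2 * DE φ ≤ (L : ℝ≥0∞) ^ 2 * ((L ^ 2 : ℝ≥0) : ℝ≥0∞)⁻¹ := by gcongr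
      _ = 1 := by
        push_cast
        rw [ENNReal.mul_inv_cancel] <;> simp [hL0.ne'])
  rw [AE_smul hN hσ2, hA, mul_one, e, ← ENNReal.coe_rpow_of_nonneg _ hp.le, ENNReal.coe_le_coe] at h1
  have h2 : (L ^ twoStar N σ) ^ (1 / twoStar N σ) ≤ C ^ (1 / twoStar N σ) :=
    NNReal.rpow_le_rpow h1 (by positivity)
  rw [← NNReal.rpow_mul, mul_one_div_cancel hp.ne', NNReal.rpow_one, hL] at h2
  exact absurd h2 (not_le.2 (lt_add_one _))

/-- smooth absolute value -/
def sab (ε t : ℝ) : ℝ := Real.sqrt (t ^ 2 + ε ^ 2) - ε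

lemma sab_hasDeriv {ε : ℝ} (hε : 0 < ε) (t : ℝ) : HasDerivAt (sab ε) (t / Real.sqrt (t ^ 2 + ε ^ 2)) t := by
  have h1 : HasDerivAt (fun t : ℝ => t ^ 2 + ε ^ 2) (2 * t) t := by
    simpa using (hasDerivAt_pow 2 t).add_const (ε ^ 2)
  have h2 := (h1.sqrt (by positivity)).sub_const ε
  rw [mul_div_mul_left _ _ two_ne_zero] at h2
  exact h2

lemma sab_contDiff {ε : ℝ} (hε : 0 < ε) {n} : ContDiff ℝ n (sab ε) := by
  unfold sab
  apply ContDiff.sub _ contDiff_const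
  apply ContDiff.sqrt
  · fun_prop
  · intro x; positivity

lemma sab_nonneg {ε : ℝ} (hε : 0 < ε) (t : ℝ) : 0 ≤ sab ε t := by
  unfold sab
  rw [sub_nonneg]
  apply Real.le_sqrt_of_sq_le; nlinarith [sq_nonneg t]

lemma Sm.sab {N : ℕ} {φ : Euc N → ℝ} (h : Sm φ) {ε : ℝ} (hε : 0 < ε) : Sm (fun x => sab ε (φ x)) := by
  refine ⟨(sab_contDiff hε).comp h.1, h.2.comp_left (g := _root_.sab ε) ?_⟩
  simp [_root_.sab, Real.sqrt_sq hε.le]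

lemma DE_sab_le {N : ℕ} {φ : Euc N → ℝ} (h : Sm φ) {ε : ℝ} (hε : 0 < ε) :
    DE (fun x => sab ε (φ x)) ≤ DE φ := by
  unfold DE
  apply lintegral_mono
  intro x
  have h1 : HasFDerivAt (fun x => sab ε (φ x)) ((φ x / Real.sqrt ((φ x) ^ 2 + ε ^ 2)) • fderiv ℝ φ x) x :=
    (sab_hasDeriv hε (φ x)).comp_hasFDerivAt x (h.diff x).hasFDerivAt
  simp only
  rw [h1.fderiv]
  gcongr
  rw [← ofReal_norm, ← ofReal_norm]
  apply ENNReal.ofReal_le_ofReal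
  rw [norm_smul]
  have : ‖φ x / Real.sqrt ((φ x) ^ 2 + ε ^ 2)‖ ≤ 1 := by
    rw [norm_div, Real.norm_of_nonneg (Real.sqrt_nonneg _)]
    apply div_le_one_of_le₀ _ (Real.sqrt_nonneg _)
    rw [Real.norm_eq_abs]
    apply Real.abs_le_sqrt; nlinarith [sq_nonneg ε]
  calc _ ≤ 1 * ‖fderiv ℝ φ x‖ := by gcongr
    _ = _ := one_mul _

lemma AE_sab {N k : ℕ} (hN : 3 ≤ N) {σ : ℝ} (hσ2 : σ < 2) {φ : Euc N → ℝ} (h : Sm φ) :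
    AE N k σ φ univ ≤ liminf (fun n : ℕ => AE N k σ (fun x => sab (1 / ((n:ℝ) + 1)) (φ x)) univ) atTop := by
  have hp := twoStar_pos hN hσ2
  have key : ∀ x, liminf (fun n : ℕ => wt N k σ x * ‖sab (1 / ((n:ℝ) + 1)) (φ x)‖ₑ ^ twoStar N σ) atTop
      = wt N k σ x * ‖φ x‖ₑ ^ twoStar N σ := by
    intro x
    apply Tendsto.liminf_eq
    apply ENNReal.Tendsto.const_mul _ (Or.inr (wt_ne_top x))
    apply Tendsto.ennrpow_const
    have h1 : Tendsto (fun n : ℕ => sab (1 / ((n:ℝ) + 1)) (φ x)) atTop (𝓝 (Real.sqrt ((φ x) ^ 2 + 0 ^ 2) - 0)) := by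
      have h2 : Continuous (fun ε : ℝ => sab ε (φ x)) := by unfold sab; fun_prop
      exact (h2.tendsto 0).comp tendsto_one_div_add_atTop_nhds_zero_nat
    have e : ‖φ x‖ₑ = ‖Real.sqrt ((φ x) ^ 2 + 0 ^ 2) - 0‖ₑ := by
      rw [zero_pow two_ne_zero, add_zero, sub_zero, Real.sqrt_sq_eq_abs, ← Real.norm_eq_abs, enorm_norm]
    rw [e]
    exact h1.enorm
  unfold AE
  simp_rw [← key]
  apply lintegral_liminf_le
  intro n
  exact (measurable_wt N k σ).mul ((h.sab (by positivity)).cont.enorm.measurable.pow_const _)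

lemma nonneg_approx {N k : ℕ} (hN : 3 ≤ N) (hk : k + 2 ≤ N) {σ : ℝ} (hσ : 0 ≤ σ) (hσ2 : σ < 2)
    {s : ℝ≥0∞} (hs : SS N k σ < s) : ∃ ψ : Euc N → ℝ, Sm ψ ∧ (∀ x, 0 ≤ ψ x) ∧ AE N k σ ψ univ = 1 ∧ DE ψ < s := by
  have hp := twoStar_pos hN hσ2
  obtain ⟨d, ⟨φ, hφ, hA, rfl⟩, hd⟩ := sInf_lt_iff.1 hs
  have hD0 : DE φ ≠ 0 := by
    intro h0
    have := SS_le hN hk hσ hσ2 hφ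
    rw [hA, h0] at this
    simp at this
    exact SS_ne_zero hN hk hσ hσ2 this
  -- choose a<1 with a^{-2/p} DE < s
  have hcont : Tendsto (fun a : ℝ≥0∞ => a⁻¹ ^ (2 / twoStar N σ) * DE φ) (𝓝 1) (𝓝 (1⁻¹ ^ (2 / twoStar N σ) * DE φ)) := by
    apply ENNReal.Tendsto.mul_const
    · exact ((ENNReal.continuous_rpow_const.comp continuous_inv).tendsto 1)
    · right; exact DE_ne_top hφ
  rw [inv_one, ENNReal.one_rpow, one_mul] at hcont
  have hev := (hcont.eventually_lt_const hd).filter_mono (nhdsWithin_le_nhds (s := Iio 1))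
  have hNe : (𝓝[<] (1:ℝ≥0∞)).NeBot := by
    apply nhdsLT_neBot_of_exists_lt ⟨0, by norm_num⟩
  obtain ⟨a, ha1, ha2⟩ := (hev.and self_mem_nhdsWithin).exists
  have hlt : a < liminf (fun n : ℕ => AE N k σ (fun x => sab (1 / ((n:ℝ) + 1)) (φ x)) univ) atTop :=
    lt_of_lt_of_le ha2 (hA ▸ AE_sab hN hσ2 hφ)
  obtain ⟨n, hn⟩ := (eventually_lt_of_lt_liminf hlt).exists
  have hε : (0:ℝ) < 1 / ((n:ℝ) + 1) := by positivity
  obtain ⟨c, hc, h1, h2⟩ := exists_norm hN hk hσ hσ2 (hφ.sab hε) (bot_lt_of_lt hn).ne'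
  refine ⟨_, (hφ.sab hε).smul c, fun x => mul_nonneg hc.le (sab_nonneg hε _), h1, ?_⟩
  rw [h2]
  refine lt_of_le_of_lt ?_ ha1
  gcongr
  exact DE_sab_le hφ hε

/-- change of variables -/
lemma lint_aff {N : ℕ} {r : ℝ} (hr : 0 < r) (t : Euc N) {F : Euc N → ℝ≥0∞} (hF : Measurable F) :
    ∫⁻ x, F (r • x + t) = ENNReal.ofReal ((r ^ N)⁻¹) * ∫⁻ x, F x := by
  have h1 : ∫⁻ x, F (r • x + t) = ∫⁻ y, F (y + t) ∂(Measure.map (fun x : Euc N => r • x) volume) := by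
    rw [lintegral_map]
    · exact hF.comp (measurable_id.add_const t)
    · exact measurable_const_smul r
  rw [h1, Measure.map_addHaar_smul _ hr.ne', lintegral_smul_measure, lintegral_add_right_eq_self F t,
    finrank_euclideanSpace_fin, abs_of_pos (by positivity), smul_eq_mul]

def Tr (N : ℕ) (r : ℝ) (t : Euc N) (φ : Euc N → ℝ) (x : Euc N) : ℝ := r ^ (((N:ℝ) - 2)/2) * φ (r • x + t)

lemma Sm.tr {N : ℕ} {φ : Euc N → ℝ} (h : Sm φ) {r : ℝ} (hr : 0 < r) (t : Euc N) : Sm (Tr N r t φ) := by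
  have : Sm (fun x => φ (r • x + t)) := by
    refine ⟨h.1.comp ((contDiff_id.const_smul r).add contDiff_const), ?_⟩
    have := h.2.comp_homeomorph ((Homeomorph.smulOfNeZero r hr.ne').trans (Homeomorph.addRight t))
    exact this
  exact this.smul _

lemma DE_tr {N : ℕ} {φ : Euc N → ℝ} (h : Sm φ) {r : ℝ} (hr : 0 < r) (t : Euc N) : DE (Tr N r t φ) = DE φ := by
  have hd : ∀ x, fderiv ℝ (Tr N r t φ) x = (r ^ ((N:ℝ)/2)) • fderiv ℝ φ (r • x + t) := by
    intro x
    have h1 : HasFDerivAt (fun x : Euc N => r • x + t) (r • ContinuousLinearMap.id ℝ (Euc N)) x :=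
      ((hasFDerivAt_id x).const_smul r).add_const t
    have h2 := ((h.diff (r • x + t)).hasFDerivAt.comp x h1).const_mul (r ^ (((N:ℝ) - 2)/2))
    have h3 : fderiv ℝ (Tr N r t φ) x = _ := h2.fderiv
    rw [h3]
    ext v
    have e : r ^ ((N:ℝ)/2) = r ^ (((N:ℝ) - 2)/2) * r := by
      rw [← Real.rpow_add_one hr.ne']; congr 1; ring
    simp [e]; ring
  unfold DE
  simp_rw [hd, enorm_smul, mul_pow]
  have hm : Measurable (fun y => ‖fderiv ℝ φ y‖ₑ ^ 2) := h.contD.enorm.measurable.pow_const _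
  rw [lintegral_const_mul', lint_aff hr t hm, ← mul_assoc]
  · have : ‖r ^ ((N:ℝ)/2)‖ₑ ^ 2 * ENNReal.ofReal ((r ^ N)⁻¹) = 1 := by
      rw [Real.enorm_eq_ofReal (by positivity), ← ENNReal.ofReal_pow (by positivity),
        ← ENNReal.ofReal_mul (by positivity)]
      have : (r ^ ((N:ℝ)/2)) ^ 2 = r ^ N := by
        rw [← Real.rpow_natCast, ← Real.rpow_mul hr.le, ← Real.rpow_natCast]; congr 1; push_cast; ring
      rw [this, mul_inv_cancel₀ (by positivity)]; simp
    rw [this, one_mul]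
  · exact ENNReal.pow_ne_top enorm_ne_top

lemma AE_tr {N k : ℕ} (hN : 3 ≤ N) {s : ℝ} (hs : s < 2) {φ : Euc N → ℝ} (h : Sm φ) {r : ℝ} (hr : 0 < r)
    {t : Euc N} (ht : zP N k t = 0) {Ω : Set (Euc N)} (hΩ : MeasurableSet Ω) :
    AE N k s (Tr N r t φ) ((fun x => r • x + t) ⁻¹' Ω) = AE N k s φ Ω := by
  have hq := twoStar_pos hN hs
  have hN' : (3 : ℝ) ≤ N := by exact_mod_cast hN
  have hf : Measurable (fun x : Euc N => r • x + t) := (measurable_const_smul r).add_const t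
  set F : Euc N → ℝ≥0∞ := Ω.indicator (fun x => wt N k s x * ‖φ x‖ₑ ^ twoStar N s) with hF
  have hFm : Measurable F := ((measurable_wt N k s).mul (h.cont.enorm.measurable.pow_const _)).indicator hΩ
  unfold AE
  rw [← lintegral_indicator hΩ, ← lintegral_indicator (hf hΩ)]
  have key : ∀ x, ((fun x => r • x + t) ⁻¹' Ω).indicator (fun x => wt N k s x * ‖Tr N r t φ x‖ₑ ^ twoStar N s) x
      = ENNReal.ofReal (r ^ N) * F (r • x + t) := by
    intro x
    by_cases hx : r • x + t ∈ Ω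
    · rw [indicator_of_mem (by exact hx), hF, indicator_of_mem hx, Tr, enorm_mul,
        ENNReal.mul_rpow_of_nonneg _ _ hq.le, wt, wt]
      have e1 : zNorm N k (r • x + t) = r * zNorm N k x := by
        rw [zNorm_eq, zNorm_eq, map_add, ht, add_zero, map_smul, norm_smul, Real.norm_of_nonneg hr.le]
      rw [e1, Real.mul_rpow hr.le (zNorm_nonneg x), ENNReal.ofReal_mul (by positivity),
        Real.enorm_eq_ofReal (by positivity), ENNReal.ofReal_rpow_of_pos (by positivity),
        ← Real.rpow_mul hr.le]
      have e2 : ENNReal.ofReal (r ^ (((N:ℝ) - 2)/2 * twoStar N s)) =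
          ENNReal.ofReal (r ^ N) * ENNReal.ofReal (r ^ (-s)) := by
        rw [← ENNReal.ofReal_mul (by positivity), ← Real.rpow_natCast, ← Real.rpow_add hr]
        congr 2
        rw [twoStar]
        have : (N:ℝ) - 2 ≠ 0 := by linarith
        field_simp; ring
      rw [e2]; ring
    · rw [indicator_of_notMem (by exact hx), hF, indicator_of_notMem hx, mul_zero]
  simp_rw [key]
  rw [lintegral_const_mul' _ _ ENNReal.ofReal_ne_top, lint_aff hr t hFm, ← mul_assoc,
    ← ENNReal.ofReal_mul (by positivity), mul_inv_cancel₀ (by positivity),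
    ENNReal.ofReal_one, one_mul]

lemma min_seq {N k : ℕ} (hN : 3 ≤ N) (hk : k + 2 ≤ N) {σ : ℝ} (hσ : 0 < σ) (hσ2 : σ < 2) :
    ∃ (φ : ℕ → Euc N → ℝ) (δ : ℝ≥0), 0 < δ ∧ (∀ n, Sm (φ n)) ∧ (∀ n x, 0 ≤ φ n x) ∧
      (∀ n, AE N k σ (φ n) univ = 1) ∧ Tendsto (fun n => DE (φ n)) atTop (𝓝 (SS N k σ)) ∧
      ∀ n, (δ : ℝ≥0∞) ≤ ∫⁻ x in closedBall (0 : Euc N) 2, ‖φ n x‖ₑ ^ twoStar N 1 := by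
  have hSt := SS_ne_top hN hk hσ.le hσ2
  obtain ⟨δ, hδ, hnv⟩ := nonvanish hN hk hσ hσ2 ((SS N k σ).toNNReal + 1)
  have hstep : ∀ n : ℕ, ∃ φ : Euc N → ℝ, Sm φ ∧ (∀ x, 0 ≤ φ x) ∧ AE N k σ φ univ = 1 ∧
      DE φ < SS N k σ + ((n : ℝ≥0∞) + 1)⁻¹ ∧
      (Real.toNNReal (3/4) * δ : ℝ≥0) ≤ ∫⁻ x in closedBall (0 : Euc N) 2, ‖φ x‖ₑ ^ twoStar N 1 := by
    intro n
    obtain ⟨ψ, hψ, hψ0, hψA, hψD⟩ := nonneg_approx hN hk hσ.le hσ2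
      (s := SS N k σ + ((n : ℝ≥0∞) + 1)⁻¹) (ENNReal.lt_add_right hSt (by simp))
    obtain ⟨y, hy, hyA⟩ := hnv ψ hψ (by
      refine hψD.le.trans ?_
      push_cast
      rw [ENNReal.coe_toNNReal hSt]
      gcongr
      rw [ENNReal.inv_le_one]
      exact le_add_self) hψA
    set r := zNorm N k y with hr
    set t := y - zP N k y with ht
    have hzt : zP N k t = 0 := by rw [ht, map_sub, zP_idem, sub_self]
    refine ⟨Tr N r t ψ, hψ.tr hy t, fun x => mul_nonneg (by positivity) (hψ0 _), ?_, ?_, ?_⟩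
    · have := AE_tr hN hσ2 hψ hy hzt (Ω := univ) MeasurableSet.univ
      rw [preimage_univ] at this
      rw [this, hψA]
    · rw [DE_tr hψ hy t]; exact hψD
    · have hm : MeasurableSet (Bl N k y) := measurable_prodMk_right measurableSet_Bl
      have h1 := AE_tr (s := 1) hN (by norm_num) hψ hy hzt (Ω := Bl N k y) hm
      rw [← h1] at hyA
      have hsub : ∀ x ∈ (fun x => r • x + t) ⁻¹' Bl N k y, ‖x‖ ≤ 2 ∧ 3/4 ≤ zNorm N k x := by
        intro x hx
        have hx' : ‖r • x + t - y‖ < r / 4 := hx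
        have e : r • x + t - y = r • (x - r⁻¹ • zP N k y) := by
          rw [smul_sub, smul_smul, mul_inv_cancel₀ hy.ne', one_smul, ht]; abel
        rw [e, norm_smul, Real.norm_of_nonneg hy.le] at hx'
        have h2 : ‖x - r⁻¹ • zP N k y‖ < 1/4 := by
          by_contra! hc
          nlinarith
        have h3 : ‖r⁻¹ • zP N k y‖ = 1 := by
          rw [norm_smul, norm_inv, Real.norm_of_nonneg hy.le, ← zNorm_eq, ← hr, inv_mul_cancel₀ hy.ne']
        have h4 : zNorm N k (r⁻¹ • zP N k y) = 1 := by
          rw [zNorm_eq, map_smul, zP_idem, h3]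
        constructor
        · have := norm_le_norm_add_norm_sub' x (r⁻¹ • zP N k y)
          linarith
        · have := zNorm_sub_le (k := k) x (r⁻¹ • zP N k y)
          rw [abs_le] at this
          linarith
      have hmp : MeasurableSet ((fun x : Euc N => r • x + t) ⁻¹' Bl N k y) :=
        ((measurable_const_smul r).add_const t) hm
      have h5 : AE N k 1 (Tr N r t ψ) ((fun x => r • x + t) ⁻¹' Bl N k y) ≤
          ENNReal.ofReal (4/3) * ∫⁻ x in closedBall (0 : Euc N) 2, ‖Tr N r t ψ x‖ₑ ^ twoStar N 1 := by
        unfold AE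
        rw [← lintegral_const_mul' _ _ (by simp), ← lintegral_indicator hmp,
          ← lintegral_indicator measurableSet_closedBall]
        apply lintegral_mono
        intro x
        by_cases hx : x ∈ (fun x => r • x + t) ⁻¹' Bl N k y
        · obtain ⟨h6, h7⟩ := hsub x hx
          rw [indicator_of_mem hx, indicator_of_mem (by simpa using h6)]
          gcongr
          rw [wt]
          apply ENNReal.ofReal_le_ofReal
          rw [Real.rpow_neg_one, inv_le_iff_one_le_mul₀ (by linarith)]
          linarith
        · rw [indicator_of_notMem hx]; exact zero_le
      have h6 := hyA.trans h5
      push_cast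
      calc _ ≤ (Real.toNNReal (3/4) : ℝ≥0∞) * (ENNReal.ofReal (4/3) *
            ∫⁻ x in closedBall (0 : Euc N) 2, ‖Tr N r t ψ x‖ₑ ^ twoStar N 1) := by gcongr
        _ = _ := by
          rw [← mul_assoc]
          have : (Real.toNNReal (3/4) : ℝ≥0∞) * ENNReal.ofReal (4/3) = 1 := by
            change ENNReal.ofReal (3/4) * ENNReal.ofReal (4/3) = 1
            rw [← ENNReal.ofReal_mul (by norm_num)]; norm_num
          rw [this, one_mul]
  choose φ h1 h2 h3 h4 h5 using hstep
  refine ⟨φ, Real.toNNReal (3/4) * δ, ?_, h1, h2, h3, ?_, h5⟩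
  · apply mul_pos _ hδ
    rw [Real.toNNReal_pos]; norm_num
  · refine tendsto_of_tendsto_of_tendsto_of_le_of_le tendsto_const_nhds ?_
      (fun n => sInf_le ⟨φ n, h1 n, h3 n, rfl⟩) (fun n => (h4 n).le)
    have : Tendsto (fun n : ℕ => ((n : ℝ≥0∞) + 1)⁻¹) atTop (𝓝 0) := by
      have := (tendsto_add_atTop_iff_nat 1).2 ENNReal.tendsto_inv_nat_nhds_zero
      simpa using this
    have h6 := tendsto_const_nhds (x := SS N k σ).add this
    rw [add_zero] at h6
    exact h6


lemma weak_sub {H : Type*} [NormedAddCommGroup H] [InnerProductSpace ℝ H] [CompleteSpace H]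
    [TopologicalSpace.SeparableSpace H] (K : Submodule ℝ H) (v : ℕ → H) (hv : ∀ n, v n ∈ K)
    (R : ℝ) (hR : ∀ n, ‖v n‖ ≤ R) :
    ∃ x ∈ K.topologicalClosure, ∃ s : ℕ → ℕ, StrictMono s ∧
      ∀ y : H, Tendsto (fun n => inner ℝ (v (s n)) y) atTop (𝓝 (inner ℝ x y)) := by
  have h := WeakDual.isSeqCompact_closedBall ℝ H 0 R
  let f : ℕ → WeakDual ℝ H := fun n => StrongDual.toWeakDual (InnerProductSpace.toDual ℝ H (v n))
  have hf : ∀ n, f n ∈ (⇑WeakDual.toStrongDual ⁻¹' closedBall (0 : StrongDual ℝ H) R) := by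
    intro n
    simp only [mem_preimage, mem_closedBall, dist_zero_right, f]
    have : ‖InnerProductSpace.toDual ℝ H (v n)‖ ≤ R := by
      rw [LinearIsometryEquiv.norm_map]; exact hR n
    exact this
  obtain ⟨L, hL, s, hs, hlim⟩ := h hf
  let x := (InnerProductSpace.toDual ℝ H).symm (WeakDual.toStrongDual L)
  have hx : ∀ y, inner ℝ x y = L y := by
    intro y
    simp only [x]
    rw [InnerProductSpace.toDual_symm_apply]; rfl
  have hconv : ∀ y : H, Tendsto (fun n => inner ℝ (v (s n)) y) atTop (𝓝 (inner ℝ x y)) := by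
    intro y
    rw [hx]
    have h2 := ((WeakDual.eval_continuous y).tendsto L).comp hlim
    refine h2.congr fun n => ?_
    simp only [Function.comp, f]
    exact InnerProductSpace.toDual_apply_apply
  refine ⟨x, ?_, s, hs, hconv⟩
  rw [← Submodule.orthogonal_orthogonal_eq_closure, Submodule.mem_orthogonal]
  intro y hy
  have h3 := hconv y
  have h4 : ∀ n, inner ℝ (v (s n)) y = 0 := fun n => (Submodule.mem_orthogonal K y).1 hy _ (hv _)
  simp only [h4] at h3
  rw [real_inner_comm]
  exact (tendsto_nhds_unique h3 tendsto_const_nhds)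

abbrev EE (N : ℕ) := WithLp 2 (Euc N × ℝ)

lemma sepEE (N : ℕ) : TopologicalSpace.SeparableSpace (Lp (EE N) 2 (volume : Measure (Euc N))) := by
  have : Fact ((2:ℝ≥0∞) ≠ ⊤) := ⟨by norm_num⟩
  have : SecondCountableTopology (EE N) := by infer_instance
  have : SecondCountableTopology (Lp (EE N) 2 (volume : Measure (Euc N))) := by infer_instance
  infer_instance

def om (N : ℕ) (x : Euc N) : ℝ := (1 + ‖x‖) ^ (-((N:ℝ) + 1))

lemma om_pos {N : ℕ} (x : Euc N) : 0 < om N x := Real.rpow_pos_of_pos (by positivity) _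
lemma om_le_one {N : ℕ} (x : Euc N) : om N x ≤ 1 :=
  Real.rpow_le_one_of_one_le_of_nonpos (by linarith [norm_nonneg x]) (by
    have : (0:ℝ) ≤ N := by positivity
    linarith)
lemma om_cont (N : ℕ) : Continuous (om N) := by
  unfold om
  refine Continuous.rpow_const (by fun_prop) fun x => Or.inl (by positivity)
lemma om_int (N : ℕ) : Integrable (om N) volume := by
  have := integrable_one_add_norm (E := Euc N) (μ := volume) (r := (N:ℝ)+1) (by simp)
  exact this
lemma om_lint (N : ℕ) : ∫⁻ x, ENNReal.ofReal (om N x) ≠ ⊤ := by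
  have := (om_int N).2
  rw [hasFiniteIntegral_iff_ofReal (ae_of_all _ fun x => (om_pos x).le)] at this
  exact this.ne

lemma grad_eq {N : ℕ} (φ : Euc N → ℝ) (x v : Euc N) : inner ℝ (gradient φ x) v = fderiv ℝ φ x v := by
  unfold gradient
  exact InnerProductSpace.toDual_symm_apply
lemma grad_norm {N : ℕ} (φ : Euc N → ℝ) (x : Euc N) : ‖gradient φ x‖ = ‖fderiv ℝ φ x‖ := by
  unfold gradient
  rw [LinearIsometryEquiv.norm_map]
lemma grad_enorm {N : ℕ} (φ : Euc N → ℝ) (x : Euc N) : ‖gradient φ x‖ₑ = ‖fderiv ℝ φ x‖ₑ := by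
  rw [← ofReal_norm, grad_norm, ofReal_norm]
lemma Sm.contG {N : ℕ} {φ : Euc N → ℝ} (h : Sm φ) : Continuous (gradient φ) := by
  unfold gradient
  exact (LinearIsometryEquiv.continuous _).comp h.contD
lemma Sm.supG {N : ℕ} {φ : Euc N → ℝ} (h : Sm φ) : HasCompactSupport (gradient φ) := by
  have := (h.2.fderiv ℝ)
  exact this.comp_left (g := fun L => (InnerProductSpace.toDual ℝ (Euc N)).symm L) (by simp)
lemma Sm.memG {N : ℕ} {φ : Euc N → ℝ} (h : Sm φ) (q : ℝ≥0∞) : MemLp (gradient φ) q volume :=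
  h.contG.memLp_of_hasCompactSupport h.supG
lemma Sm.mem {N : ℕ} {φ : Euc N → ℝ} (h : Sm φ) (q : ℝ≥0∞) : MemLp φ q volume :=
  h.cont.memLp_of_hasCompactSupport h.2
lemma Sm.add {N : ℕ} {φ ψ : Euc N → ℝ} (h : Sm φ) (h' : Sm ψ) : Sm (fun x => φ x + ψ x) :=
  ⟨h.1.add h'.1, h.2.add h'.2⟩
lemma Sm.sub {N : ℕ} {φ ψ : Euc N → ℝ} (h : Sm φ) (h' : Sm ψ) : Sm (fun x => φ x - ψ x) := by
  have := h.add (h'.smul (-1))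
  refine (congrArg Sm ?_).mp this
  ext x; ring
lemma grad_add {N : ℕ} {φ ψ : Euc N → ℝ} (h : Sm φ) (h' : Sm ψ) (x : Euc N) :
    gradient (fun x => φ x + ψ x) x = gradient φ x + gradient ψ x := by
  unfold gradient
  rw [fderiv_fun_add (h.diff x) (h'.diff x), map_add]
lemma grad_smul {N : ℕ} {φ : Euc N → ℝ} (h : Sm φ) (c : ℝ) (x : Euc N) :
    gradient (fun x => c * φ x) x = c • gradient φ x := by
  unfold gradient
  rw [fderiv_const_mul (h.diff x)]; simp
lemma grad_sub {N : ℕ} {φ ψ : Euc N → ℝ} (h : Sm φ) (h' : Sm ψ) (x : Euc N) :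
    gradient (fun x => φ x - ψ x) x = gradient φ x - gradient ψ x := by
  unfold gradient
  rw [fderiv_fun_sub (h.diff x) (h'.diff x), map_sub]
lemma DE_grad {N : ℕ} (φ : Euc N → ℝ) : DE φ = ∫⁻ x, ‖gradient φ x‖ₑ ^ 2 := by
  simp only [grad_enorm]; rfl

def TT {N : ℕ} (φ : Euc N → ℝ) (x : Euc N) : EE N := WithLp.toLp 2 (gradient φ x, om N x * φ x)

lemma EE_enorm {N : ℕ} (e : EE N) : ‖e‖ₑ ^ 2 = ‖e.fst‖ₑ ^ 2 + ‖e.snd‖ₑ ^ 2 := by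
  rw [← ofReal_norm, ← ofReal_norm, ← ofReal_norm, ← ENNReal.ofReal_pow (by positivity),
    ← ENNReal.ofReal_pow (by positivity), ← ENNReal.ofReal_pow (by positivity),
    ← ENNReal.ofReal_add (by positivity) (by positivity), WithLp.prod_norm_sq_eq_of_L2]

lemma TT_mem {N : ℕ} {φ : Euc N → ℝ} (h : Sm φ) : MemLp (TT φ) 2 volume := by
  refine Continuous.memLp_of_hasCompactSupport ?_ ?_
  · exact (WithLp.prod_continuous_toLp 2 _ _).comp (h.contG.prodMk ((om_cont N).mul h.cont))
  · refine HasCompactSupport.intro h.2 fun x hx => ?_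
    have h1 : φ x = 0 := image_eq_zero_of_notMem_tsupport hx
    have h2 : gradient φ x = 0 := by
      have : fderiv ℝ φ x = 0 := by
        by_contra h3
        exact hx (support_fderiv_subset ℝ h3)
      unfold gradient; rw [this, map_zero]
    unfold TT; rw [h1, h2]; simp

def KK (N : ℕ) : Submodule ℝ (Lp (EE N) 2 (volume : Measure (Euc N))) where
  carrier := {v | ∃ φ : Euc N → ℝ, Sm φ ∧ v =ᵐ[volume] TT φ}
  add_mem' := by
    rintro a b ⟨φ, h, ha⟩ ⟨ψ, h', hb⟩
    refine ⟨_, h.add h', ?_⟩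
    filter_upwards [Lp.coeFn_add a b, ha, hb] with x h1 h2 h3
    rw [h1, Pi.add_apply, h2, h3]
    unfold TT
    rw [grad_add h h', mul_add, ← WithLp.toLp_add]; rfl
  zero_mem' := by
    refine ⟨fun _ => 0, ⟨contDiff_const, HasCompactSupport.zero⟩, ?_⟩
    filter_upwards [Lp.coeFn_zero (EE N) 2 (volume : Measure (Euc N))] with x h1
    rw [h1]; unfold TT gradient; simp; rfl
  smul_mem' := by
    rintro c a ⟨φ, h, ha⟩
    refine ⟨_, h.smul c, ?_⟩
    filter_upwards [Lp.coeFn_smul c a, ha] with x h1 h2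
    rw [h1, Pi.smul_apply, h2]
    unfold TT
    rw [grad_smul h, ← WithLp.toLp_smul]
    congr 1
    ext
    · simp
    · simp; ring

lemma om_sq_le {N : ℕ} {p : ℝ} (hp : 2 ≤ p) (x : Euc N) (t : ℝ) :
    ‖om N x * t‖ₑ ^ 2 ≤ ENNReal.ofReal (om N x) + ‖t‖ₑ ^ p := by
  have h0 := om_pos x
  have h1 := om_le_one x
  rw [← ofReal_norm, ← ofReal_norm, ← ENNReal.ofReal_pow (by positivity),
    ENNReal.ofReal_rpow_of_nonneg (by positivity) (by linarith), ← ENNReal.ofReal_add h0.le (by positivity)]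
  refine ENNReal.ofReal_le_ofReal ?_
  rw [norm_mul, mul_pow, Real.norm_of_nonneg h0.le]
  have h2 : om N x ^ 2 ≤ om N x := by nlinarith
  rcases le_total ‖t‖ 1 with ht | ht
  · have : ‖t‖ ^ 2 ≤ 1 := by nlinarith [norm_nonneg t]
    have h3 : om N x ^ 2 * ‖t‖ ^ 2 ≤ om N x ^ 2 * 1 := by gcongr
    have : 0 ≤ ‖t‖ ^ p := by positivity
    linarith
  · have h4 : ‖t‖ ^ 2 ≤ ‖t‖ ^ p := by
      rw [← Real.rpow_natCast]
      exact Real.rpow_le_rpow_of_exponent_le ht (by push_cast; exact hp)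
    have h3 : om N x ^ 2 * ‖t‖ ^ 2 ≤ 1 * ‖t‖ ^ 2 := by gcongr; linarith
    linarith

lemma AE_zero_simp {N k : ℕ} (u : Euc N → ℝ) : AE N k 0 u univ = ∫⁻ x, ‖u x‖ₑ ^ twoStar N 0 := by
  unfold AE wt
  simp

lemma TT_bdd {N : ℕ} (hN : 3 ≤ N) (M : ℝ≥0) : ∃ R : ℝ≥0, ∀ φ : Euc N → ℝ, Sm φ → DE φ ≤ M →
    eLpNorm (TT φ) 2 volume ≤ R := by
  obtain ⟨C, hC⟩ := AE_zero_bdd (k := 0) hN M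
  have h2 : (∫⁻ x, ENNReal.ofReal (om N x)) ≠ ⊤ := om_lint N
  refine ⟨((M : ℝ≥0∞) + ((∫⁻ x, ENNReal.ofReal (om N x)) + C)) ^ (1/2:ℝ) |>.toNNReal, fun φ h hD => ?_⟩
  rw [ENNReal.coe_toNNReal (by
    refine ENNReal.rpow_ne_top_of_nonneg (by norm_num) ?_
    simp [h2]), eLpNorm_two_eq]
  refine ENNReal.rpow_le_rpow ?_ (by norm_num)
  simp only [EE_enorm]
  have hm : Measurable (fun x => ‖gradient φ x‖ₑ ^ 2) := h.contG.enorm.measurable.pow_const _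
  have : ∀ x, ‖(TT φ x).fst‖ₑ ^ 2 + ‖(TT φ x).snd‖ₑ ^ 2 ≤
      ‖gradient φ x‖ₑ ^ 2 + (ENNReal.ofReal (om N x) + ‖φ x‖ₑ ^ twoStar N 0) := fun x =>
    add_le_add le_rfl (om_sq_le (twoStar_gt hN (by norm_num)).le x _)
  refine (lintegral_mono this).trans ?_
  rw [lintegral_add_left hm, lintegral_add_left (om_cont N).measurable.ennreal_ofReal]
  refine add_le_add ?_ (add_le_add le_rfl ?_)
  · rw [← DE_grad]; exact hD
  · rw [← AE_zero_simp (k := 0)]; exact hC φ h hD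

lemma eLpNorm_le_of_enorm {N : ℕ} {F G : Type*} [NormedAddCommGroup F] [NormedAddCommGroup G]
    {f : Euc N → F} {g : Euc N → G} {q : ℝ≥0∞} (h : ∀ᵐ x, ‖f x‖ₑ ≤ ‖g x‖ₑ) :
    eLpNorm f q volume ≤ eLpNorm g q volume := eLpNorm_mono_enorm_ae h

lemma EE_fst {N : ℕ} (e : EE N) : ‖e.fst‖ₑ ≤ ‖e‖ₑ := by
  have := EE_enorm e
  have h : ‖e.fst‖ₑ ^ 2 ≤ ‖e‖ₑ ^ 2 := by rw [this]; exact le_self_add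
  exact (ENNReal.pow_le_pow_left_iff (by norm_num)).1 h
lemma EE_snd {N : ℕ} (e : EE N) : ‖e.snd‖ₑ ≤ ‖e‖ₑ := by
  have := EE_enorm e
  have h : ‖e.snd‖ₑ ^ 2 ≤ ‖e‖ₑ ^ 2 := by rw [this]; exact le_add_self
  exact (ENNReal.pow_le_pow_left_iff (by norm_num)).1 h

lemma weak_lim {N : ℕ} (hN : 3 ≤ N) (M : ℝ≥0) (φ : ℕ → Euc N → ℝ) (hφ : ∀ n, Sm (φ n))
    (hM : ∀ n, DE (φ n) ≤ M) :
    ∃ (s : ℕ → ℕ) (u : Euc N → ℝ) (g : Euc N → Euc N) (ψ : ℕ → Euc N → ℝ), StrictMono s ∧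
      Measurable u ∧ MemLp g 2 volume ∧ StronglyMeasurable g ∧
      MemLp (fun x => om N x * u x) 2 volume ∧
      (∀ η : Euc N → Euc N, MemLp η 2 volume →
        Tendsto (fun n => ∫ x, inner ℝ (gradient (φ (s n)) x) (η x)) atTop (𝓝 (∫ x, inner ℝ (g x) (η x)))) ∧
      (∀ ζ : Euc N → ℝ, MemLp ζ 2 volume →
        Tendsto (fun n => ∫ x, om N x * φ (s n) x * ζ x) atTop (𝓝 (∫ x, om N x * u x * ζ x)) ∧
        Tendsto (fun n => ∫ x, om N x * ψ n x * ζ x) atTop (𝓝 (∫ x, om N x * u x * ζ x))) ∧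
      (∀ j, Sm (ψ j)) ∧ (∀ᵐ x, Tendsto (fun j => ψ j x) atTop (𝓝 (u x))) ∧
      Tendsto (fun j => eLpNorm (fun x => g x - gradient (ψ j) x) 2 volume) atTop (𝓝 0) := by
  obtain ⟨R, hR⟩ := TT_bdd hN M
  have := sepEE N
  let v : ℕ → Lp (EE N) 2 (volume : Measure (Euc N)) := fun n => (TT_mem (hφ n)).toLp _
  obtain ⟨V, hV, s, hs, hw⟩ := weak_sub (KK N) v (fun n => ⟨φ n, hφ n, MemLp.coeFn_toLp _⟩) R (by
    intro n
    simp only [v]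
    rw [Lp.norm_toLp]
    exact ENNReal.toReal_le_coe_of_le_coe (hR _ (hφ n) (hM n)))
  have hVs := Lp.stronglyMeasurable V
  have hfst : Continuous (fun e : EE N => e.fst) := by fun_prop
  have hsnd : Continuous (fun e : EE N => e.snd) := by fun_prop
  have hVm := Lp.memLp V
  have hg : StronglyMeasurable (fun x => (V x).fst) := hfst.comp_stronglyMeasurable hVs
  have hu : StronglyMeasurable (fun x => (V x).snd) := hsnd.comp_stronglyMeasurable hVs
  have hom : ∀ x, om N x * ((om N x)⁻¹ * (V x).snd) = (V x).snd := fun x => by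
    rw [← mul_assoc, mul_inv_cancel₀ (om_pos x).ne', one_mul]
  -- approximants
  have hV' : V ∈ closure ((KK N : Submodule ℝ _) : Set (Lp (EE N) 2 (volume : Measure (Euc N)))) := by
    rw [← Submodule.topologicalClosure_coe]; exact hV
  obtain ⟨y, hyK, hy⟩ := mem_closure_iff_seq_limit.1 hV'
  choose ψ0 hψ0 hyψ using hyK
  obtain ⟨ns, hns, hae⟩ := (tendstoInMeasure_of_tendsto_Lp hy).exists_seq_tendsto_ae
  refine ⟨s, fun x => (om N x)⁻¹ * (V x).snd, fun x => (V x).fst, fun j => ψ0 (ns j), hs,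
    ((om_cont N).measurable.inv).mul hu.measurable, ?_, hg, ?_, ?_, ?_, fun j => hψ0 _, ?_, ?_⟩
  · exact ⟨hg.aestronglyMeasurable, (eLpNorm_le_of_enorm (ae_of_all _ fun x => EE_fst (V x))).trans_lt hVm.2⟩
  · simp only [hom]
    exact ⟨hu.aestronglyMeasurable, (eLpNorm_le_of_enorm (ae_of_all _ fun x => EE_snd (V x))).trans_lt hVm.2⟩
  · intro η hη
    have hη' : MemLp (fun x => (WithLp.toLp 2 (η x, (0:ℝ)) : EE N)) 2 volume := by
      refine ⟨((WithLp.prod_continuous_toLp 2 _ _).comp (by fun_prop : Continuous fun e : Euc N => (e, (0:ℝ)))).comp_aestronglyMeasurable hη.1, ?_⟩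
      refine (eLpNorm_le_of_enorm (g := η) (ae_of_all _ fun x => ?_)).trans_lt hη.2
      refine (ENNReal.pow_le_pow_left_iff (n := 2) (by norm_num)).1 ?_
      rw [EE_enorm]; simp
    have h1 := hw (hη'.toLp _)
    have h2 : ∀ (W : Lp (EE N) 2 (volume : Measure (Euc N))) (f : Euc N → EE N), W =ᵐ[volume] f →
        inner ℝ W (hη'.toLp _) = ∫ x, inner ℝ (f x).fst (η x) := by
      intro W f hf
      rw [L2.inner_def]
      refine integral_congr_ae ?_
      filter_upwards [hf, hη'.coeFn_toLp] with x h3 h4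
      rw [h3, h4, WithLp.prod_inner_apply]; simp
    rw [h2 V V (ae_eq_refl _)] at h1
    exact h1.congr fun n => h2 _ _ (MemLp.coeFn_toLp _)
  · intro ζ hζ
    have hη' : MemLp (fun x => (WithLp.toLp 2 ((0:Euc N), ζ x) : EE N)) 2 volume := by
      refine ⟨((WithLp.prod_continuous_toLp 2 _ _).comp (by fun_prop : Continuous fun e : ℝ => ((0:Euc N), e))).comp_aestronglyMeasurable hζ.1, ?_⟩
      refine (eLpNorm_le_of_enorm (g := ζ) (ae_of_all _ fun x => ?_)).trans_lt hζ.2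
      refine (ENNReal.pow_le_pow_left_iff (n := 2) (by norm_num)).1 ?_
      rw [EE_enorm]; simp
    have h1 := hw (hη'.toLp _)
    have h2 : ∀ (W : Lp (EE N) 2 (volume : Measure (Euc N))) (f : Euc N → EE N), W =ᵐ[volume] f →
        inner ℝ W (hη'.toLp _) = ∫ x, (f x).snd * ζ x := by
      intro W f hf
      rw [L2.inner_def]
      refine integral_congr_ae ?_
      filter_upwards [hf, hη'.coeFn_toLp] with x h3 h4
      rw [h3, h4, WithLp.prod_inner_apply]; simp [mul_comm]
    have h3 : Tendsto (fun j => inner ℝ (y (ns j)) (hη'.toLp _)) atTop (𝓝 (inner ℝ V (hη'.toLp _))) :=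
      (hy.comp hns.tendsto_atTop).inner tendsto_const_nhds
    rw [h2 V V (ae_eq_refl _)] at h1 h3
    simp only [hom]
    exact ⟨h1.congr fun n => h2 _ _ (MemLp.coeFn_toLp _), h3.congr fun n => h2 _ _ (hyψ _)⟩
  · have h5 : ∀ᵐ x, ∀ j, (y (ns j) : Euc N → EE N) x = TT (ψ0 (ns j)) x :=
      ae_all_iff.2 fun j => hyψ _
    filter_upwards [hae, h5] with x h6 h7
    have h8 := ((hsnd.tendsto _).comp h6).const_mul ((om N x)⁻¹)
    refine h8.congr fun j => ?_
    simp only [Function.comp, h7]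
    show (om N x)⁻¹ * (om N x * ψ0 (ns j) x) = _
    rw [← mul_assoc, inv_mul_cancel₀ (om_pos x).ne', one_mul]
  · have h9 := (Lp.tendsto_Lp_iff_tendsto_eLpNorm' _ _).1 (hy.comp hns.tendsto_atTop)
    refine tendsto_of_tendsto_of_tendsto_of_le_of_le tendsto_const_nhds h9 (fun _ => zero_le) fun j => ?_
    refine eLpNorm_le_of_enorm ?_
    filter_upwards [hyψ (ns j)] with x h7
    have := EE_fst ((y (ns j) : Euc N → EE N) x - V x)
    simp only [Pi.sub_apply, Function.comp]
    refine le_trans (le_of_eq ?_) this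
    rw [h7, ← enorm_neg, neg_sub]; rfl


lemma conv_star {N : ℕ} (hN : 3 ≤ N) {ψ : ℕ → Euc N → ℝ} (hψ : ∀ j, Sm (ψ j)) {u : Euc N → ℝ}
    {g : Euc N → Euc N} (hg : AEStronglyMeasurable g volume)
    (hae : ∀ᵐ x, Tendsto (fun j => ψ j x) atTop (𝓝 (u x)))
    (hlim : Tendsto (fun j => eLpNorm (fun x => g x - gradient (ψ j) x) 2 volume) atTop (𝓝 0)) :
    Tendsto (fun n => eLpNorm (fun x => u x - ψ n x)
      (ENNReal.ofReal (2 * (N : ℝ) / ((N : ℝ) - 2))) volume) atTop (𝓝 0) := by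
  obtain ⟨C, hC⟩ := sob hN
  set q := ENNReal.ofReal (2 * (N : ℝ) / ((N : ℝ) - 2))
  set a := fun j => eLpNorm (fun x => g x - gradient (ψ j) x) 2 volume with ha
  have key : ∀ j, eLpNorm (fun x => u x - ψ j x) q volume ≤ C * a j := by
    intro j
    have h1 := Lp.eLpNorm_lim_le_liminf_eLpNorm (p := q) (μ := volume)
      (f := fun i x => ψ i x - ψ j x) (fun i => ((hψ i).sub (hψ j)).asm) (fun x => u x - ψ j x)
      (by filter_upwards [hae] with x hx; exact hx.sub_const _)
    refine h1.trans ?_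
    have h2 : ∀ i, eLpNorm (fun x => ψ i x - ψ j x) q volume ≤ C * (a j + a i) := by
      intro i
      refine (hC _ ((hψ i).sub (hψ j))).trans ?_
      gcongr
      have h3 : eLpNorm (fderiv ℝ (fun x => ψ i x - ψ j x)) 2 volume =
          eLpNorm (fun x => (g x - gradient (ψ j) x) - (g x - gradient (ψ i) x)) 2 volume := by
        refine eLpNorm_congr_enorm_ae (ae_of_all _ fun x => ?_)
        rw [← grad_enorm, grad_sub (hψ i) (hψ j)]
        congr 1; abel
      rw [h3]
      exact eLpNorm_sub_le (hg.sub (hψ j).contG.aestronglyMeasurable)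
        (hg.sub (hψ i).contG.aestronglyMeasurable) (by norm_num)
    have h4 : Tendsto (fun i => (C:ℝ≥0∞) * (a j + a i)) atTop (𝓝 (C * (a j + 0))) :=
      ENNReal.Tendsto.const_mul (tendsto_const_nhds.add hlim) (Or.inr ENNReal.coe_ne_top)
    rw [add_zero] at h4
    rw [← h4.liminf_eq]
    exact liminf_le_liminf (Eventually.of_forall h2)
  have h5 : Tendsto (fun j => (C:ℝ≥0∞) * a j) atTop (𝓝 (C * 0)) :=
    ENNReal.Tendsto.const_mul hlim (Or.inr ENNReal.coe_ne_top)
  rw [mul_zero] at h5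
  exact tendsto_of_tendsto_of_tendsto_of_le_of_le tendsto_const_nhds h5 (fun _ => zero_le) key

def Com (N : ℕ) : ℝ≥0∞ := (∫⁻ x, ENNReal.ofReal (om N x)) ^ (1/2:ℝ)
lemma Com_ne_top (N : ℕ) : Com N ≠ ⊤ := ENNReal.rpow_ne_top_of_nonneg (by norm_num) (om_lint N)

lemma tr_est {N : ℕ} {θ : Euc N → ℝ} (h : Sm θ) (v : Euc N) :
    ∫⁻ x, ENNReal.ofReal (om N x) * ‖θ (x + v) - θ x‖ₑ ≤ ‖v‖ₑ * (Com N * DE θ ^ (1/2:ℝ)) := by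
  have hD : Measurable (fun q : Euc N × ℝ => ‖fderiv ℝ θ (q.1 + q.2 • v)‖ₑ) :=
    have hc : Continuous (fun q : Euc N × ℝ => q.1 + q.2 • v) := by fun_prop
    (h.contD.comp hc).enorm.measurable
  have hDx : ∀ x, Measurable (fun s : ℝ => ‖fderiv ℝ θ (x + s • v)‖ₑ) := fun x =>
    have hc : Continuous (fun s : ℝ => x + s • v) := by fun_prop
    (h.contD.comp hc).enorm.measurable
  have hDs : ∀ s : ℝ, Measurable (fun x : Euc N => ‖fderiv ℝ θ (x + s • v)‖ₑ) := fun s =>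
    have hc : Continuous (fun x : Euc N => x + s • v) := by fun_prop
    (h.contD.comp hc).enorm.measurable
  have h1 : ∀ x, ‖θ (x + v) - θ x‖ₑ ≤ ‖v‖ₑ * ∫⁻ s in Icc (0:ℝ) 1, ‖fderiv ℝ θ (x + s • v)‖ₑ := by
    intro x
    have hder : ∀ s : ℝ, HasDerivAt (fun s : ℝ => θ (x + s • v)) (fderiv ℝ θ (x + s • v) v) s := by
      intro s
      have h2 : HasDerivAt (fun s : ℝ => x + s • v) v s := by
        simpa using ((hasDerivAt_id s).smul_const v).const_add x
      exact (h.diff _).hasFDerivAt.comp_hasDerivAt s h2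
    have h3 := enorm_sub_le_lintegral_deriv_of_contDiffOn_Icc (f := fun s : ℝ => θ (x + s • v))
      (a := 0) (b := 1) ((h.c1.comp (by fun_prop)).contDiffOn) (by norm_num)
    simp only [one_smul, zero_smul, add_zero] at h3
    refine h3.trans ?_
    have hm : Measurable (fun s : ℝ => ‖fderiv ℝ θ (x + s • v)‖ₑ) := hDx x
    rw [← lintegral_const_mul _ hm]
    refine lintegral_mono fun s => ?_
    rw [(hder s).deriv, mul_comm]
    exact ContinuousLinearMap.le_opENorm _ _
  have hom : Measurable (fun x => ENNReal.ofReal (om N x)) := (om_cont N).measurable.ennreal_ofReal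
  calc ∫⁻ x, ENNReal.ofReal (om N x) * ‖θ (x + v) - θ x‖ₑ
      ≤ ∫⁻ x, ∫⁻ s in Icc (0:ℝ) 1, ‖v‖ₑ * (ENNReal.ofReal (om N x) * ‖fderiv ℝ θ (x + s • v)‖ₑ) := by
        refine lintegral_mono fun x => ?_
        have hm : Measurable (fun s : ℝ => ‖fderiv ℝ θ (x + s • v)‖ₑ) := hDx x
        have hm2 : Measurable (fun s : ℝ => ENNReal.ofReal (om N x) * ‖fderiv ℝ θ (x + s • v)‖ₑ) := hm.const_mul _
        rw [lintegral_const_mul _ hm2, lintegral_const_mul _ hm]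
        calc _ ≤ ENNReal.ofReal (om N x) * (‖v‖ₑ * ∫⁻ s in Icc (0:ℝ) 1, ‖fderiv ℝ θ (x + s • v)‖ₑ) := by
              gcongr; exact h1 x
          _ = _ := by ring
    _ = ∫⁻ s in Icc (0:ℝ) 1, ∫⁻ x, ‖v‖ₑ * (ENNReal.ofReal (om N x) * ‖fderiv ℝ θ (x + s • v)‖ₑ) := by
        refine lintegral_lintegral_swap (Measurable.aemeasurable ?_)
        have hm2 : Measurable (fun q : Euc N × ℝ => ENNReal.ofReal (om N q.1) * ‖fderiv ℝ θ (q.1 + q.2 • v)‖ₑ) :=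
          (hom.comp measurable_fst).mul hD
        exact hm2.const_mul _
    _ ≤ ∫⁻ s in Icc (0:ℝ) 1, ‖v‖ₑ * (Com N * DE θ ^ (1/2:ℝ)) := by
        refine lintegral_mono fun s => ?_
        have hm : Measurable (fun x : Euc N => ‖fderiv ℝ θ (x + s • v)‖ₑ) := hDs s
        simp only
        have hm2 : Measurable (fun x : Euc N => ENNReal.ofReal (om N x) * ‖fderiv ℝ θ (x + s • v)‖ₑ) := hom.mul hm
        rw [lintegral_const_mul _ hm2]
        refine mul_le_mul_right ?_ _
        have := ENNReal.lintegral_mul_le_Lp_mul_Lq volume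
          (Real.holderConjugate_iff.2 ⟨by norm_num, by norm_num⟩ : (2:ℝ).HolderConjugate 2)
          hom.aemeasurable hm.aemeasurable
        simp only [Pi.mul_apply] at this
        refine this.trans ?_
        refine mul_le_mul' ?_ ?_
        · refine ENNReal.rpow_le_rpow (lintegral_mono fun x => ?_) (by norm_num)
          simp only
          rw [ENNReal.ofReal_rpow_of_nonneg (om_pos x).le (by norm_num)]
          refine ENNReal.ofReal_le_ofReal ?_
          rw [Real.rpow_two]
          nlinarith [om_pos x, om_le_one x]
        · refine ENNReal.rpow_le_rpow (le_of_eq ?_) (by norm_num)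
          simp only [ENNReal.rpow_two]
          exact lintegral_add_right_eq_self (fun x => ‖fderiv ℝ θ x‖ₑ ^ 2) (s • v)
    _ = _ := by simp

/-- mollification -/
def Mo {N : ℕ} (ρ : Euc N → ℝ) (a : ℝ) (v : Euc N → ℝ) (x : Euc N) : ℝ :=
  (a ^ N)⁻¹ * ∫ y, ρ (a⁻¹ • (x - y)) * v y

lemma Mo_eq {N : ℕ} {ρ : Euc N → ℝ} {a : ℝ} (ha : 0 < a) (v : Euc N → ℝ) (x : Euc N) :
    Mo ρ a v x = ∫ X, ρ X * v (x - a • X) := by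
  have h1 := Measure.integral_comp_smul (volume : Measure (Euc N))
    (fun Y => ρ (a⁻¹ • Y) * v (x - Y)) a
  have h2 := integral_sub_left_eq_self (fun y => ρ (a⁻¹ • (x - y)) * v y) (volume : Measure (Euc N)) x
  simp only [sub_sub_cancel] at h2
  rw [h2] at h1
  unfold Mo
  rw [smul_eq_mul, abs_of_nonneg (by positivity), finrank_euclideanSpace_fin] at h1
  rw [← h1]
  congr 1; ext X
  rw [smul_smul, inv_mul_cancel₀ ha.ne', one_smul]

lemma Mo_meas {N : ℕ} {ρ : Euc N → ℝ} (hρ : Continuous ρ) (a : ℝ) {v : Euc N → ℝ} (hv : Measurable v) :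
    Measurable (Mo ρ a v) := by
  unfold Mo
  refine Measurable.const_mul (StronglyMeasurable.measurable ?_) _
  refine StronglyMeasurable.integral_prod_right (f := fun x y => ρ (a⁻¹ • (x - y)) * v y) ?_
  refine Measurable.stronglyMeasurable ?_
  exact ((hρ.comp (by fun_prop : Continuous fun q : Euc N × Euc N => a⁻¹ • (q.1 - q.2))).measurable).mul
    (hv.comp measurable_snd)

lemma Mo_est {N : ℕ} {ρ : Euc N → ℝ} (hρ : Sm ρ) (hρ1 : ∀ x, 1 ≤ ‖x‖ → ρ x = 0) {a : ℝ} (ha : 0 < a)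
    {θ : Euc N → ℝ} (h : Sm θ) :
    ∫⁻ x, ENNReal.ofReal (om N x) * ‖(∫ X, ρ X) * θ x - Mo ρ a θ x‖ₑ ≤
      ENNReal.ofReal a * ((∫⁻ X, ‖ρ X‖ₑ) * (Com N * DE θ ^ (1/2:ℝ))) := by
  have hom : Measurable (fun x => ENNReal.ofReal (om N x)) := (om_cont N).measurable.ennreal_ofReal
  have hm : Measurable (fun q : Euc N × Euc N => ‖θ (q.1 + -(a • q.2)) - θ q.1‖ₑ) :=
    have hc : Continuous (fun q : Euc N × Euc N => q.1 + -(a • q.2)) := by fun_prop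
    ((h.cont.comp hc).sub (h.cont.comp continuous_fst)).enorm.measurable
  have hmX : ∀ x, Measurable (fun X => ‖θ (x + -(a • X)) - θ x‖ₑ) := fun x =>
    have hc : Continuous (fun X : Euc N => x + -(a • X)) := by fun_prop
    ((h.cont.comp hc).sub continuous_const).enorm.measurable
  have hmx : ∀ X, Measurable (fun x => ‖θ (x + -(a • X)) - θ x‖ₑ) := fun X =>
    have hc : Continuous (fun x : Euc N => x + -(a • X)) := by fun_prop
    ((h.cont.comp hc).sub h.cont).enorm.measurable
  have hρm : Measurable (fun X => ‖ρ X‖ₑ) := hρ.cont.enorm.measurable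
  have h1 : ∀ x, ‖(∫ X, ρ X) * θ x - Mo ρ a θ x‖ₑ ≤ ∫⁻ X, ‖ρ X‖ₑ * ‖θ (x + -(a • X)) - θ x‖ₑ := by
    intro x
    rw [Mo_eq ha, ← integral_mul_const, ← integral_sub]
    · refine (enorm_integral_le_lintegral_enorm _).trans (lintegral_mono fun X => ?_)
      simp only
      rw [← mul_sub, enorm_mul, ← sub_eq_add_neg, ← enorm_neg (θ (x - a • X) - θ x), neg_sub]
    · exact (hρ.cont.integrable_of_hasCompactSupport hρ.2).mul_const _
    · refine Continuous.integrable_of_hasCompactSupport (hρ.cont.mul (h.cont.comp (by fun_prop))) ?_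
      exact hρ.2.mul_right
  calc _ ≤ ∫⁻ x, ∫⁻ X, ‖ρ X‖ₑ * (ENNReal.ofReal (om N x) * ‖θ (x + -(a • X)) - θ x‖ₑ) := by
        refine lintegral_mono fun x => ?_
        refine (mul_le_mul_right (h1 x) _).trans (le_of_eq ?_)
        have hx : Measurable (fun X => ‖θ (x + -(a • X)) - θ x‖ₑ) := hmX x
        have hx2 : Measurable (fun X => ‖ρ X‖ₑ * ‖θ (x + -(a • X)) - θ x‖ₑ) := hρm.mul hx
        rw [← lintegral_const_mul _ hx2]
        congr 1; ext X; ring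
    _ = ∫⁻ X, ∫⁻ x, ‖ρ X‖ₑ * (ENNReal.ofReal (om N x) * ‖θ (x + -(a • X)) - θ x‖ₑ) := by
        refine lintegral_lintegral_swap (Measurable.aemeasurable ?_)
        have hx2 : Measurable (fun q : Euc N × Euc N => ENNReal.ofReal (om N q.1) * ‖θ (q.1 + -(a • q.2)) - θ q.1‖ₑ) :=
          (hom.comp measurable_fst).mul hm
        have hx3 : Measurable (fun q : Euc N × Euc N => ‖ρ q.2‖ₑ) := hρm.comp measurable_snd
        exact hx3.mul hx2
    _ ≤ ∫⁻ X, ‖ρ X‖ₑ * (ENNReal.ofReal a * (Com N * DE θ ^ (1/2:ℝ))) := by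
        refine lintegral_mono fun X => ?_
        have hx : Measurable (fun x => ‖θ (x + -(a • X)) - θ x‖ₑ) := hmx X
        simp only
        have hx2 : Measurable (fun x => ENNReal.ofReal (om N x) * ‖θ (x + -(a • X)) - θ x‖ₑ) := hom.mul hx
        rw [lintegral_const_mul _ hx2]
        by_cases hX : 1 ≤ ‖X‖
        · rw [hρ1 X hX]; simp
        · refine mul_le_mul_right ((tr_est h _).trans ?_) _
          refine mul_le_mul_left ?_ _
          rw [enorm_neg, ← ofReal_norm, norm_smul, Real.norm_of_nonneg ha.le]
          refine ENNReal.ofReal_le_ofReal ?_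
          nlinarith [norm_nonneg X]
    _ = _ := by
        rw [lintegral_mul_const _ hρm]; ring


lemma enorm_le_one_add_rpow {p : ℝ} (hp : 1 ≤ p) (t : ℝ≥0∞) : t ≤ 1 + t ^ p := by
  rcases le_total t 1 with h | h
  · exact h.trans le_self_add
  · refine le_trans ?_ le_add_self
    conv_lhs => rw [← ENNReal.rpow_one t]
    exact ENNReal.rpow_le_rpow_of_exponent_le h hp

lemma ker_sm {N : ℕ} {ρ : Euc N → ℝ} (hρ : Sm ρ) {a : ℝ} (ha : 0 < a) (x : Euc N) :
    Sm (fun y => ρ (a⁻¹ • (x - y))) := by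
  refine ⟨hρ.1.comp (by fun_prop), ?_⟩
  refine hρ.2.comp_homeomorph ((Homeomorph.subLeft x).trans (Homeomorph.smulOfNeZero a⁻¹ (by positivity)))

/-- Uniform pointwise bound for mollifications. -/
lemma Mo_bdd {N : ℕ} (hN : 3 ≤ N) {ρ : Euc N → ℝ} (hρ : Sm ρ) {a : ℝ} (ha : 0 < a) (C : ℝ≥0) :
    ∃ R : ℝ≥0, ∀ v : Euc N → ℝ, Measurable v → (∫⁻ x, ‖v x‖ₑ ^ twoStar N 0) ≤ C →
      ∀ x, ‖Mo ρ a v x‖ₑ ≤ R := by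
  obtain ⟨K, hK⟩ := hρ.cont.bounded_above_of_compact_support hρ.2
  have hK0 : 0 ≤ K := (norm_nonneg _).trans (hK 0)
  have hIntg : (∫⁻ X, ‖ρ X‖ₑ) ≠ ⊤ := by
    have := (hρ.cont.integrable_of_hasCompactSupport (μ := volume) hρ.2).2
    exact this.ne
  let A : ℝ≥0∞ := ENNReal.ofReal ((a^N)⁻¹) * (ENNReal.ofReal (((a⁻¹)^N)⁻¹) * (∫⁻ X, ‖ρ X‖ₑ) + ENNReal.ofReal K * C)
  have hA : A ≠ ⊤ := by
    refine ENNReal.mul_ne_top ENNReal.ofReal_ne_top (ENNReal.add_ne_top.2 ⟨?_, ?_⟩)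
    · exact ENNReal.mul_ne_top ENNReal.ofReal_ne_top hIntg
    · exact ENNReal.mul_ne_top ENNReal.ofReal_ne_top ENNReal.coe_ne_top
  refine ⟨A.toNNReal, fun v hv hC x => ?_⟩
  rw [ENNReal.coe_toNNReal hA]
  unfold Mo
  rw [enorm_mul, Real.enorm_of_nonneg (by positivity)]
  refine mul_le_mul_right ((enorm_integral_le_lintegral_enorm _).trans ?_) _
  have hm : Measurable (fun y => ‖ρ (a⁻¹ • (x - y))‖ₑ) := (ker_sm hρ ha x).cont.enorm.measurable
  have h1 : ∀ y, ‖ρ (a⁻¹ • (x - y)) * v y‖ₑ ≤ ‖ρ (a⁻¹ • (x - y))‖ₑ + ENNReal.ofReal K * ‖v y‖ₑ ^ twoStar N 0 := by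
    intro y
    rw [enorm_mul]
    refine (mul_le_mul_right (enorm_le_one_add_rpow (p := twoStar N 0) ?_ _) _).trans ?_
    · linarith [twoStar_gt (σ := 0) hN (by norm_num)]
    · rw [mul_add, mul_one]
      refine add_le_add le_rfl (mul_le_mul_left ?_ _)
      rw [← ofReal_norm]; exact ENNReal.ofReal_le_ofReal (hK _)
  refine (lintegral_mono h1).trans ?_
  have hv2 : Measurable (fun y => ‖v y‖ₑ ^ twoStar N 0) := hv.enorm.pow_const _
  rw [lintegral_add_left hm, lintegral_const_mul _ hv2]
  refine add_le_add (le_of_eq ?_) (mul_le_mul_right hC _)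
  have h2 := lint_aff (N := N) (r := a⁻¹) (by positivity) 0 (F := fun X => ‖ρ X‖ₑ) hρ.cont.enorm.measurable
  rw [← h2]
  simp only [add_zero]
  exact lintegral_sub_left_eq_self (fun y => ‖ρ (a⁻¹ • y)‖ₑ) x

lemma rellich {N : ℕ} (hN : 3 ≤ N) (M : ℝ≥0) {φ ψ : ℕ → Euc N → ℝ} (hφ : ∀ n, Sm (φ n)) (hψ : ∀ n, Sm (ψ n))
    (hM : ∀ n, DE (φ n) ≤ M) (hM' : ∀ n, DE (ψ n) ≤ M) {u : Euc N → ℝ} (hu : Measurable u)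
    (hae : ∀ᵐ x, Tendsto (fun j => ψ j x) atTop (𝓝 (u x)))
    (hw : ∀ ζ : Euc N → ℝ, MemLp ζ 2 volume →
        Tendsto (fun n => ∫ x, om N x * φ n x * ζ x) atTop (𝓝 (∫ x, om N x * u x * ζ x)))
    (hw' : ∀ ζ : Euc N → ℝ, MemLp ζ 2 volume →
        Tendsto (fun n => ∫ x, om N x * ψ n x * ζ x) atTop (𝓝 (∫ x, om N x * u x * ζ x))) :
    Tendsto (fun n => ∫⁻ x, ENNReal.ofReal (om N x) * ‖φ n x - u x‖ₑ) atTop (𝓝 0) := by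
  obtain ⟨ρ, hρ, hρ1, hρ0, -, hρ2, -⟩ := exists_bump N
  have hρ0' : ∀ x, 1 ≤ ‖x‖ → ρ x = 0 := fun x hx => hρ0 x (by linarith)
  obtain ⟨C, hC⟩ := AE_zero_bdd (k := 0) hN M
  simp only [AE_zero_simp] at hC
  have hom : Measurable (fun x => ENNReal.ofReal (om N x)) := (om_cont N).measurable.ennreal_ofReal
  have hρi := hρ.cont.integrable_of_hasCompactSupport (μ := volume) hρ.2
  set c := ∫ X, ρ X with hc
  have hcpos : 0 < c := by
    rw [hc]
    refine (hρ.cont.integral_pos_of_hasCompactSupport_nonneg_nonzero hρ.2 (fun x => (hρ2 x).1) (x := 0) ?_)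
    rw [hρ1 0 (by norm_num)]; norm_num
  set B : ℝ≥0∞ := (∫⁻ X, ‖ρ X‖ₑ) * (Com N * (M:ℝ≥0∞) ^ (1/2:ℝ)) with hB
  have hBt : B ≠ ⊤ := ENNReal.mul_ne_top hρi.2.ne (ENNReal.mul_ne_top (Com_ne_top N)
    (ENNReal.rpow_ne_top_of_nonneg (by norm_num) ENNReal.coe_ne_top))
  have hest : ∀ (a : ℝ), 0 < a → ∀ θ : Euc N → ℝ, Sm θ → DE θ ≤ M →
      ∫⁻ x, ENNReal.ofReal (om N x) * ‖c * θ x - Mo ρ a θ x‖ₑ ≤ ENNReal.ofReal a * B := by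
    intro a ha θ hθ hθM
    refine (Mo_est hρ hρ0' ha hθ).trans ?_
    rw [hB]; gcongr
  -- pointwise convergence of mollifications
  have hpt : ∀ (a : ℝ), 0 < a → ∀ θ : ℕ → Euc N → ℝ, (∀ ζ : Euc N → ℝ, MemLp ζ 2 volume →
        Tendsto (fun n => ∫ x, om N x * θ n x * ζ x) atTop (𝓝 (∫ x, om N x * u x * ζ x))) → ∀ x,
        Tendsto (fun n => Mo ρ a (θ n) x) atTop (𝓝 (Mo ρ a u x)) := by
    intro a ha θ hθ x
    have hk := ker_sm hρ ha x
    have hζ : MemLp (fun y => (om N y)⁻¹ * ρ (a⁻¹ • (x - y))) 2 volume := by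
      refine Continuous.memLp_of_hasCompactSupport ?_ ?_
      · exact ((om_cont N).inv₀ fun y => (om_pos y).ne').mul hk.cont
      · exact hk.2.mul_left
    have h1 := hθ _ hζ
    have h2 : ∀ v : Euc N → ℝ, (∫ y, om N y * v y * ((om N y)⁻¹ * ρ (a⁻¹ • (x - y)))) =
        ∫ y, ρ (a⁻¹ • (x - y)) * v y := by
      intro v
      congr 1; ext y
      have := (om_pos y).ne'
      field_simp
    simp only [h2] at h1
    exact h1.const_mul _
  have hcX : ∀ a : ℝ, 0 < a → ∀ᶠ n in atTop, ENNReal.ofReal c * ∫⁻ x, ENNReal.ofReal (om N x) * ‖φ n x - u x‖ₑ ≤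
      3 * (ENNReal.ofReal a * (B + 1)) := by
    intro a ha
    obtain ⟨R, hR⟩ := Mo_bdd hN hρ ha C
    have hMm : ∀ n, Measurable (Mo ρ a (φ n)) := fun n => Mo_meas hρ.cont a (hφ n).cont.measurable
    have hMψ : ∀ n, Measurable (Mo ρ a (ψ n)) := fun n => Mo_meas hρ.cont a (hψ n).cont.measurable
    have hMu : Measurable (Mo ρ a u) := Mo_meas hρ.cont a hu
    have hRn : ∀ n x, ‖Mo ρ a (φ n) x‖ₑ ≤ R := fun n x =>
      hR _ (hφ n).cont.measurable (hC _ (hφ n) (hM n)) x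
    have hRu : ∀ x, ‖Mo ρ a u x‖ₑ ≤ R := fun x =>
      le_of_tendsto ((hpt a ha φ hw x).enorm) (Eventually.of_forall fun n => hRn n x)
    have hmid : Tendsto (fun n => ∫⁻ x, ENNReal.ofReal (om N x) * ‖Mo ρ a (φ n) x - Mo ρ a u x‖ₑ) atTop
        (𝓝 (∫⁻ x : Euc N, 0)) := by
      refine tendsto_lintegral_of_dominated_convergence (fun x => ENNReal.ofReal (om N x) * (2 * R)) ?_ ?_ ?_ ?_
      · exact fun n => hom.mul ((hMm n).sub hMu).enorm
      · refine fun n => ae_of_all _ fun x => mul_le_mul_right ?_ _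
        refine (enorm_sub_le).trans ?_
        rw [two_mul]; exact add_le_add (hRn n x) (hRu x)
      · rw [lintegral_mul_const _ hom]
        exact ENNReal.mul_ne_top (om_lint N) (by finiteness)
      · refine ae_of_all _ fun x => ?_
        have h3 : Tendsto (fun n => ‖Mo ρ a (φ n) x - Mo ρ a u x‖ₑ) atTop (𝓝 0) := by
          have := ((hpt a ha φ hw x).sub_const (Mo ρ a u x)).enorm
          simpa using this
        have := ENNReal.Tendsto.const_mul (a := ENNReal.ofReal (om N x)) h3 (Or.inr ENNReal.ofReal_ne_top)
        simpa using this
    simp only [lintegral_zero] at hmid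
    have hpos : (0:ℝ≥0∞) < ENNReal.ofReal a * (B + 1) := by
      refine ENNReal.mul_pos (by simpa using ha) (by simp)
    have hfat : ∫⁻ x, ENNReal.ofReal (om N x) * ‖c * u x - Mo ρ a u x‖ₑ ≤ ENNReal.ofReal a * B := by
      have h4 : ∀ᵐ x, ENNReal.ofReal (om N x) * ‖c * u x - Mo ρ a u x‖ₑ =
          liminf (fun n => ENNReal.ofReal (om N x) * ‖c * ψ n x - Mo ρ a (ψ n) x‖ₑ) atTop := by
        filter_upwards [hae] with x hx
        have h5 := ((hx.const_mul c).sub (hpt a ha ψ hw' x)).enorm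
        exact (ENNReal.Tendsto.const_mul h5 (Or.inr ENNReal.ofReal_ne_top)).liminf_eq.symm
      rw [lintegral_congr_ae h4]
      refine (lintegral_liminf_le fun n => ?_).trans ?_
      · exact hom.mul ((((hψ n).cont.measurable.const_mul c).sub (hMψ n)).enorm)
      · refine (liminf_le_liminf (Eventually.of_forall fun n => hest a ha _ (hψ n) (hM' n))).trans ?_
        simp
    filter_upwards [ENNReal.tendsto_nhds_zero.1 hmid _ hpos] with n hn
    have hm0 : Measurable (fun x => ENNReal.ofReal (om N x) * ‖φ n x - u x‖ₑ) :=
      hom.mul (((hφ n).cont.measurable.sub hu).enorm)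
    have hm1 : Measurable (fun x => ENNReal.ofReal (om N x) * ‖c * φ n x - Mo ρ a (φ n) x‖ₑ) :=
      hom.mul ((((hφ n).cont.measurable.const_mul c).sub (hMm n)).enorm)
    have hm2 : Measurable (fun x => ENNReal.ofReal (om N x) * ‖Mo ρ a (φ n) x - Mo ρ a u x‖ₑ) :=
      hom.mul ((hMm n).sub hMu).enorm
    rw [← lintegral_const_mul _ hm0]
    calc _ ≤ ∫⁻ x, (ENNReal.ofReal (om N x) * ‖c * φ n x - Mo ρ a (φ n) x‖ₑ +
          (ENNReal.ofReal (om N x) * ‖Mo ρ a (φ n) x - Mo ρ a u x‖ₑ +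
            ENNReal.ofReal (om N x) * ‖c * u x - Mo ρ a u x‖ₑ)) := by
          refine lintegral_mono fun x => ?_
          simp only
          rw [← mul_add, ← mul_add, mul_left_comm, ← Real.enorm_of_nonneg hcpos.le, ← enorm_mul]
          refine mul_le_mul_right ?_ _
          have : c * (φ n x - u x) = (c * φ n x - Mo ρ a (φ n) x) + ((Mo ρ a (φ n) x - Mo ρ a u x) - (c * u x - Mo ρ a u x)) := by ring
          rw [this]
          exact (enorm_add_le _ _).trans (add_le_add le_rfl enorm_sub_le)
      _ ≤ ENNReal.ofReal a * (B + 1) + (ENNReal.ofReal a * (B + 1) + ENNReal.ofReal a * (B + 1)) := by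
          rw [lintegral_add_left hm1, lintegral_add_left hm2]
          refine add_le_add ?_ (add_le_add hn ?_)
          · refine (hest a ha _ (hφ n) (hM n)).trans ?_
            gcongr; exact le_self_add
          · refine hfat.trans ?_
            gcongr; exact le_self_add
      _ = _ := by ring
  rw [ENNReal.tendsto_nhds_zero]
  intro ε hε
  wlog hεt : ε ≠ ⊤ generalizing ε
  · rw [not_not] at hεt; simp [hεt]
  set D : ℝ := ((B + 1)).toReal
  have hD : ENNReal.ofReal D = B + 1 := ENNReal.ofReal_toReal (by simp [hBt])
  have hD0 : 0 < D := ENNReal.toReal_pos (by simp) (by simp [hBt])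
  have hε0 : 0 < ε.toReal := ENNReal.toReal_pos hε.ne' hεt
  filter_upwards [hcX (c * ε.toReal / (3 * D)) (by positivity)] with n hn
  have h6 : 3 * (ENNReal.ofReal (c * ε.toReal / (3 * D)) * (B + 1)) = ENNReal.ofReal c * ε := by
    rw [← hD, ← ENNReal.ofReal_mul (by positivity)]
    have : (3:ℝ≥0∞) = ENNReal.ofReal 3 := by simp
    rw [this, ← ENNReal.ofReal_mul (by positivity)]
    conv_rhs => rw [← ENNReal.ofReal_toReal hεt, ← ENNReal.ofReal_mul hcpos.le]
    congr 1; field_simp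
  rw [h6] at hn
  exact (ENNReal.mul_le_mul_iff_right (by simpa using hcpos) ENNReal.ofReal_ne_top).1 hn


lemma not_zero_aux {N : ℕ} (hN : 3 ≤ N) (M : ℝ≥0) {φ : ℕ → Euc N → ℝ} (hφ : ∀ n, Sm (φ n))
    (hM : ∀ n, DE (φ n) ≤ M) {δ : ℝ≥0} (hδ : 0 < δ)
    (hd : ∀ n, (δ:ℝ≥0∞) ≤ ∫⁻ x in closedBall 0 2, ‖φ n x‖ₑ ^ twoStar N 1)
    (h0 : Tendsto (fun n => ∫⁻ x, ENNReal.ofReal (om N x) * ‖φ n x‖ₑ) atTop (𝓝 0)) : False := by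
  obtain ⟨C, hC⟩ := AE_zero_bdd (k := 0) hN M
  simp only [AE_zero_simp] at hC
  have hNr : (3:ℝ) ≤ N := by exact_mod_cast hN
  set p0 := twoStar N 0 with hp0
  set m := twoStar N 1 with hm
  have hm2 : 2 < m := twoStar_gt hN (by norm_num)
  have hmp : m < p0 := by
    rw [hm, hp0]; unfold twoStar
    apply div_lt_div_of_pos_right _ (by linarith); linarith
  set θ := (p0 - m) / (p0 - 1) with hθ
  have hθ0 : 0 < θ := div_pos (by linarith) (by linarith)
  have hθ1 : θ < 1 := by rw [hθ, div_lt_one (by linarith)]; linarith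
  have hθm : θ + p0 * (1 - θ) = m := by
    rw [hθ]; have : p0 - 1 ≠ 0 := by linarith
    field_simp; ring
  set K : ℝ≥0∞ := ENNReal.ofReal ((3:ℝ) ^ ((N:ℝ)+1)) with hK
  have hle : ∀ n, (δ:ℝ≥0∞) ≤ (K * ∫⁻ x, ENNReal.ofReal (om N x) * ‖φ n x‖ₑ) ^ θ * (C:ℝ≥0∞) ^ (1 - θ) := by
    intro n
    refine (hd n).trans ?_
    have hme : Measurable (fun x => ‖φ n x‖ₑ) := (hφ n).cont.enorm.measurable
    have h1 := ENNReal.lintegral_mul_norm_pow_le (μ := volume.restrict (closedBall (0:Euc N) 2))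
      (f := fun x => ‖φ n x‖ₑ) (g := fun x => ‖φ n x‖ₑ ^ p0) hme.aemeasurable
      (hme.pow_const _).aemeasurable hθ0.le (by linarith : 0 ≤ 1 - θ) (by ring)
    calc _ = ∫⁻ x in closedBall 0 2, ‖φ n x‖ₑ ^ θ * (‖φ n x‖ₑ ^ p0) ^ (1 - θ) := by
          congr 1; ext x
          rw [← ENNReal.rpow_mul, ← ENNReal.rpow_add_of_nonneg _ _ hθ0.le (by
            apply mul_nonneg <;> linarith), hθm]
      _ ≤ _ := h1
      _ ≤ _ := by
          refine mul_le_mul' (ENNReal.rpow_le_rpow ?_ hθ0.le) (ENNReal.rpow_le_rpow ?_ (by linarith))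
          · have hom : Measurable (fun x => ENNReal.ofReal (om N x) * ‖φ n x‖ₑ) :=
              (om_cont N).measurable.ennreal_ofReal.mul hme
            rw [← lintegral_const_mul _ hom]
            refine (setLIntegral_mono' measurableSet_closedBall fun x hx => ?_).trans (setLIntegral_le_lintegral _ _)
            rw [← mul_assoc, hK, ← ENNReal.ofReal_mul (by positivity)]
            conv_lhs => rw [← one_mul ‖φ n x‖ₑ]
            refine mul_le_mul_left ?_ _
            rw [← ENNReal.ofReal_one]
            refine ENNReal.ofReal_le_ofReal ?_
            rw [mem_closedBall, dist_zero_right] at hx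
            unfold om
            rw [Real.rpow_neg (by positivity), ← div_eq_mul_inv, le_div_iff₀ (by positivity), one_mul]
            exact Real.rpow_le_rpow (by positivity) (by linarith) (by positivity)
          · exact (setLIntegral_le_lintegral _ _).trans (hC _ (hφ n) (hM n))
  have hlim : Tendsto (fun n => (K * ∫⁻ x, ENNReal.ofReal (om N x) * ‖φ n x‖ₑ) ^ θ * (C:ℝ≥0∞) ^ (1 - θ)) atTop (𝓝 0) := by
    have h2 := ENNReal.Tendsto.const_mul (a := K) h0 (Or.inr ENNReal.ofReal_ne_top)
    have h3 := (ENNReal.continuous_rpow_const (y := θ)).tendsto _ |>.comp h2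
    have h4 := ENNReal.Tendsto.mul_const (b := (C:ℝ≥0∞) ^ (1 - θ)) h3 (Or.inr (ENNReal.rpow_ne_top_of_nonneg (by linarith) ENNReal.coe_ne_top))
    simpa [ENNReal.zero_rpow_of_pos hθ0] using h4
  have := ge_of_tendsto' hlim hle
  simp at this
  exact hδ.ne' this

lemma lim_lemma {N k : ℕ} (hN : 3 ≤ N) (hk : k + 2 ≤ N) {σ : ℝ} (hσ : 0 < σ) (hσ2 : σ < 2) :
    ∃ (φ ψ : ℕ → Euc N → ℝ) (u : Euc N → ℝ) (g : Euc N → Euc N),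
      (∀ n, Sm (φ n)) ∧ (∀ n x, 0 ≤ φ n x) ∧ (∀ n, AE N k σ (φ n) univ = 1) ∧
      Tendsto (fun n => DE (φ n)) atTop (𝓝 (SS N k σ)) ∧
      Measurable u ∧ (∀ x, 0 ≤ u x) ∧ MemLp g 2 volume ∧ StronglyMeasurable g ∧
      (∀ᵐ x, Tendsto (fun j => φ j x) atTop (𝓝 (u x))) ∧ ¬ (u =ᵐ[volume] 0) ∧
      (∀ η : Euc N → Euc N, MemLp η 2 volume →
        Tendsto (fun n => ∫ x, inner ℝ (gradient (φ n) x) (η x)) atTop (𝓝 (∫ x, inner ℝ (g x) (η x)))) ∧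
      (∀ j, Sm (ψ j)) ∧ (∀ᵐ x, Tendsto (fun j => ψ j x) atTop (𝓝 (u x))) ∧
      Tendsto (fun n => eLpNorm (fun x => u x - ψ n x)
        (ENNReal.ofReal (2 * (N : ℝ) / ((N : ℝ) - 2))) volume) atTop (𝓝 0) ∧
      Tendsto (fun j => eLpNorm (fun x => g x - gradient (ψ j) x) 2 volume) atTop (𝓝 0) := by
  obtain ⟨φ0, δ, hδ, hφ0, hpos0, hA0, hD0, hd0⟩ := min_seq hN hk hσ hσ2
  have hSt := SS_ne_top hN hk hσ.le hσ2
  obtain ⟨n0, hn0⟩ := eventually_atTop.1 (hD0.eventually (gt_mem_nhds (ENNReal.lt_add_right hSt one_ne_zero)))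
  set M1 : ℝ≥0 := (SS N k σ + 1).toNNReal
  have hM1 : (M1:ℝ≥0∞) = SS N k σ + 1 := ENNReal.coe_toNNReal (by simp [hSt])
  obtain ⟨s, u0, g, ψ0, hs, hu0, hg, hgs, -, hwg, hwu, hψ0, hψae, hψg⟩ := weak_lim hN M1
    (fun n => φ0 (n + n0)) (fun n => hφ0 _) (fun n => by rw [hM1]; exact (hn0 _ (by omega)).le)
  obtain ⟨j0, hj0⟩ := eventually_atTop.1 (ENNReal.tendsto_nhds_zero.1 hψg 1 one_pos)
  set M2 : ℝ≥0 := ((eLpNorm g 2 volume + 1) ^ 2).toNNReal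
  have hM2 : (M2:ℝ≥0∞) = (eLpNorm g 2 volume + 1) ^ 2 := ENNReal.coe_toNNReal (by
    have := hg.2.ne
    finiteness)
  have hψM : ∀ j, DE (ψ0 (j + j0)) ≤ M2 := by
    intro j
    rw [hM2]
    have h1 : eLpNorm (gradient (ψ0 (j + j0))) 2 volume ≤ eLpNorm g 2 volume + 1 := by
      have h2 : gradient (ψ0 (j + j0)) = g - fun x => g x - gradient (ψ0 (j + j0)) x := by
        ext1 x; simp
      rw [h2]
      refine (eLpNorm_sub_le hg.1 (hg.1.sub (hψ0 _).contG.aestronglyMeasurable) (by norm_num)).trans ?_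
      exact add_le_add le_rfl (hj0 _ (by omega))
    rw [DE_grad]
    rw [eLpNorm_two_eq] at h1
    have h3 := ENNReal.rpow_le_rpow h1 (by norm_num : (0:ℝ) ≤ 2)
    rw [← ENNReal.rpow_mul] at h3
    norm_num at h3
    exact_mod_cast h3
  have hsh : Tendsto (fun j : ℕ => j + j0) atTop atTop := tendsto_add_atTop_nat j0
  have hrel := rellich hN (max M1 M2) (φ := fun n => φ0 (s n + n0)) (ψ := fun j => ψ0 (j + j0))
    (fun n => hφ0 _) (fun n => hψ0 _)
    (fun n => by
      refine le_trans ?_ (ENNReal.coe_le_coe.2 (le_max_left M1 M2))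
      rw [hM1]; exact (hn0 _ (by omega)).le)
    (fun n => (hψM n).trans (ENNReal.coe_le_coe.2 (le_max_right M1 M2))) hu0
    (by filter_upwards [hψae] with x hx; exact hx.comp hsh)
    (fun ζ hζ => (hwu ζ hζ).1) (fun ζ hζ => (hwu ζ hζ).2.comp hsh)
  have hmeas : TendstoInMeasure volume (fun n x => om N x * φ0 (s n + n0) x) atTop (fun x => om N x * u0 x) := by
    refine tendstoInMeasure_of_tendsto_eLpNorm (p := 1) (by norm_num)
      (fun n => ((om_cont N).mul (hφ0 _).cont).aestronglyMeasurable)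
      (((om_cont N).measurable.mul hu0).aestronglyMeasurable) ?_
    refine hrel.congr fun n => ?_
    rw [eLpNorm_one_eq_lintegral_enorm]
    congr 1; ext x
    rw [Pi.sub_apply, ← mul_sub, enorm_mul, Real.enorm_of_nonneg (om_pos x).le]
  obtain ⟨r, hr, hrae⟩ := hmeas.exists_seq_tendsto_ae
  have hφae : ∀ᵐ x, Tendsto (fun j => φ0 (s (r j) + n0) x) atTop (𝓝 (u0 x)) := by
    filter_upwards [hrae] with x hx
    have h8 := hx.const_mul ((om N x)⁻¹)
    have h9 : ∀ t, (om N x)⁻¹ * (om N x * t) = t := fun t => by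
      rw [← mul_assoc, inv_mul_cancel₀ (om_pos x).ne', one_mul]
    simpa only [h9] using h8
  have hu00 : ∀ᵐ x, 0 ≤ u0 x := by
    filter_upwards [hφae] with x hx
    exact ge_of_tendsto' hx fun n => hpos0 _ _
  have huu : ∀ᵐ x, |u0 x| = u0 x := by filter_upwards [hu00] with x hx; exact abs_of_nonneg hx
  have hidx : Tendsto (fun j => s (r j) + n0) atTop atTop :=
    tendsto_atTop_mono (fun j => Nat.le_add_right (s (r j)) n0) (hs.tendsto_atTop.comp hr.tendsto_atTop)
  refine ⟨fun n => φ0 (s (r n) + n0), ψ0, fun x => |u0 x|, g, fun n => hφ0 _, fun n => hpos0 _,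
    fun n => hA0 _, hD0.comp hidx, hu0.abs, fun x => abs_nonneg _, hg, hgs, ?_, ?_, ?_, hψ0, ?_, ?_, hψg⟩
  · filter_upwards [hφae, huu] with x h1 h2; rw [h2]; exact h1
  · intro hz
    refine not_zero_aux hN M1 (φ := fun n => φ0 (s n + n0)) (fun n => hφ0 _) (fun n => by
      rw [hM1]; exact (hn0 _ (by omega)).le) hδ (fun n => hd0 _) ?_
    refine hrel.congr fun n => lintegral_congr_ae ?_
    filter_upwards [hz, huu] with x h1 h2
    rw [h2] at h1; rw [h1]; simp
  · intro η hη
    exact (hwg η hη).comp hr.tendsto_atTop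
  · filter_upwards [hψae, huu] with x h1 h2; rw [h2]; exact h1
  · refine conv_star hN hψ0 hg.1 ?_ hψg
    filter_upwards [hψae, huu] with x h1 h2; rw [h2]; exact h1


lemma eLpNorm_tendsto {N : ℕ} {F : Type*} [NormedAddCommGroup F] {g : Euc N → F} {f : ℕ → Euc N → F}
    (hg : AEStronglyMeasurable g volume) (hf : ∀ j, AEStronglyMeasurable (f j) volume)
    (h : Tendsto (fun j => eLpNorm (fun x => g x - f j x) 2 volume) atTop (𝓝 0)) :
    Tendsto (fun j => eLpNorm (f j) 2 volume) atTop (𝓝 (eLpNorm g 2 volume)) := by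
  have h1 : ∀ j, eLpNorm (f j) 2 volume ≤ eLpNorm g 2 volume + eLpNorm (fun x => g x - f j x) 2 volume := by
    intro j
    have : f j = g - fun x => g x - f j x := by ext1 x; simp
    conv_lhs => rw [this]
    exact eLpNorm_sub_le hg (hg.sub (hf j)) (by norm_num)
  have h2 : ∀ j, eLpNorm g 2 volume - eLpNorm (fun x => g x - f j x) 2 volume ≤ eLpNorm (f j) 2 volume := by
    intro j
    rw [tsub_le_iff_right]
    have : g = f j + fun x => g x - f j x := by ext1 x; simp
    conv_lhs => rw [this]
    exact eLpNorm_add_le (hf j) (hg.sub (hf j)) (by norm_num)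
  refine tendsto_of_tendsto_of_tendsto_of_le_of_le ?_ ?_ h2 h1
  · have := ENNReal.Tendsto.sub (tendsto_const_nhds (x := eLpNorm g 2 volume) (f := atTop)) h (Or.inr (by simp))
    simpa using this
  · simpa using (tendsto_const_nhds (x := eLpNorm g 2 volume) (f := atTop)).add h

lemma DE_tendsto {N : ℕ} {g : Euc N → Euc N} (hg : AEStronglyMeasurable g volume) {ψ : ℕ → Euc N → ℝ}
    (hψ : ∀ j, Sm (ψ j))
    (h : Tendsto (fun j => eLpNorm (fun x => g x - gradient (ψ j) x) 2 volume) atTop (𝓝 0)) :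
    Tendsto (fun j => DE (ψ j)) atTop (𝓝 (∫⁻ x, ‖g x‖ₑ ^ 2)) := by
  have h1 := eLpNorm_tendsto hg (fun j => (hψ j).contG.aestronglyMeasurable) h
  have h2 := (ENNReal.continuous_rpow_const (y := 2)).tendsto _ |>.comp h1
  have h3 : ∀ f : Euc N → Euc N, (eLpNorm f 2 volume) ^ (2:ℝ) = ∫⁻ x, ‖f x‖ₑ ^ 2 := by
    intro f
    rw [eLpNorm_two_eq, ← ENNReal.rpow_mul]; norm_num
  rw [h3] at h2
  refine h2.congr fun j => ?_
  simp only [Function.comp]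
  rw [h3, DE_grad]

lemma SS_le_lim {N k : ℕ} (hN : 3 ≤ N) (hk : k + 2 ≤ N) {σ : ℝ} (hσ : 0 ≤ σ) (hσ2 : σ < 2)
    {ψ : ℕ → Euc N → ℝ} (hψ : ∀ j, Sm (ψ j)) {u : Euc N → ℝ} {D : ℝ≥0∞}
    (hae : ∀ᵐ x, Tendsto (fun j => ‖ψ j x‖ₑ) atTop (𝓝 ‖u x‖ₑ))
    (hD : Tendsto (fun j => DE (ψ j)) atTop (𝓝 D)) :
    AE N k σ u univ ≤ (D / SS N k σ) ^ (twoStar N σ / 2) ∧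
    SS N k σ * AE N k σ u univ ^ (2 / twoStar N σ) ≤ D := by
  have hp := twoStar_pos hN hσ2
  have hS0 := SS_ne_zero hN hk hσ hσ2
  have hSt := SS_ne_top hN hk hσ hσ2
  have h1 : ∀ j, AE N k σ (ψ j) univ ≤ (DE (ψ j) / SS N k σ) ^ (twoStar N σ / 2) := by
    intro j
    have h2 : AE N k σ (ψ j) univ ^ (2 / twoStar N σ) ≤ DE (ψ j) / SS N k σ := by
      rw [ENNReal.le_div_iff_mul_le (Or.inl hS0) (Or.inl hSt), mul_comm]
      exact SS_le hN hk hσ hσ2 (hψ j)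
    have h3 := ENNReal.rpow_le_rpow h2 (by positivity : 0 ≤ twoStar N σ / 2)
    rwa [← ENNReal.rpow_mul, show 2 / twoStar N σ * (twoStar N σ / 2) = 1 by field_simp, ENNReal.rpow_one] at h3
  have h4 : AE N k σ u univ ≤ (D / SS N k σ) ^ (twoStar N σ / 2) := by
    have h5 : Tendsto (fun j => (DE (ψ j) / SS N k σ) ^ (twoStar N σ / 2)) atTop (𝓝 ((D / SS N k σ) ^ (twoStar N σ / 2))) :=
      (ENNReal.continuous_rpow_const (y := twoStar N σ / 2)).tendsto _ |>.comp
        (ENNReal.Tendsto.div_const hD (Or.inr hS0))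
    rw [← h5.liminf_eq]
    refine le_trans ?_ (liminf_le_liminf (Eventually.of_forall h1))
    unfold AE
    rw [Measure.restrict_univ]
    have h6 : ∀ᵐ x, wt N k σ x * ‖u x‖ₑ ^ twoStar N σ = liminf (fun j => wt N k σ x * ‖ψ j x‖ₑ ^ twoStar N σ) atTop := by
      filter_upwards [hae] with x hx
      have h7 := (ENNReal.continuous_rpow_const (y := twoStar N σ)).tendsto _ |>.comp hx
      exact (ENNReal.Tendsto.const_mul h7 (Or.inr (wt_ne_top x))).liminf_eq.symm
    rw [lintegral_congr_ae h6]
    exact lintegral_liminf_le fun n => (measurable_wt N k σ).mul ((hψ n).cont.enorm.measurable.pow_const _)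
  refine ⟨h4, ?_⟩
  have h8 := ENNReal.rpow_le_rpow h4 (by positivity : 0 ≤ 2 / twoStar N σ)
  rw [← ENNReal.rpow_mul, show twoStar N σ / 2 * (2 / twoStar N σ) = 1 by field_simp, ENNReal.rpow_one] at h8
  rw [mul_comm]
  exact (ENNReal.le_div_iff_mul_le (Or.inl hS0) (Or.inl hSt)).1 h8

lemma wt_ball {N k : ℕ} (hN : 3 ≤ N) (hk : k + 2 ≤ N) {σ : ℝ} (hσ : 0 ≤ σ) (hσ2 : σ < 2) (R : ℝ) :
    ∫⁻ x in closedBall 0 R, wt N k σ x ≠ ⊤ := by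
  have hR : 0 < |R| + 1 := by positivity
  let χ : ContDiffBump (0 : Euc N) := ⟨|R| + 1, |R| + 2, hR, by linarith⟩
  have hχ : Sm (χ : Euc N → ℝ) := ⟨χ.contDiff, χ.hasCompactSupport⟩
  have h := AE_ne_top hN hk hσ hσ2 hχ
  refine ne_top_of_le_ne_top h ?_
  unfold AE
  rw [Measure.restrict_univ]
  refine (setLIntegral_mono' measurableSet_closedBall fun x hx => ?_).trans (setLIntegral_le_lintegral _ _)
  have : χ x = 1 := χ.one_of_mem_closedBall (by
    rw [mem_closedBall, dist_zero_right] at hx ⊢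
    show ‖x‖ ≤ |R| + 1
    linarith [le_abs_self R])
  rw [this]; simp

/-- real weight -/
def wr (N k : ℕ) (σ : ℝ) (x : Euc N) : ℝ := zNorm N k x ^ (-σ)
lemma wr_nonneg {N k : ℕ} {σ : ℝ} (x : Euc N) : 0 ≤ wr N k σ x := Real.rpow_nonneg (zNorm_nonneg x) _
lemma wr_meas (N k : ℕ) (σ : ℝ) : Measurable (wr N k σ) := (measurable_zNorm N k).pow_const _
lemma wr_enorm {N k : ℕ} {σ : ℝ} (x : Euc N) : ‖wr N k σ x‖ₑ = wt N k σ x := by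
  rw [Real.enorm_of_nonneg (wr_nonneg x)]; rfl

lemma rpow_enorm {p : ℝ} (hp : 0 ≤ p) (t : ℝ) : ‖|t| ^ p‖ₑ = ‖t‖ₑ ^ p := by
  rw [Real.enorm_of_nonneg (by positivity), ← ENNReal.ofReal_rpow_of_nonneg (abs_nonneg _) hp, ← Real.norm_eq_abs, ofReal_norm]

lemma AE_enorm {N k : ℕ} (hN : 3 ≤ N) {σ : ℝ} (hσ2 : σ < 2) (u : Euc N → ℝ) :
    AE N k σ u univ = ∫⁻ x, ‖wr N k σ x * |u x| ^ twoStar N σ‖ₑ := by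
  unfold AE
  rw [Measure.restrict_univ]
  congr 1; ext x
  rw [enorm_mul, wr_enorm, rpow_enorm (twoStar_pos hN hσ2).le]

lemma AE_int {N k : ℕ} (hN : 3 ≤ N) {σ : ℝ} (hσ2 : σ < 2) {u : Euc N → ℝ} (hu : Measurable u)
    (h : AE N k σ u univ ≠ ⊤) : Integrable (fun x => wr N k σ x * |u x| ^ twoStar N σ) volume := by
  refine ⟨((wr_meas N k σ).mul (hu.abs.pow_const _)).aestronglyMeasurable, ?_⟩
  unfold HasFiniteIntegral
  rw [← AE_enorm hN hσ2]
  exact h.lt_top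

lemma AE_real {N k : ℕ} (hN : 3 ≤ N) {σ : ℝ} (hσ2 : σ < 2) {u : Euc N → ℝ} (hu : Measurable u) :
    ∫ x, wr N k σ x * |u x| ^ twoStar N σ = (AE N k σ u univ).toReal := by
  have hm : AEStronglyMeasurable (fun x => wr N k σ x * |u x| ^ twoStar N σ) volume :=
    ((wr_meas N k σ).mul (hu.abs.pow_const _)).aestronglyMeasurable
  rw [AE_enorm hN hσ2, ← integral_norm_eq_lintegral_enorm hm]
  congr 1; ext x
  rw [Real.norm_of_nonneg]
  exact mul_nonneg (wr_nonneg x) (by positivity)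

lemma wr_eta_int {N k : ℕ} (hN : 3 ≤ N) (hk : k + 2 ≤ N) {σ : ℝ} (hσ : 0 ≤ σ) (hσ2 : σ < 2)
    {η : Euc N → ℝ} (hη : Sm η) : Integrable (fun x => wr N k σ x * η x) volume := by
  obtain ⟨K, hK⟩ := hη.cont.bounded_above_of_compact_support hη.2
  obtain ⟨R, hR⟩ := hη.2.isCompact.isBounded.subset_closedBall 0
  refine ⟨((wr_meas N k σ).mul hη.cont.measurable).aestronglyMeasurable, ?_⟩
  unfold HasFiniteIntegral
  have h1 : ∀ x, ‖wr N k σ x * η x‖ₑ ≤ (closedBall 0 R).indicator (fun x => wt N k σ x * ENNReal.ofReal K) x := by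
    intro x
    by_cases hx : x ∈ closedBall 0 R
    · rw [indicator_of_mem hx, enorm_mul, wr_enorm, ← ofReal_norm (η x)]
      gcongr; exact hK x
    · have : η x = 0 := image_eq_zero_of_notMem_tsupport fun h => hx (hR h)
      rw [this]; simp
  refine (lintegral_mono h1).trans_lt ?_
  rw [lintegral_indicator measurableSet_closedBall, lintegral_mul_const _ (measurable_wt N k σ)]
  exact ENNReal.mul_lt_top (wt_ball hN hk hσ hσ2 R).lt_top ENNReal.ofReal_lt_top

lemma rpow_le_one_add {p : ℝ} (hp : 1 ≤ p) {t : ℝ} (ht : 0 ≤ t) : t ^ (p - 1) ≤ 1 + t ^ p := by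
  rcases le_total t 1 with h | h
  · have := Real.rpow_le_one ht h (by linarith : 0 ≤ p - 1)
    have : 0 ≤ t ^ p := by positivity
    linarith
  · have := Real.rpow_le_rpow_of_exponent_le h (by linarith : p - 1 ≤ p)
    linarith

lemma nl_int {N k : ℕ} (hN : 3 ≤ N) (hk : k + 2 ≤ N) {σ : ℝ} (hσ : 0 ≤ σ) (hσ2 : σ < 2)
    {u : Euc N → ℝ} (hu : Measurable u) (hu0 : ∀ x, 0 ≤ u x) (h : AE N k σ u univ ≠ ⊤) {η : Euc N → ℝ} (hη : Sm η) :
    Integrable (fun x => wr N k σ x * u x ^ (twoStar N σ - 1) * η x) volume := by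
  have hp := twoStar_gt hN hσ2
  obtain ⟨K, hK⟩ := hη.cont.bounded_above_of_compact_support hη.2
  have h1 := (wr_eta_int (k := k) hN hk hσ hσ2 hη).norm.add ((AE_int hN hσ2 hu h).const_mul K)
  refine h1.mono' (((wr_meas N k σ).mul (hu.pow_const _)).mul hη.cont.measurable).aestronglyMeasurable
    (ae_of_all _ fun x => ?_)
  have hw := wr_nonneg (N := N) (k := k) (σ := σ) x
  have h2 := rpow_le_one_add (p := twoStar N σ) (by linarith) (hu0 x)
  have h3 := hK x
  have h4 : 0 ≤ u x ^ twoStar N σ := Real.rpow_nonneg (hu0 x) _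
  simp only [Pi.add_apply, norm_mul, Real.norm_of_nonneg hw, abs_of_nonneg (hu0 x)]
  rw [Real.norm_of_nonneg (Real.rpow_nonneg (hu0 x) _)]
  calc _ ≤ wr N k σ x * (1 + u x ^ twoStar N σ) * ‖η x‖ := by gcongr
    _ = wr N k σ x * ‖η x‖ + (wr N k σ x * u x ^ twoStar N σ) * ‖η x‖ := by ring
    _ ≤ wr N k σ x * ‖η x‖ + (wr N k σ x * u x ^ twoStar N σ) * K := by gcongr
    _ = _ := by ring


lemma conv_pt {p a : ℝ} (hp : 1 < p) (ha : 0 ≤ a) (b : ℝ) : a ^ p + p * a ^ (p - 1) * b ≤ |a + b| ^ p := by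
  rcases ha.eq_or_lt with rfl | ha
  · rw [Real.zero_rpow (by linarith), Real.zero_rpow (by linarith)]
    simp; positivity
  · have hap : a ^ p = a ^ (p - 1) * a := by
      rw [← Real.rpow_add_one ha.ne']; ring_nf
    have hq : 0 < a ^ (p - 1) := by positivity
    rcases le_total (-a) b with h | h
    · have h1 := one_add_mul_self_le_rpow_one_add (s := b / a) (p := p) (by rw [le_div_iff₀ ha]; linarith) hp.le
      have h2 : a + b = a * (1 + b / a) := by field_simp
      rw [abs_of_nonneg (by linarith), h2, Real.mul_rpow ha.le (by
        have : -1 ≤ b / a := by rw [le_div_iff₀ ha]; linarith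
        linarith)]
      calc _ = a ^ p * (1 + p * (b / a)) := by rw [hap]; field_simp
        _ ≤ _ := by gcongr
    · have : a ^ p + p * a ^ (p - 1) * b ≤ 0 := by
        rw [hap]
        have : p * a ^ (p-1) * b ≤ p * a ^ (p-1) * (-a) := by gcongr
        nlinarith [mul_pos hq ha]
      exact this.trans (by positivity)

lemma trunc_pt {p a K : ℝ} (hp : 1 < p) (ha : 0 ≤ a) (hK : 0 < K) :
    |a ^ (p - 1) - (min a K) ^ (p - 1)| ≤ a ^ p / K := by
  rcases le_total a K with h | h
  · rw [min_eq_left h, sub_self, abs_zero]; positivity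
  · rw [min_eq_right h]
    have ha' : 0 < a := hK.trans_le h
    have h1 : K ^ (p-1) ≤ a ^ (p-1) := Real.rpow_le_rpow hK.le h (by linarith)
    have h2 : 0 ≤ K ^ (p-1) := by positivity
    rw [abs_of_nonneg (by linarith), le_div_iff₀ hK]
    have hap : a ^ p = a ^ (p - 1) * a := by
      rw [← Real.rpow_add_one ha'.ne']; ring_nf
    rw [hap]
    have : 0 ≤ a ^ (p-1) := by positivity
    nlinarith

lemma nl_trunc {N k : ℕ} (hN : 3 ≤ N) (hk : k + 2 ≤ N) {σ : ℝ} (hσ : 0 ≤ σ) (hσ2 : σ < 2)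
    {u : Euc N → ℝ} (hu : Measurable u) (hu0 : ∀ x, 0 ≤ u x) (h : AE N k σ u univ ≤ 1) {η : Euc N → ℝ} (hη : Sm η)
    {B : ℝ} (hB : ∀ x, ‖η x‖ ≤ B) {K : ℝ} (hK : 0 < K) :
    |(∫ x, wr N k σ x * u x ^ (twoStar N σ - 1) * η x) - ∫ x, wr N k σ x * (min (u x) K) ^ (twoStar N σ - 1) * η x|
      ≤ B / K := by
  have hp := twoStar_gt hN hσ2
  have ht : AE N k σ u univ ≠ ⊤ := ne_top_of_le_ne_top (by simp) h
  have hum : Measurable (fun x => min (u x) K) := hu.min measurable_const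
  have htm : AE N k σ (fun x => min (u x) K) univ ≠ ⊤ := by
    refine ne_top_of_le_ne_top ht (lintegral_mono fun x => ?_)
    refine mul_le_mul_right (ENNReal.rpow_le_rpow ?_ (by linarith)) _
    rw [Real.enorm_of_nonneg (hu0 x), Real.enorm_of_nonneg (le_min (hu0 x) hK.le)]
    exact ENNReal.ofReal_le_ofReal (min_le_left _ _)
  rw [← integral_sub (nl_int hN hk hσ hσ2 hu hu0 ht hη)
    (nl_int hN hk hσ hσ2 hum (fun x => le_min (hu0 x) hK.le) htm hη), ← Real.norm_eq_abs]
  have hB0 : 0 ≤ B := (norm_nonneg _).trans (hB 0)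
  have hI := (AE_int hN hσ2 hu ht).const_mul (B / K)
  refine (norm_integral_le_of_norm_le hI (ae_of_all _ fun x => ?_)).trans ?_
  · have h2 := trunc_pt (p := twoStar N σ) (by linarith) (hu0 x) hK
    have hw := wr_nonneg (N := N) (k := k) (σ := σ) x
    rw [← sub_mul, ← mul_sub, norm_mul, norm_mul, Real.norm_of_nonneg hw, abs_of_nonneg (hu0 x), Real.norm_eq_abs (_ - _)]
    calc _ ≤ wr N k σ x * (u x ^ twoStar N σ / K) * B := by
          gcongr
          · exact mul_nonneg hw (div_nonneg (Real.rpow_nonneg (hu0 x) _) hK.le)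
          · exact hB x
      _ = _ := by ring
  · rw [integral_const_mul, AE_real hN hσ2 hu]
    have : (AE N k σ u univ).toReal ≤ 1 := by
      have := ENNReal.toReal_mono (by simp) h
      simpa using this
    calc _ ≤ B / K * 1 := by gcongr
      _ = _ := mul_one _

lemma nl_conv {N k : ℕ} (hN : 3 ≤ N) (hk : k + 2 ≤ N) {σ : ℝ} (hσ : 0 ≤ σ) (hσ2 : σ < 2)
    {φ : ℕ → Euc N → ℝ} (hφ : ∀ n, Measurable (φ n)) (hφ0 : ∀ n x, 0 ≤ φ n x) (hA : ∀ n, AE N k σ (φ n) univ ≤ 1)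
    {u : Euc N → ℝ} (hu : Measurable u) (hu0 : ∀ x, 0 ≤ u x) (h : AE N k σ u univ ≤ 1)
    (hae : ∀ᵐ x, Tendsto (fun j => φ j x) atTop (𝓝 (u x))) {η : Euc N → ℝ} (hη : Sm η) :
    Tendsto (fun n => ∫ x, wr N k σ x * φ n x ^ (twoStar N σ - 1) * η x) atTop
      (𝓝 (∫ x, wr N k σ x * u x ^ (twoStar N σ - 1) * η x)) := by
  have hp := twoStar_gt hN hσ2
  obtain ⟨B0, hB0⟩ := hη.cont.bounded_above_of_compact_support hη.2
  set B := |B0| + 1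
  have hB : ∀ x, ‖η x‖ ≤ B := fun x => (hB0 x).trans (by linarith [le_abs_self B0])
  have hBp : 0 < B := by positivity
  rw [Metric.tendsto_atTop]
  intro ε hε
  set K := 4 * B / ε with hKd
  have hK : 0 < K := by positivity
  have hBK : B / K = ε / 4 := by rw [hKd]; field_simp
  have hdom : Tendsto (fun n => ∫ x, wr N k σ x * (min (φ n x) K) ^ (twoStar N σ - 1) * η x) atTop
      (𝓝 (∫ x, wr N k σ x * (min (u x) K) ^ (twoStar N σ - 1) * η x)) := by
    refine tendsto_integral_of_dominated_convergence (fun x => K ^ (twoStar N σ - 1) * ‖wr N k σ x * η x‖) ?_ ?_ ?_ ?_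
    · exact fun n => (((wr_meas N k σ).mul (((hφ n).min measurable_const).pow_const _)).mul hη.cont.measurable).aestronglyMeasurable
    · exact (wr_eta_int hN hk hσ hσ2 hη).norm.const_mul _
    · refine fun n => ae_of_all _ fun x => ?_
      have hm0 : 0 ≤ min (φ n x) K := le_min (hφ0 n x) hK.le
      rw [mul_right_comm, norm_mul, mul_comm, Real.norm_of_nonneg (Real.rpow_nonneg hm0 _)]
      gcongr
      · linarith
      · exact min_le_right _ _
    · filter_upwards [hae] with x hx
      have h1 : Tendsto (fun n => min (φ n x) K) atTop (𝓝 (min (u x) K)) := hx.min tendsto_const_nhds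
      exact ((h1.rpow_const (Or.inr (by linarith))).const_mul _).mul_const _
  obtain ⟨n0, hn0⟩ := Metric.tendsto_atTop.1 hdom (ε / 4) (by positivity)
  refine ⟨n0, fun n hn => ?_⟩
  have h1 := nl_trunc hN hk hσ hσ2 (hφ n) (hφ0 n) (hA n) hη hB hK
  have h2 := nl_trunc hN hk hσ hσ2 hu hu0 h hη hB hK
  have h3 := hn0 n hn
  rw [hBK] at h1 h2
  rw [Real.dist_eq] at h3 ⊢
  rw [abs_le] at h1 h2
  rw [abs_lt] at h3 ⊢
  constructor <;> linarith [h1.1, h1.2, h2.1, h2.2, h3.1, h3.2]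

lemma DE_toReal {N : ℕ} {φ : Euc N → ℝ} (h : Sm φ) : (DE φ).toReal = ∫ x, ‖gradient φ x‖ ^ 2 := by
  have hm : AEStronglyMeasurable (fun x => ‖gradient φ x‖ ^ 2) volume :=
    (h.contG.norm.pow 2).aestronglyMeasurable
  have := integral_norm_eq_lintegral_enorm hm
  rw [DE_grad]
  simp only [enorm_pow, enorm_norm] at this
  rw [← this]
  congr 1; ext x; simp

lemma DE_expand {N : ℕ} {φ η : Euc N → ℝ} (h : Sm φ) (hη : Sm η) (t : ℝ) :
    (DE (fun x => φ x + t * η x)).toReal =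
      (DE φ).toReal + 2 * t * (∫ x, inner ℝ (gradient φ x) (gradient η x)) + t ^ 2 * (DE η).toReal := by
  rw [DE_toReal (h.add (hη.smul t)), DE_toReal h, DE_toReal hη]
  have i1 : Integrable (fun x => ‖gradient φ x‖ ^ 2) volume :=
    (h.contG.norm.pow 2).integrable_of_hasCompactSupport (HasCompactSupport.intro h.supG fun x hx => by
      have := image_eq_zero_of_notMem_tsupport hx
      simp [this])
  have i3 : Integrable (fun x => ‖gradient η x‖ ^ 2) volume :=
    (hη.contG.norm.pow 2).integrable_of_hasCompactSupport (HasCompactSupport.intro hη.supG fun x hx => by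
      have := image_eq_zero_of_notMem_tsupport hx
      simp [this])
  have i2 : Integrable (fun x => inner ℝ (gradient φ x) (gradient η x)) volume := by
    refine (h.contG.inner hη.contG).integrable_of_hasCompactSupport ?_
    refine HasCompactSupport.intro h.supG fun x hx => ?_
    rw [image_eq_zero_of_notMem_tsupport hx, inner_zero_left]
  rw [← integral_const_mul, ← integral_const_mul, ← integral_add i1 (i2.const_mul _)]
  have i4 : Integrable (fun x => ‖gradient φ x‖ ^ 2 + 2 * t * inner ℝ (gradient φ x) (gradient η x)) volume :=
    i1.add (i2.const_mul _)
  rw [← integral_add i4 (i3.const_mul _)]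
  congr 1; ext x
  rw [grad_add h (hη.smul t), grad_smul hη, norm_add_sq_real, norm_smul, inner_smul_right, mul_pow]
  simp; ring


lemma AE_lower {N k : ℕ} (hN : 3 ≤ N) (hk : k + 2 ≤ N) {σ : ℝ} (hσ : 0 ≤ σ) (hσ2 : σ < 2)
    {φ η : Euc N → ℝ} (hφ : Sm φ) (hφ0 : ∀ x, 0 ≤ φ x) (hη : Sm η) (t : ℝ) :
    (AE N k σ φ univ).toReal + twoStar N σ * t * (∫ x, wr N k σ x * φ x ^ (twoStar N σ - 1) * η x) ≤
      (AE N k σ (fun x => φ x + t * η x) univ).toReal := by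
  have hp := twoStar_gt hN hσ2
  have hs : Sm (fun x => φ x + t * η x) := hφ.add (hη.smul t)
  have hA := AE_ne_top hN hk hσ hσ2 hφ
  have hA2 := AE_ne_top hN hk hσ hσ2 hs
  rw [← AE_real hN hσ2 hφ.cont.measurable, ← AE_real hN hσ2 hs.cont.measurable, ← integral_const_mul]
  have i1 := AE_int hN hσ2 hφ.cont.measurable hA
  have i2 := (nl_int hN hk hσ hσ2 hφ.cont.measurable hφ0 hA hη).const_mul (twoStar N σ * t)
  rw [← integral_add i1 i2]
  refine integral_mono (i1.add i2) (AE_int hN hσ2 hs.cont.measurable hA2) fun x => ?_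
  have h1 := conv_pt (p := twoStar N σ) (by linarith) (hφ0 x) (t * η x)
  have h2 := mul_le_mul_of_nonneg_left h1 (wr_nonneg (N := N) (k := k) (σ := σ) x)
  simp only [Pi.add_apply, abs_of_nonneg (hφ0 x)]
  refine le_trans (le_of_eq ?_) h2
  ring

lemma EL {N k : ℕ} (hN : 3 ≤ N) (hk : k + 2 ≤ N) {σ : ℝ} (hσ : 0 ≤ σ) (hσ2 : σ < 2)
    {φ : ℕ → Euc N → ℝ} {u : Euc N → ℝ} {g : Euc N → Euc N}
    (hφ : ∀ n, Sm (φ n)) (hφ0 : ∀ n x, 0 ≤ φ n x) (hA : ∀ n, AE N k σ (φ n) univ = 1)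
    (hD : Tendsto (fun n => DE (φ n)) atTop (𝓝 (SS N k σ)))
    (hu : Measurable u) (hu0 : ∀ x, 0 ≤ u x) (hAu : AE N k σ u univ ≤ 1)
    (hae : ∀ᵐ x, Tendsto (fun j => φ j x) atTop (𝓝 (u x)))
    (hw : ∀ η : Euc N → Euc N, MemLp η 2 volume →
        Tendsto (fun n => ∫ x, inner ℝ (gradient (φ n) x) (η x)) atTop (𝓝 (∫ x, inner ℝ (g x) (η x))))
    {η : Euc N → ℝ} (hη : Sm η) :
    ∫ x, inner ℝ (g x) (gradient η x) =
      (SS N k σ).toReal * ∫ x, wr N k σ x * u x ^ (twoStar N σ - 1) * η x := by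
  have hp := twoStar_gt hN hσ2
  have hSt := SS_ne_top hN hk hσ hσ2
  set p := twoStar N σ
  set S := (SS N k σ).toReal with hS
  set c := ∫ x, wr N k σ x * u x ^ (p - 1) * η x
  set G := ∫ x, inner ℝ (g x) (gradient η x)
  set D := (DE η).toReal
  have hc := nl_conv hN hk hσ hσ2 (fun n => (hφ n).cont.measurable) hφ0 (fun n => (hA n).le) hu hu0 hAu hae hη
  have hG := hw _ (hη.memG 2)
  have hDr : Tendsto (fun n => (DE (φ n)).toReal) atTop (𝓝 S) := (ENNReal.tendsto_toReal hSt).comp hD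
  have key : ∀ t : ℝ, 0 < 1 + p * t * c → S * (1 + p * t * c) ^ (2 / p) ≤ S + 2 * t * G + t ^ 2 * D := by
    intro t ht
    have hb : Tendsto (fun n => 1 + p * t * ∫ x, wr N k σ x * φ n x ^ (p - 1) * η x) atTop (𝓝 (1 + p * t * c)) :=
      (hc.const_mul _).const_add _
    have hl : Tendsto (fun n => S * (1 + p * t * ∫ x, wr N k σ x * φ n x ^ (p - 1) * η x) ^ (2 / p)) atTop
        (𝓝 (S * (1 + p * t * c) ^ (2 / p))) := (hb.rpow_const (Or.inl ht.ne')).const_mul _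
    have hr : Tendsto (fun n => (DE (φ n)).toReal + 2 * t * (∫ x, inner ℝ (gradient (φ n) x) (gradient η x)) + t ^ 2 * D)
        atTop (𝓝 (S + 2 * t * G + t ^ 2 * D)) := (hDr.add (hG.const_mul _)).add_const _
    refine le_of_tendsto_of_tendsto hl hr ?_
    filter_upwards [hb.eventually (lt_mem_nhds ht)] with n hn
    rw [← DE_expand (hφ n) hη t]
    have hs : Sm (fun x => φ n x + t * η x) := (hφ n).add (hη.smul t)
    have h1 := ENNReal.toReal_mono (DE_ne_top hs) (SS_le (k := k) hN hk hσ hσ2 hs)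
    rw [ENNReal.toReal_mul, ← ENNReal.toReal_rpow] at h1
    refine le_trans ?_ h1
    have h2 := AE_lower hN hk hσ hσ2 (hφ n) (hφ0 n) hη t
    rw [hA n, ENNReal.toReal_one] at h2
    have hS0 : 0 ≤ S := ENNReal.toReal_nonneg
    exact mul_le_mul_of_nonneg_left (Real.rpow_le_rpow hn.le h2 (by positivity)) hS0
  set f : ℝ → ℝ := fun t => S + 2 * t * G + t ^ 2 * D - S * (1 + p * t * c) ^ (2 / p) with hf
  have hmin : IsLocalMin f 0 := by
    have hcont : Continuous (fun t : ℝ => 1 + p * t * c) := by fun_prop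
    have h0 : ∀ᶠ t in 𝓝 (0:ℝ), 0 < 1 + p * t * c := by
      have := hcont.tendsto 0
      refine this.eventually (lt_mem_nhds ?_)
      simp
    filter_upwards [h0] with t ht
    have h3 := key t ht
    have h4 : f 0 = 0 := by simp [hf]
    rw [h4, hf]; simp only; linarith
  have hder : HasDerivAt f (2 * G - S * (p * c * (2 / p) * (1 + p * 0 * c) ^ (2 / p - 1))) 0 := by
    have d1 : HasDerivAt (fun t : ℝ => 1 + p * t * c) (p * c) 0 := by
      have := (((hasDerivAt_id (0:ℝ)).const_mul p).mul_const c).const_add 1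
      simpa using this
    have d2 := (d1.rpow_const (p := 2 / p) (Or.inl (by simp))).const_mul S
    have d3 : HasDerivAt (fun t : ℝ => S + 2 * t * G + t ^ 2 * D) (2 * G) 0 := by
      have e1 := (((hasDerivAt_id (0:ℝ)).const_mul 2).mul_const G).const_add S
      have e2 := ((hasDerivAt_id (0:ℝ)).pow 2).mul_const D
      have e3 : HasDerivAt (fun t : ℝ => S + 2 * t * G + t ^ 2 * D) _ 0 := e1.add e2
      convert e3 using 1
      simp
    exact d3.sub d2
  have h5 := hmin.hasDerivAt_eq_zero hder
  have hp0 : p ≠ 0 := by positivity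
  have h6 : p * c * (2 / p) = 2 * c := by field_simp
  rw [h6] at h5
  simp at h5
  linarith


lemma inner_conv {N : ℕ} {g a : Euc N → Euc N} {b : ℕ → Euc N → Euc N} (hg : MemLp g 2 volume)
    (ha : MemLp a 2 volume) (hb : ∀ j, MemLp (b j) 2 volume)
    (h : Tendsto (fun j => eLpNorm (fun x => a x - b j x) 2 volume) atTop (𝓝 0)) :
    Tendsto (fun j => ∫ x, inner ℝ (g x) (b j x)) atTop (𝓝 (∫ x, inner ℝ (g x) (a x))) := by
  have key : ∀ c : Euc N → Euc N, AEStronglyMeasurable c volume →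
      ‖∫ x, inner ℝ (g x) (c x)‖ₑ ≤ eLpNorm g 2 volume * eLpNorm c 2 volume := by
    intro c hc
    refine (enorm_integral_le_lintegral_enorm _).trans ?_
    have h1 := ENNReal.lintegral_mul_le_Lp_mul_Lq volume (p := 2) (q := 2)
      (Real.holderConjugate_iff.2 ⟨by norm_num, by norm_num⟩) hg.1.enorm hc.enorm
    rw [eLpNorm_two_eq, eLpNorm_two_eq]
    simp only [ENNReal.rpow_ofNat] at h1
    refine le_trans (lintegral_mono fun x => ?_) h1
    simp only [Pi.mul_apply]
    rw [← ofReal_norm, ← ofReal_norm, ← ofReal_norm, ← ENNReal.ofReal_mul (norm_nonneg _)]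
    exact ENNReal.ofReal_le_ofReal (norm_inner_le_norm _ _)
  have hi : ∀ c : Euc N → Euc N, MemLp c 2 volume → Integrable (fun x => inner ℝ (g x) (c x)) volume := by
    intro c hc
    refine ⟨hg.1.inner hc.1, ?_⟩
    have h1 := ENNReal.lintegral_mul_le_Lp_mul_Lq volume (p := 2) (q := 2)
      (Real.holderConjugate_iff.2 ⟨by norm_num, by norm_num⟩) hg.1.enorm hc.1.enorm
    simp only [ENNReal.rpow_ofNat] at h1
    rw [← eLpNorm_two_eq, ← eLpNorm_two_eq] at h1
    refine lt_of_le_of_lt (le_trans (lintegral_mono fun x => ?_) h1) (ENNReal.mul_lt_top hg.2 hc.2)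
    simp only [Pi.mul_apply]
    rw [← ofReal_norm, ← ofReal_norm, ← ofReal_norm, ← ENNReal.ofReal_mul (norm_nonneg _)]
    exact ENNReal.ofReal_le_ofReal (norm_inner_le_norm _ _)
  rw [tendsto_iff_edist_tendsto_0]
  have h2 : Tendsto (fun j => eLpNorm g 2 volume * eLpNorm (fun x => a x - b j x) 2 volume) atTop (𝓝 0) := by
    have := ENNReal.Tendsto.const_mul (a := eLpNorm g 2 volume) h (Or.inr hg.2.ne)
    simpa using this
  refine tendsto_of_tendsto_of_tendsto_of_le_of_le tendsto_const_nhds h2 (fun _ => zero_le) fun j => ?_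
  simp only
  rw [edist_comm, edist_eq_enorm_sub, ← integral_sub (hi a ha) (hi _ (hb j))]
  have := key (fun x => a x - b j x) (ha.1.sub (hb j).1)
  simpa only [inner_sub_right] using this

lemma Sm.compl {N : ℕ} {φ : Euc N → ℝ} (h : Sm φ) {H : ℝ → ℝ} (hH : ContDiff ℝ (⊤ : ℕ∞) H) (h0 : H 0 = 0) :
    Sm (fun x => H (φ x)) := ⟨hH.comp h.1, h.2.comp_left (g := H) h0⟩

lemma grad_comp {N : ℕ} {φ : Euc N → ℝ} (h : Sm φ) {H : ℝ → ℝ} (hH : ContDiff ℝ (⊤ : ℕ∞) H) (x : Euc N) :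
    gradient (fun x => H (φ x)) x = deriv H (φ x) • gradient φ x := by
  have h1 : HasDerivAt H (deriv H (φ x)) (φ x) := (hH.differentiable (by simp)).differentiableAt.hasDerivAt
  have h2 := (h1.comp_hasFDerivAt x (h.diff x).hasFDerivAt).fderiv
  unfold gradient
  have h3 : (fun x => H (φ x)) = H ∘ φ := rfl
  rw [h3, h2, map_smul]

lemma chain_conv {N : ℕ} {u : Euc N → ℝ} {g : Euc N → Euc N} {ψ : ℕ → Euc N → ℝ}
    (hu : Measurable u) (hg : MemLp g 2 volume) (hψ : ∀ j, Sm (ψ j))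
    (hae : ∀ᵐ x, Tendsto (fun j => ψ j x) atTop (𝓝 (u x)))
    (h : Tendsto (fun j => eLpNorm (fun x => g x - gradient (ψ j) x) 2 volume) atTop (𝓝 0))
    {H : ℝ → ℝ} (hH : ContDiff ℝ (⊤ : ℕ∞) H) {L : ℝ} (hL : ∀ t, |deriv H t| ≤ L) :
    Tendsto (fun j => eLpNorm (fun x => deriv H (u x) • g x - gradient (fun x => H (ψ j x)) x) 2 volume)
      atTop (𝓝 0) := by
  have hL0 : 0 ≤ L := (abs_nonneg _).trans (hL 0)
  have hdc : Continuous (deriv H) := hH.continuous_deriv (by simp)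
  have hdm := hdc.measurable
  set e : ℕ → ℝ≥0∞ := fun j => eLpNorm (fun x => (deriv H (u x) - deriv H (ψ j x)) • g x) 2 volume with he
  have he0 : Tendsto e atTop (𝓝 0) := by
    have h1 : Tendsto (fun j => ∫⁻ x, ‖(deriv H (u x) - deriv H (ψ j x)) • g x‖ₑ ^ 2) atTop (𝓝 (∫⁻ x : Euc N, 0)) := by
      refine tendsto_lintegral_of_dominated_convergence' (fun x => (ENNReal.ofReal (2 * L)) ^ 2 * ‖g x‖ₑ ^ 2) ?_ ?_ ?_ ?_
      · intro j
        have h2 : Measurable (fun x => deriv H (u x) - deriv H (ψ j x)) :=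
          (hdm.comp hu).sub (hdm.comp (hψ j).cont.measurable)
        exact (h2.aestronglyMeasurable.smul hg.1).enorm.pow_const 2
      · refine fun j => ae_of_all _ fun x => ?_
        simp only
        rw [enorm_smul, mul_pow]
        gcongr
        rw [← ofReal_norm, Real.norm_eq_abs]
        refine ENNReal.ofReal_le_ofReal ((abs_sub _ _).trans ?_)
        linarith [hL (u x), hL (ψ j x)]
      · rw [lintegral_const_mul' _ _ (ENNReal.pow_ne_top ENNReal.ofReal_ne_top)]
        have := hg.2
        rw [eLpNorm_two_eq] at this
        refine ENNReal.mul_ne_top (ENNReal.pow_ne_top ENNReal.ofReal_ne_top) ?_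
        intro h3
        rw [h3] at this
        simp at this
      · filter_upwards [hae] with x hx
        have h2 : Tendsto (fun j => (deriv H (u x) - deriv H (ψ j x)) • g x) atTop
            (𝓝 ((deriv H (u x) - deriv H (u x)) • g x)) :=
          (tendsto_const_nhds.sub ((hdc.tendsto _).comp hx)).smul_const _
        have h3 := ((ENNReal.continuous_pow 2).tendsto _).comp h2.enorm
        simpa [Function.comp_def] using h3
    simp only [lintegral_zero] at h1
    have h2 := (ENNReal.continuous_rpow_const (y := 1/2)).tendsto _ |>.comp h1
    rw [ENNReal.zero_rpow_of_pos (by norm_num)] at h2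
    refine h2.congr fun j => ?_
    rw [he]; simp only
    rw [eLpNorm_two_eq]; rfl
  have h3 : Tendsto (fun j => e j + ENNReal.ofReal L * eLpNorm (fun x => g x - gradient (ψ j) x) 2 volume) atTop (𝓝 0) := by
    have := he0.add (ENNReal.Tendsto.const_mul (a := ENNReal.ofReal L) h (Or.inr (by simp)))
    simpa using this
  refine tendsto_of_tendsto_of_tendsto_of_le_of_le tendsto_const_nhds h3 (fun _ => zero_le) fun j => ?_
  simp only
  have h4 : Measurable (fun x => deriv H (u x) - deriv H (ψ j x)) :=
          (hdm.comp hu).sub (hdm.comp (hψ j).cont.measurable)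
  have h4' : Measurable (fun x => deriv H (ψ j x)) := hdm.comp (hψ j).cont.measurable
  have m1 : AEStronglyMeasurable (fun x => (deriv H (u x) - deriv H (ψ j x)) • g x) volume :=
    h4.aestronglyMeasurable.smul hg.1
  have m2 : AEStronglyMeasurable (fun x => deriv H (ψ j x) • (g x - gradient (ψ j) x)) volume :=
    h4'.aestronglyMeasurable.smul (hg.1.sub (hψ j).contG.aestronglyMeasurable)
  have h5 : (fun x => deriv H (u x) • g x - gradient (fun x => H (ψ j x)) x) =
      (fun x => (deriv H (u x) - deriv H (ψ j x)) • g x) + (fun x => deriv H (ψ j x) • (g x - gradient (ψ j) x)) := by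
    ext1 x
    simp only [Pi.add_apply]
    rw [grad_comp (hψ j) hH]
    module
  rw [h5]
  refine (eLpNorm_add_le m1 m2 (by norm_num)).trans ?_
  refine add_le_add le_rfl ?_
  rw [← ENNReal.ofReal_toReal (a := ENNReal.ofReal L) (by simp)] 
  rw [ENNReal.toReal_ofReal hL0]
  refine eLpNorm_le_mul_eLpNorm_of_ae_le_mul (ae_of_all _ fun x => ?_) 2
  rw [norm_smul]
  gcongr
  exact hL _

lemma AE_holder {N k : ℕ} (hN : 3 ≤ N) {σ : ℝ} (hσ2 : σ < 2) {u v : Euc N → ℝ} (hu : Measurable u) (hv : Measurable v) :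
    ∫⁻ x, wt N k σ x * ‖u x‖ₑ ^ (twoStar N σ - 1) * ‖v x‖ₑ ≤
      AE N k σ u univ ^ (1 - 1 / twoStar N σ) * AE N k σ v univ ^ (1 / twoStar N σ) := by
  have hp := twoStar_gt hN hσ2
  have hθ : 1 / twoStar N σ ≤ 1 := by rw [div_le_one (by linarith)]; linarith
  unfold AE
  rw [Measure.restrict_univ]
  have hm : ∀ u : Euc N → ℝ, Measurable u → AEMeasurable (fun x => wt N k σ x * ‖u x‖ₑ ^ twoStar N σ) volume := by
    intro u hu
    exact ((measurable_wt N k σ).mul (hu.enorm.pow_const _)).aemeasurable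
  have := ENNReal.lintegral_mul_norm_pow_le (hm u hu) (hm v hv) (p := 1 - 1 / twoStar N σ) (q := 1 / twoStar N σ)
    (by linarith) (by positivity) (by ring)
  refine le_trans (le_of_eq ?_) this
  congr 1; ext x
  have hp0 : twoStar N σ ≠ 0 := by positivity
  rw [ENNReal.mul_rpow_of_nonneg _ _ (by linarith), ENNReal.mul_rpow_of_nonneg _ _ (by positivity),
    ← ENNReal.rpow_mul, ← ENNReal.rpow_mul]
  have e1 : twoStar N σ * (1 - 1 / twoStar N σ) = twoStar N σ - 1 := by field_simp
  have e2 : twoStar N σ * (1 / twoStar N σ) = 1 := by field_simp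
  rw [e1, e2, ENNReal.rpow_one]
  have e3 : wt N k σ x = wt N k σ x ^ (1 - 1 / twoStar N σ) * wt N k σ x ^ (1 / twoStar N σ) := by
    rw [← ENNReal.rpow_add_of_nonneg _ _ (by linarith) (by positivity)]; simp
  conv_lhs => rw [e3]
  ring

lemma AE_conv {N k : ℕ} (hN : 3 ≤ N) (hk : k + 2 ≤ N) {σ : ℝ} (hσ : 0 ≤ σ) (hσ2 : σ < 2)
    {u : Euc N → ℝ} {g : Euc N → Euc N} {ψ : ℕ → Euc N → ℝ} (hg : MemLp g 2 volume) (hψ : ∀ j, Sm (ψ j))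
    (hae : ∀ᵐ x, Tendsto (fun j => ψ j x) atTop (𝓝 (u x)))
    (h : Tendsto (fun j => eLpNorm (fun x => g x - gradient (ψ j) x) 2 volume) atTop (𝓝 0)) :
    Tendsto (fun j => AE N k σ (fun x => u x - ψ j x) univ) atTop (𝓝 0) := by
  have hp := twoStar_gt hN hσ2
  have hS0 := SS_ne_zero hN hk hσ hσ2
  have h1 : ∀ j, AE N k σ (fun x => u x - ψ j x) univ ≤
      ((eLpNorm (fun x => g x - gradient (ψ j) x) 2 volume) ^ (2:ℝ) / SS N k σ) ^ (twoStar N σ / 2) := by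
    intro j
    refine (SS_le_lim hN hk hσ hσ2 (ψ := fun i x => ψ i x - ψ j x) (fun i => (hψ i).sub (hψ j)) ?_ ?_).1
    · filter_upwards [hae] with x hx
      exact (hx.sub_const _).enorm
    · have h2 := DE_tendsto (g := fun x => g x - gradient (ψ j) x) (ψ := fun i x => ψ i x - ψ j x)
        (hg.1.sub (hψ j).contG.aestronglyMeasurable)
        (fun i => (hψ i).sub (hψ j)) (h.congr fun i => ?_)
      · rw [eLpNorm_two_eq, ← ENNReal.rpow_mul]
        norm_num
        exact h2
      · congr 1; ext1 x
        rw [grad_sub (hψ i) (hψ j)]; simp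
  have h2 : Tendsto (fun j => ((eLpNorm (fun x => g x - gradient (ψ j) x) 2 volume) ^ (2:ℝ) / SS N k σ) ^ (twoStar N σ / 2))
      atTop (𝓝 0) := by
    have e1 := (ENNReal.continuous_rpow_const (y := 2)).tendsto _ |>.comp h
    rw [ENNReal.zero_rpow_of_pos (by norm_num)] at e1
    have e2 := ENNReal.Tendsto.div_const e1 (Or.inr hS0)
    have e3 := (ENNReal.continuous_rpow_const (y := twoStar N σ / 2)).tendsto _ |>.comp e2
    rw [ENNReal.zero_div, ENNReal.zero_rpow_of_pos (by linarith)] at e3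
    exact e3
  exact tendsto_of_tendsto_of_tendsto_of_le_of_le tendsto_const_nhds h2 (fun _ => zero_le) h1


/-- The data of a weak solution obtained from a minimizing sequence. -/
structure WS (N k : ℕ) (σ : ℝ) (ψ : ℕ → Euc N → ℝ) (u : Euc N → ℝ) (g : Euc N → Euc N) : Prop where
  hN : 3 ≤ N
  hk : k + 2 ≤ N
  hσ : 0 < σ
  hσ2 : σ < 2
  hu : Measurable u
  hu0 : ∀ x, 0 ≤ u x
  hg : MemLp g 2 volume
  hgm : StronglyMeasurable g
  hne : ¬ (u =ᵐ[volume] 0)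
  hA : AE N k σ u univ ≤ 1
  hψ : ∀ j, Sm (ψ j)
  hae : ∀ᵐ x, Tendsto (fun j => ψ j x) atTop (𝓝 (u x))
  hLu : Tendsto (fun n => eLpNorm (fun x => u x - ψ n x)
        (ENNReal.ofReal (2 * (N : ℝ) / ((N : ℝ) - 2))) volume) atTop (𝓝 0)
  hLg : Tendsto (fun j => eLpNorm (fun x => g x - gradient (ψ j) x) 2 volume) atTop (𝓝 0)
  hEL : ∀ η : Euc N → ℝ, Sm η → ∫ x, inner ℝ (g x) (gradient η x) =
      (SS N k σ).toReal * ∫ x, wr N k σ x * u x ^ (twoStar N σ - 1) * η x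

lemma exists_WS {N k : ℕ} (hN : 3 ≤ N) (hk : k + 2 ≤ N) {σ : ℝ} (hσ : 0 < σ) (hσ2 : σ < 2) :
    ∃ ψ u g, WS N k σ ψ u g := by
  obtain ⟨φ, ψ, u, g, hφ, hφ0, hA, hD, hu, hu0, hg, hgm, hae, hne, hw, hψ, haeψ, h1, h2⟩ := lim_lemma hN hk hσ hσ2
  have hAu : AE N k σ u univ ≤ 1 := by
    have hS0 := SS_ne_zero hN hk hσ.le hσ2
    have hSt := SS_ne_top hN hk hσ.le hσ2
    have := (SS_le_lim (u := u) hN hk hσ.le hσ2 hφ (by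
      filter_upwards [hae] with x hx
      exact hx.enorm) hD).1
    rwa [ENNReal.div_self hS0 hSt, ENNReal.one_rpow] at this
  exact ⟨ψ, u, g, hN, hk, hσ, hσ2, hu, hu0, hg, hgm, hne, hAu, hψ, haeψ, h1, h2,
    fun η hη => EL hN hk hσ.le hσ2 hφ hφ0 hA hD hu hu0 hAu hae hw hη⟩

lemma lip_of_deriv {H : ℝ → ℝ} (hH : ContDiff ℝ (⊤ : ℕ∞) H) {L : ℝ} (hL : ∀ t, |deriv H t| ≤ L) (s t : ℝ) :
    ‖H s - H t‖ₑ ≤ ENNReal.ofReal L * ‖s - t‖ₑ := by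
  have hL0 : 0 ≤ L := (abs_nonneg _).trans (hL 0)
  have h := Convex.norm_image_sub_le_of_norm_deriv_le (f := H) (s := univ) (x := t) (y := s) (C := L)
    (fun x _ => (hH.differentiable (by simp)).differentiableAt) (fun x _ => hL x) convex_univ (mem_univ _) (mem_univ _)
  rw [← ofReal_norm, ← ofReal_norm, ← ENNReal.ofReal_mul hL0]
  exact ENNReal.ofReal_le_ofReal h

lemma nl_enorm {N k : ℕ} (hN : 3 ≤ N) {σ : ℝ} (hσ2 : σ < 2) {u : Euc N → ℝ} (hu0 : ∀ x, 0 ≤ u x) (v : Euc N → ℝ) (x : Euc N) :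
    ‖wr N k σ x * u x ^ (twoStar N σ - 1) * v x‖ₑ = wt N k σ x * ‖u x‖ₑ ^ (twoStar N σ - 1) * ‖v x‖ₑ := by
  have hp := twoStar_gt hN hσ2
  rw [enorm_mul, enorm_mul, wr_enorm]
  congr 2
  have := rpow_enorm (p := twoStar N σ - 1) (by linarith) (u x)
  rwa [abs_of_nonneg (hu0 x)] at this

lemma nl_int' {N k : ℕ} (hN : 3 ≤ N) {σ : ℝ} (hσ2 : σ < 2) {u v : Euc N → ℝ} (hu : Measurable u) (hu0 : ∀ x, 0 ≤ u x)
    (hv : Measurable v) (hA : AE N k σ u univ ≠ ⊤) (hB : AE N k σ v univ ≠ ⊤) :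
    Integrable (fun x => wr N k σ x * u x ^ (twoStar N σ - 1) * v x) volume := by
  have hp := twoStar_gt hN hσ2
  refine ⟨(((wr_meas N k σ).mul (hu.pow_const _)).mul hv).aestronglyMeasurable, ?_⟩
  unfold HasFiniteIntegral
  simp only [nl_enorm hN hσ2 hu0]
  refine lt_of_le_of_lt (AE_holder hN hσ2 hu hv) ?_
  have hθ : 1 / twoStar N σ ≤ 1 := by rw [div_le_one (by linarith)]; linarith
  exact ENNReal.mul_lt_top (ENNReal.rpow_lt_top_of_nonneg (by linarith) hA)
    (ENNReal.rpow_lt_top_of_nonneg (by positivity) hB)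

lemma AE_lip {N k : ℕ} (hN : 3 ≤ N) {σ : ℝ} (hσ2 : σ < 2) {u v : Euc N → ℝ} {L : ℝ}
    (h : ∀ x, ‖v x‖ₑ ≤ ENNReal.ofReal L * ‖u x‖ₑ) :
    AE N k σ v univ ≤ ENNReal.ofReal L ^ twoStar N σ * AE N k σ u univ := by
  have hp := twoStar_pos hN hσ2
  unfold AE
  rw [← lintegral_const_mul' _ _ (ENNReal.rpow_ne_top_of_nonneg hp.le ENNReal.ofReal_ne_top)]
  refine lintegral_mono fun x => ?_
  simp only
  calc _ ≤ wt N k σ x * (ENNReal.ofReal L * ‖u x‖ₑ) ^ twoStar N σ := by gcongr; exact h x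
    _ = _ := by rw [ENNReal.mul_rpow_of_nonneg _ _ hp.le]; ring

namespace WS
variable {N k : ℕ} {σ : ℝ} {ψ : ℕ → Euc N → ℝ} {u : Euc N → ℝ} {g : Euc N → Euc N}

lemma hAt (w : WS N k σ ψ u g) : AE N k σ u univ ≠ ⊤ := ne_top_of_le_ne_top (by simp) w.hA

lemma grad_mem (w : WS N k σ ψ u g) {H : ℝ → ℝ} (hH : ContDiff ℝ (⊤ : ℕ∞) H) {L : ℝ} (hL : ∀ t, |deriv H t| ≤ L) :
    MemLp (fun x => deriv H (u x) • g x) 2 volume := by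
  have hdc : Continuous (deriv H) := hH.continuous_deriv (by simp)
  have hm : Measurable (fun x => deriv H (u x)) := hdc.measurable.comp w.hu
  refine (w.hg.const_smul L).mono (hm.aestronglyMeasurable.smul w.hg.1) (ae_of_all _ fun x => ?_)
  simp only [Pi.smul_apply, norm_smul]
  gcongr
  exact (hL _).trans (le_abs_self _)

lemma ELH (w : WS N k σ ψ u g) {H : ℝ → ℝ} (hH : ContDiff ℝ (⊤ : ℕ∞) H) (h0 : H 0 = 0) {L : ℝ}
    (hL : ∀ t, |deriv H t| ≤ L) :
    ∫ x, inner ℝ (g x) (deriv H (u x) • g x) =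
      (SS N k σ).toReal * ∫ x, wr N k σ x * u x ^ (twoStar N σ - 1) * H (u x) := by
  have hp := twoStar_gt w.hN w.hσ2
  have hθ : 1 / twoStar N σ ≤ 1 := by rw [div_le_one (by linarith)]; linarith
  have h1 := chain_conv w.hu w.hg w.hψ w.hae w.hLg hH hL
  have h2 := inner_conv w.hg (w.grad_mem hH hL) (fun j => ((w.hψ j).compl hH h0).memG 2) h1
  simp only [w.hEL _ ((w.hψ _).compl hH h0)] at h2
  refine tendsto_nhds_unique h2 (Tendsto.const_mul _ ?_)
  rw [tendsto_iff_edist_tendsto_0]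
  have hHm : Measurable (fun x => H (u x)) := hH.continuous.measurable.comp w.hu
  have hAH : AE N k σ (fun x => H (u x)) univ ≠ ⊤ := by
    refine ne_top_of_le_ne_top ?_ (AE_lip (u := u) (L := L) w.hN w.hσ2 fun x => ?_)
    · exact ENNReal.mul_ne_top (ENNReal.rpow_ne_top_of_nonneg (by linarith) ENNReal.ofReal_ne_top) w.hAt
    · have := lip_of_deriv hH hL (u x) 0
      simpa [h0] using this
  have h3 := AE_conv w.hN w.hk w.hσ.le w.hσ2 w.hg w.hψ w.hae w.hLg
  have h4 : Tendsto (fun j => ENNReal.ofReal L * (AE N k σ u univ ^ (1 - 1 / twoStar N σ) *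
      AE N k σ (fun x => u x - ψ j x) univ ^ (1 / twoStar N σ))) atTop (𝓝 0) := by
    have e1 := (ENNReal.continuous_rpow_const (y := 1 / twoStar N σ)).tendsto _ |>.comp h3
    rw [ENNReal.zero_rpow_of_pos (by positivity)] at e1
    have e2 := ENNReal.Tendsto.const_mul (a := AE N k σ u univ ^ (1 - 1 / twoStar N σ)) e1
      (Or.inr (ENNReal.rpow_ne_top_of_nonneg (by linarith) w.hAt))
    have e3 := ENNReal.Tendsto.const_mul (a := ENNReal.ofReal L) e2 (Or.inr (by simp))
    simpa using e3
  refine tendsto_of_tendsto_of_tendsto_of_le_of_le tendsto_const_nhds h4 (fun _ => zero_le) fun j => ?_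
  simp only
  have hj := (w.hψ j).compl hH h0
  have hum : Measurable (fun x => u x - ψ j x) := w.hu.sub (w.hψ j).cont.measurable
  rw [edist_comm, edist_eq_enorm_sub, ← integral_sub (nl_int' w.hN w.hσ2 w.hu w.hu0 hHm w.hAt hAH)
    (nl_int w.hN w.hk w.hσ.le w.hσ2 w.hu w.hu0 w.hAt hj)]
  refine (enorm_integral_le_lintegral_enorm _).trans ?_
  refine le_trans ?_ (mul_le_mul_right (AE_holder w.hN w.hσ2 w.hu hum) _)
  rw [← lintegral_const_mul' _ _ ENNReal.ofReal_ne_top]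
  refine lintegral_mono fun x => ?_
  simp only
  rw [← mul_sub]
  have := nl_enorm (k := k) w.hN w.hσ2 w.hu0 (fun x => H (u x) - H (ψ j x)) x
  rw [this]
  calc _ ≤ wt N k σ x * ‖u x‖ₑ ^ (twoStar N σ - 1) * (ENNReal.ofReal L * ‖u x - ψ j x‖ₑ) :=
        mul_le_mul_right (lip_of_deriv hH hL _ _) _
    _ = _ := by ring

/-- energy inequality for compositions -/
lemma HSF (w : WS N k σ ψ u g) {F : ℝ → ℝ} (hF : ContDiff ℝ (⊤ : ℕ∞) F) (h0 : F 0 = 0) {L : ℝ}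
    (hL : ∀ t, |deriv F t| ≤ L) :
    SS N k σ * AE N k σ (fun x => F (u x)) univ ^ (2 / twoStar N σ) ≤ ∫⁻ x, ‖deriv F (u x) • g x‖ₑ ^ 2 := by
  have h1 := chain_conv w.hu w.hg w.hψ w.hae w.hLg hF hL
  have h2 := DE_tendsto (w.grad_mem hF hL).1 (fun j => (w.hψ j).compl hF h0) h1
  refine (SS_le_lim w.hN w.hk w.hσ.le w.hσ2 (fun j => (w.hψ j).compl hF h0) ?_ h2).2
  filter_upwards [w.hae] with x hx
  exact (((hF.continuous.tendsto _).comp hx)).enorm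

/-- combined inequality -/
lemma BK (w : WS N k σ ψ u g) {F H : ℝ → ℝ} (hF : ContDiff ℝ (⊤ : ℕ∞) F) (h0 : F 0 = 0) {L : ℝ}
    (hL : ∀ t, |deriv F t| ≤ L) (hH : ContDiff ℝ (⊤ : ℕ∞) H) (hH0 : H 0 = 0) (hFH : ∀ t, deriv H t = deriv F t ^ 2)
    (hHn : ∀ t, 0 ≤ t → 0 ≤ H t) :
    AE N k σ (fun x => F (u x)) univ ^ (2 / twoStar N σ) ≤
      ∫⁻ x, wt N k σ x * ‖u x‖ₑ ^ (twoStar N σ - 1) * ‖H (u x)‖ₑ := by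
  have hp := twoStar_gt w.hN w.hσ2
  have hS0 := SS_ne_zero w.hN w.hk w.hσ.le w.hσ2
  have hSt := SS_ne_top w.hN w.hk w.hσ.le w.hσ2
  have hL0 : 0 ≤ L := (abs_nonneg _).trans (hL 0)
  have hL2 : ∀ t, |deriv H t| ≤ L ^ 2 := fun t => by
    rw [hFH, abs_pow]; gcongr; exact hL t
  have h1 := w.HSF hF h0 hL
  have h2 := w.ELH hH hH0 hL2
  have hHm : Measurable (fun x => H (u x)) := hH.continuous.measurable.comp w.hu
  have e1 : ENNReal.ofReal (∫ x, inner ℝ (g x) (deriv H (u x) • g x)) = ∫⁻ x, ‖deriv F (u x) • g x‖ₑ ^ 2 := by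
    have hdc : Continuous (deriv F) := hF.continuous_deriv (by simp)
    have hm : Measurable (fun x => deriv F (u x)) := hdc.measurable.comp w.hu
    have hm1 : AEStronglyMeasurable (fun x => ‖deriv F (u x) • g x‖ ^ 2) volume :=
      ((hm.aestronglyMeasurable.smul w.hg.1).norm.pow 2)
    have e2 : (∫ x, inner ℝ (g x) (deriv H (u x) • g x)) = ∫ x, ‖deriv F (u x) • g x‖ ^ 2 := by
      congr 1; ext x
      rw [inner_smul_right, real_inner_self_eq_norm_sq, norm_smul, mul_pow, hFH]; simp
    rw [e2, ofReal_integral_eq_lintegral_ofReal]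
    · congr 1; ext x
      rw [ENNReal.ofReal_pow (norm_nonneg _), ofReal_norm]
    · have := (w.grad_mem hF hL).norm.integrable_sq
      exact this
    · exact ae_of_all _ fun x => by positivity
  have hm2 : AEStronglyMeasurable (fun x => wr N k σ x * u x ^ (twoStar N σ - 1) * H (u x)) volume :=
    (((wr_meas N k σ).mul (w.hu.pow_const _)).mul hHm).aestronglyMeasurable
  have e3 : ENNReal.ofReal (∫ x, wr N k σ x * u x ^ (twoStar N σ - 1) * H (u x)) ≤
      ∫⁻ x, wt N k σ x * ‖u x‖ₑ ^ (twoStar N σ - 1) * ‖H (u x)‖ₑ := by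
    refine (ENNReal.ofReal_le_ofReal (le_abs_self _)).trans ?_
    rw [← Real.norm_eq_abs, ofReal_norm]
    refine (enorm_integral_le_lintegral_enorm _).trans (le_of_eq ?_)
    congr 1; ext x
    exact nl_enorm w.hN w.hσ2 w.hu0 (fun x => H (u x)) x
  rw [← e1, h2, ENNReal.ofReal_mul ENNReal.toReal_nonneg, ENNReal.ofReal_toReal hSt] at h1
  exact ((ENNReal.mul_le_mul_iff_right hS0 hSt).1 h1).trans e3

end WS


namespace WS
variable {N k : ℕ} {σ : ℝ} {ψ : ℕ → Euc N → ℝ} {u : Euc N → ℝ} {g : Euc N → Euc N}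

lemma A_ne (w : WS N k σ ψ u g) : AE N k σ u univ ≠ 0 := by
  intro h
  have hp := twoStar_gt w.hN w.hσ2
  refine w.hne ?_
  have hmm : Measurable (fun x => wt N k σ x * ‖u x‖ₑ ^ twoStar N σ) :=
      (measurable_wt N k σ).mul (w.hu.enorm.pow_const _)
  rw [AE, lintegral_eq_zero_iff hmm, Measure.restrict_univ] at h
  filter_upwards [h, zNorm_null (N := N) (k := k) (by have := w.hk; omega)] with x hx hz
  have h1 := wt_pos (N := N) (k := k) (σ := σ) hz
  simp only [Pi.zero_apply, mul_eq_zero, h1.ne', false_or] at hx ⊢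
  rw [ENNReal.rpow_eq_zero_iff] at hx
  rcases hx with hx | hx
  · simpa using hx.1
  · exact absurd hx.2 (by linarith)

lemma A_one (w : WS N k σ ψ u g) : AE N k σ u univ = 1 := by
  have hp := twoStar_gt w.hN w.hσ2
  have h := w.BK (F := fun t => t) (H := fun t => t) contDiff_id rfl (L := 1) (by intro t; simp)
    contDiff_id rfl (by intro t; simp) (fun t ht => ht)
  have h2 : ∫⁻ x, wt N k σ x * ‖u x‖ₑ ^ (twoStar N σ - 1) * ‖u x‖ₑ = AE N k σ u univ := by
    rw [AE, Measure.restrict_univ]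
    congr 1; ext x
    rw [mul_assoc]
    congr 1
    have := ENNReal.rpow_add_of_nonneg (x := ‖u x‖ₑ) (twoStar N σ - 1) 1 (by linarith) (by norm_num)
    rw [ENNReal.rpow_one] at this
    rw [← this]; ring_nf
  rw [h2] at h
  refine le_antisymm w.hA ?_
  by_contra hlt
  rw [not_le] at hlt
  have h0 := w.A_ne
  have ht := w.hAt
  set A := AE N k σ u univ
  have h3 : (A ^ (2 / twoStar N σ)) < 1 ∧ A < A ^ (2 / twoStar N σ) := by
    refine ⟨ENNReal.rpow_lt_one hlt (by positivity), ?_⟩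
    have := ENNReal.rpow_lt_rpow_of_exponent_gt (x := A) (pos_iff_ne_zero.2 h0) hlt
      (y := 1) (z := 2 / twoStar N σ) (by rw [div_lt_one (by linarith)]; linarith)
    rwa [ENNReal.rpow_one] at this
  exact absurd h (not_le.2 h3.2)

lemma g_sq (w : WS N k σ ψ u g) : ∫ x, ‖g x‖ ^ 2 = (SS N k σ).toReal := by
  have hp := twoStar_gt w.hN w.hσ2
  have h := w.ELH (H := fun t => t) contDiff_id rfl (L := 1) (by intro t; simp)
  have h1 : ∫ x, wr N k σ x * u x ^ (twoStar N σ - 1) * u x = 1 := by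
    have := AE_real (N := N) (k := k) (σ := σ) w.hN w.hσ2 w.hu
    rw [w.A_one, ENNReal.toReal_one] at this
    refine Eq.trans ?_ this
    congr 1; ext x
    rw [abs_of_nonneg (w.hu0 x), mul_assoc]
    congr 1
    rcases (w.hu0 x).eq_or_lt with h0 | h0
    · rw [← h0, Real.zero_rpow (by linarith), Real.zero_rpow (by linarith)]; simp
    · rw [← Real.rpow_add_one h0.ne']; ring_nf
  rw [h1, mul_one] at h
  rw [← h]
  congr 1; ext x
  simp [real_inner_self_eq_norm_sq]

end WS


/-- Truncated power. -/
def qf (ε : ℝ) (m : ℕ) (t : ℝ) : ℝ := ((1 + t ^ 2) / (1 + ε * t ^ 2)) ^ m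

lemma qf_smooth {ε : ℝ} (h0 : 0 < ε) (m : ℕ) : ContDiff ℝ (⊤ : ℕ∞) (qf ε m) := by
  unfold qf
  refine ContDiff.pow (ContDiff.div (by fun_prop) (by fun_prop) fun t => ?_) m
  positivity

lemma qf_pos {ε : ℝ} (h0 : 0 < ε) (m : ℕ) (t : ℝ) : 0 < qf ε m t := by unfold qf; positivity

lemma qf_le_eps {ε : ℝ} (h0 : 0 < ε) (m : ℕ) (h1 : ε ≤ 1) (t : ℝ) : qf ε m t ≤ (1 / ε) ^ m := by
  unfold qf
  refine pow_le_pow_left₀ (by positivity) ?_ m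
  rw [div_le_div_iff₀ (by positivity) h0]
  nlinarith [sq_nonneg t]

lemma qf_le {ε : ℝ} (h0 : 0 < ε) (m : ℕ) (t : ℝ) : qf ε m t ≤ (1 + t ^ 2) ^ m := by
  unfold qf
  refine pow_le_pow_left₀ (by positivity) ?_ m
  exact div_le_self (by positivity) (by nlinarith [mul_nonneg h0.le (sq_nonneg t)])

lemma qf_mono {ε : ℝ} (h0 : 0 < ε) (m : ℕ) (h1 : ε ≤ 1) {s t : ℝ} (hs : 0 ≤ s) (hst : s ≤ t) : qf ε m s ≤ qf ε m t := by
  unfold qf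
  refine pow_le_pow_left₀ (by positivity) ?_ m
  rw [div_le_div_iff₀ (by positivity) (by positivity)]
  have : s ^ 2 ≤ t ^ 2 := by gcongr
  nlinarith

lemma qf_half {ε : ℝ} (h0 : 0 < ε) (m : ℕ) (t : ℝ) : qf ε m t ≤ 4 ^ m * qf ε m (t / 2) := by
  unfold qf
  rw [← mul_pow]
  refine pow_le_pow_left₀ (by positivity) ?_ m
  rw [← mul_div_assoc, div_le_div_iff₀ (by positivity) (by positivity)]
  have ht : 0 ≤ t ^ 2 := sq_nonneg t
  have : 0 ≤ ε * t ^ 2 := by positivity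
  nlinarith [mul_nonneg this ht]

lemma prim_smooth {q : ℝ → ℝ} (hq : ContDiff ℝ (⊤ : ℕ∞) q) :
    ContDiff ℝ (⊤ : ℕ∞) (fun t => ∫ s in (0:ℝ)..t, q s) ∧ ∀ t, deriv (fun t => ∫ s in (0:ℝ)..t, q s) t = q t := by
  have hd : ∀ t, HasDerivAt (fun t => ∫ s in (0:ℝ)..t, q s) (q t) t := fun t =>
    intervalIntegral.integral_hasDerivAt_right (hq.continuous.intervalIntegrable _ _)
      hq.continuous.stronglyMeasurable.stronglyMeasurableAtFilter hq.continuous.continuousAt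
  refine ⟨?_, fun t => (hd t).deriv⟩
  rw [contDiff_infty_iff_deriv]
  refine ⟨fun t => (hd t).differentiableAt, ?_⟩
  have : deriv (fun t => ∫ s in (0:ℝ)..t, q s) = q := funext fun t => (hd t).deriv
  rw [this]; exact hq

lemma prim_upper {q : ℝ → ℝ} (hq : Continuous q) {t : ℝ} (ht : 0 ≤ t) (hm : ∀ s, 0 ≤ s → s ≤ t → q s ≤ q t) :
    ∫ s in (0:ℝ)..t, q s ≤ t * q t := by
  have h := intervalIntegral.integral_mono_on (μ := volume) ht (hq.intervalIntegrable 0 t)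
    (intervalIntegrable_const (c := q t)) (fun s hs => hm s hs.1 hs.2)
  simpa using h

lemma prim_lower {q : ℝ → ℝ} (hq : Continuous q) (hq0 : ∀ s, 0 ≤ q s) {t : ℝ} (ht : 0 ≤ t)
    (hm : ∀ s, t / 2 ≤ s → q (t / 2) ≤ q s) :
    t / 2 * q (t / 2) ≤ ∫ s in (0:ℝ)..t, q s := by
  have h := intervalIntegral.integral_mono_on (μ := volume) (by linarith : t / 2 ≤ t)
    (intervalIntegrable_const (c := q (t / 2))) (hq.intervalIntegrable (t / 2) t) (fun s hs => hm s hs.1)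
  have h2 : 0 ≤ ∫ s in (0:ℝ)..(t / 2), q s := intervalIntegral.integral_nonneg (by linarith) fun s _ => hq0 s
  rw [← intervalIntegral.integral_add_adjacent_intervals (hq.intervalIntegrable 0 (t / 2)) (hq.intervalIntegrable (t / 2) t)]
  simp at h
  have : t - t / 2 = t / 2 := by ring
  rw [this] at h
  linarith

namespace WS
variable {N k : ℕ} {σ : ℝ} {ψ : ℕ → Euc N → ℝ} {u : Euc N → ℝ} {g : Euc N → Euc N}

lemma BK1 (w : WS N k σ ψ u g) {ε : ℝ} (h0 : 0 < ε) (h1 : ε ≤ 1) (m : ℕ) :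
    AE N k σ (fun x => u x * qf ε m (u x)) univ ^ (2 / twoStar N σ) ≤
      ENNReal.ofReal (2 * 4 ^ m) ^ (2:ℝ) * ∫⁻ x, wt N k σ x * ‖u x‖ₑ ^ (twoStar N σ) * ‖qf ε m (u x)‖ₑ ^ 2 := by
  have hp := twoStar_gt w.hN w.hσ2
  have hq := qf_smooth h0 m
  have hq2 : ContDiff ℝ (⊤ : ℕ∞) (fun t => qf ε m t ^ 2) := hq.pow 2
  obtain ⟨F1, F2⟩ := prim_smooth hq
  obtain ⟨H1, H2⟩ := prim_smooth hq2
  set F := fun t => ∫ s in (0:ℝ)..t, qf ε m s with hF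
  set H := fun t => ∫ s in (0:ℝ)..t, qf ε m s ^ 2 with hH
  have hHn : ∀ t, 0 ≤ t → 0 ≤ H t := fun t ht => intervalIntegral.integral_nonneg ht fun s _ => by positivity
  have hb := w.BK F1 (by simp [hF]) (L := (1 / ε) ^ m) (fun t => by
    rw [F2, abs_of_pos (qf_pos h0 m t)]; exact qf_le_eps h0 m h1 t) H1 (by simp [hH])
    (fun t => by rw [H2, F2]) hHn
  have s1 : AE N k σ (fun x => u x * qf ε m (u x)) univ ≤
      ENNReal.ofReal (2 * 4 ^ m) ^ twoStar N σ * AE N k σ (fun x => F (u x)) univ := by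
    refine AE_lip w.hN w.hσ2 fun x => ?_
    rw [← ofReal_norm, ← ofReal_norm, ← ENNReal.ofReal_mul (by positivity)]
    refine ENNReal.ofReal_le_ofReal ?_
    have hux := w.hu0 x
    have l1 : u x / 2 * qf ε m (u x / 2) ≤ F (u x) := prim_lower hq.continuous (fun s => (qf_pos h0 m s).le) hux
      (fun s hs => qf_mono h0 m h1 (by linarith) hs)
    have l2 := qf_half h0 m (u x)
    rw [Real.norm_of_nonneg (mul_nonneg hux (qf_pos h0 m _).le), Real.norm_eq_abs]
    refine le_trans ?_ (mul_le_mul_of_nonneg_left (l1.trans (le_abs_self _)) (by positivity))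
    calc _ ≤ u x * (4 ^ m * qf ε m (u x / 2)) := by gcongr
      _ = _ := by ring
  have s2 := ENNReal.rpow_le_rpow s1 (z := 2 / twoStar N σ) (by positivity)
  rw [ENNReal.mul_rpow_of_nonneg _ _ (by positivity), ← ENNReal.rpow_mul] at s2
  have e : twoStar N σ * (2 / twoStar N σ) = 2 := by field_simp
  rw [e] at s2
  refine s2.trans (mul_le_mul_right (hb.trans (lintegral_mono fun x => ?_)) _)
  simp only
  have hux := w.hu0 x
  have l3 : H (u x) ≤ u x * qf ε m (u x) ^ 2 := prim_upper hq2.continuous hux (fun s hs hst => by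
    have := qf_mono h0 m h1 hs hst
    have := (qf_pos h0 m s).le
    gcongr)
  have l4 : ‖H (u x)‖ₑ ≤ ‖u x‖ₑ * ‖qf ε m (u x)‖ₑ ^ 2 := by
    rw [← enorm_pow, ← enorm_mul, Real.enorm_of_nonneg (hHn _ hux), Real.enorm_of_nonneg (by positivity)]
    exact ENNReal.ofReal_le_ofReal l3
  have l5 : ‖u x‖ₑ ^ twoStar N σ = ‖u x‖ₑ ^ (twoStar N σ - 1) * ‖u x‖ₑ := by
    have := ENNReal.rpow_add_of_nonneg (x := ‖u x‖ₑ) (twoStar N σ - 1) 1 (by linarith) (by norm_num)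
    rw [ENNReal.rpow_one] at this
    rw [← this]; congr 1; ring
  rw [l5]
  refine (mul_le_mul_right l4 _).trans (le_of_eq ?_)
  ring

lemma BK2 (w : WS N k σ ψ u g) {ε : ℝ} (h0 : 0 < ε) (h1 : ε ≤ 1) (m : ℕ) {K : ℝ} (hK : 0 ≤ K) :
    ∫⁻ x, wt N k σ x * ‖u x‖ₑ ^ (twoStar N σ) * ‖qf ε m (u x)‖ₑ ^ 2 ≤
      ENNReal.ofReal ((1 + K ^ 2) ^ m) ^ 2 + AE N k σ u {x | K < u x} ^ (1 - 2 / twoStar N σ) *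
        AE N k σ (fun x => u x * qf ε m (u x)) univ ^ (2 / twoStar N σ) := by
  have hp := twoStar_gt w.hN w.hσ2
  have hθ : 2 / twoStar N σ ≤ 1 := by rw [div_le_one (by linarith)]; linarith
  have hms : MeasurableSet {x | K < u x} := measurableSet_lt measurable_const w.hu
  have hqm : Measurable (fun x => qf ε m (u x)) := (qf_smooth h0 m).continuous.measurable.comp w.hu
  rw [← lintegral_add_compl _ hms, add_comm]
  refine add_le_add ?_ ?_
  · calc _ ≤ ∫⁻ x in {x | K < u x}ᶜ, ENNReal.ofReal ((1 + K ^ 2) ^ m) ^ 2 * (wt N k σ x * ‖u x‖ₑ ^ (twoStar N σ)) := by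
          refine setLIntegral_mono' hms.compl fun x hx => ?_
          rw [mul_comm]
          refine mul_le_mul_left (pow_le_pow_left₀ zero_le ?_ 2) _
          simp only [mem_compl_iff, mem_setOf_eq, not_lt] at hx
          have hux := w.hu0 x
          rw [Real.enorm_of_nonneg (qf_pos h0 m _).le]
          refine ENNReal.ofReal_le_ofReal ((qf_le h0 m _).trans ?_)
          gcongr
      _ ≤ ∫⁻ x, ENNReal.ofReal ((1 + K ^ 2) ^ m) ^ 2 * (wt N k σ x * ‖u x‖ₑ ^ (twoStar N σ)) := setLIntegral_le_lintegral _ _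
      _ = ENNReal.ofReal ((1 + K ^ 2) ^ m) ^ 2 * AE N k σ u univ := by
          rw [lintegral_const_mul' _ _ (ENNReal.pow_ne_top ENNReal.ofReal_ne_top), AE, Measure.restrict_univ]
      _ = _ := by rw [w.A_one, mul_one]
  · have hm1 : AEMeasurable (fun x => wt N k σ x * ‖u x‖ₑ ^ twoStar N σ) (volume.restrict {x | K < u x}) :=
      ((measurable_wt N k σ).mul (w.hu.enorm.pow_const _)).aemeasurable
    have hm2 : AEMeasurable (fun x => wt N k σ x * ‖u x * qf ε m (u x)‖ₑ ^ twoStar N σ) (volume.restrict {x | K < u x}) :=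
      ((measurable_wt N k σ).mul ((w.hu.mul hqm).enorm.pow_const _)).aemeasurable
    have h3 := ENNReal.lintegral_mul_norm_pow_le hm1 hm2 (p := 1 - 2 / twoStar N σ) (q := 2 / twoStar N σ)
      (by linarith) (by positivity) (by ring)
    have h4 : AE N k σ (fun x => u x * qf ε m (u x)) {x | K < u x} ≤ AE N k σ (fun x => u x * qf ε m (u x)) univ := by
      unfold AE
      rw [Measure.restrict_univ]
      exact setLIntegral_le_lintegral _ _
    refine le_trans (le_trans (le_of_eq ?_) h3) (mul_le_mul_right (ENNReal.rpow_le_rpow h4 (by positivity)) _)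
    congr 1; ext x
    have hp0 : twoStar N σ ≠ 0 := by positivity
    rw [enorm_mul, ENNReal.mul_rpow_of_nonneg _ _ (by linarith : 0 ≤ twoStar N σ), ENNReal.mul_rpow_of_nonneg _ _ (by linarith), ENNReal.mul_rpow_of_nonneg _ _ (by positivity : 0 ≤ 2 / twoStar N σ),
      ENNReal.mul_rpow_of_nonneg _ _ (by positivity : 0 ≤ 2 / twoStar N σ),
      ← ENNReal.rpow_mul, ← ENNReal.rpow_mul, ← ENNReal.rpow_mul]
    have e1 : twoStar N σ * (1 - 2 / twoStar N σ) = twoStar N σ - 2 := by field_simp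
    have e2 : twoStar N σ * (2 / twoStar N σ) = 2 := by field_simp
    rw [e1, e2]
    have e3 : wt N k σ x = wt N k σ x ^ (1 - 2 / twoStar N σ) * wt N k σ x ^ (2 / twoStar N σ) := by
      rw [← ENNReal.rpow_add_of_nonneg _ _ (by linarith) (by positivity)]; simp
    have e4 : ‖u x‖ₑ ^ twoStar N σ = ‖u x‖ₑ ^ (twoStar N σ - 2) * ‖u x‖ₑ ^ (2:ℝ) := by
      rw [← ENNReal.rpow_add_of_nonneg _ _ (by linarith) (by positivity)]; congr 1; ring
    conv_lhs => rw [e3, e4]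
    rw [ENNReal.rpow_two, ENNReal.rpow_two]
    ring

lemma tail (w : WS N k σ ψ u g) : Tendsto (fun n : ℕ => AE N k σ u {x | (n:ℝ) < u x}) atTop (𝓝 0) := by
  have hms : ∀ n : ℕ, MeasurableSet {x | (n:ℝ) < u x} := fun n => measurableSet_lt measurable_const w.hu
  have hm : Measurable (fun x => wt N k σ x * ‖u x‖ₑ ^ twoStar N σ) :=
      (measurable_wt N k σ).mul (w.hu.enorm.pow_const _)
  have h1 : Tendsto (fun n : ℕ => ∫⁻ x, ({x | (n:ℝ) < u x}).indicator (fun x => wt N k σ x * ‖u x‖ₑ ^ twoStar N σ) x)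
      atTop (𝓝 (∫⁻ x : Euc N, 0)) := by
    refine tendsto_lintegral_of_dominated_convergence (fun x => wt N k σ x * ‖u x‖ₑ ^ twoStar N σ)
      (fun n => hm.indicator (hms n)) (fun n => ae_of_all _ fun x => indicator_le_self _ _ x) ?_ ?_
    · have := w.hAt
      rwa [AE, Measure.restrict_univ] at this
    · refine ae_of_all _ fun x => ?_
      obtain ⟨n0, hn0⟩ := exists_nat_ge (u x)
      refine tendsto_const_nhds.congr' ?_
      filter_upwards [eventually_ge_atTop n0] with n hn
      rw [indicator_of_notMem]
      simp only [mem_setOf_eq, not_lt]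
      exact hn0.trans (by exact_mod_cast hn)
  simp only [lintegral_zero] at h1
  refine h1.congr fun n => ?_
  rw [lintegral_indicator (hms n)]
  rfl

lemma BK3 (w : WS N k σ ψ u g) (m : ℕ) : ∃ C : ℝ≥0∞, C ≠ ⊤ ∧ ∀ ε : ℝ, 0 < ε → ε ≤ 1 →
    AE N k σ (fun x => u x * qf ε m (u x)) univ ≤ C := by
  have hp := twoStar_gt w.hN w.hσ2
  have hθ : 2 / twoStar N σ < 1 := by rw [div_lt_one (by linarith)]; linarith
  set c := ENNReal.ofReal (2 * 4 ^ m) ^ (2:ℝ) with hc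
  have hct : c ≠ ⊤ := ENNReal.rpow_ne_top_of_nonneg (by norm_num) ENNReal.ofReal_ne_top
  have h1 := w.tail
  have h2 := (ENNReal.continuous_rpow_const (y := 1 - 2 / twoStar N σ)).tendsto _ |>.comp h1
  rw [ENNReal.zero_rpow_of_pos (by linarith)] at h2
  have h3 := ENNReal.Tendsto.const_mul (a := c) h2 (Or.inr hct)
  rw [mul_zero] at h3
  obtain ⟨n, hn⟩ := (h3.eventually (gt_mem_nhds (ENNReal.inv_pos.2 ENNReal.ofNat_ne_top : (0:ℝ≥0∞) < 2⁻¹))).exists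
  obtain ⟨K, hKd⟩ : ∃ K : ℝ, K = (n : ℝ) := ⟨_, rfl⟩
  simp only [Function.comp_def, ← hKd] at hn
  set D := c * ENNReal.ofReal ((1 + K ^ 2) ^ m) ^ 2 with hD
  have hDt : D ≠ ⊤ := ENNReal.mul_ne_top hct (ENNReal.pow_ne_top ENNReal.ofReal_ne_top)
  refine ⟨(2 * D) ^ (twoStar N σ / 2), ENNReal.rpow_ne_top_of_nonneg (by positivity) (ENNReal.mul_ne_top (by simp) hDt), ?_⟩
  intro ε h0 ε1
  set B := AE N k σ (fun x => u x * qf ε m (u x)) univ with hB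
  have hBt : B ≠ ⊤ := by
    refine ne_top_of_le_ne_top ?_ (AE_lip (u := u) (L := (1 / ε) ^ m) w.hN w.hσ2 fun x => ?_)
    · exact ENNReal.mul_ne_top (ENNReal.rpow_ne_top_of_nonneg (by linarith) ENNReal.ofReal_ne_top) w.hAt
    · rw [enorm_mul, mul_comm]
      refine mul_le_mul_left ?_ _
      rw [Real.enorm_of_nonneg (qf_pos h0 m _).le]
      exact ENNReal.ofReal_le_ofReal (qf_le_eps h0 m ε1 _)
  have h4 := (w.BK1 h0 ε1 m).trans (mul_le_mul_right (w.BK2 h0 ε1 m (K := K) (by rw [hKd]; positivity)) c)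
  rw [← hB, mul_add, ← hD, ← mul_assoc] at h4
  have hBt' : B ^ (2 / twoStar N σ) ≠ ⊤ := ENNReal.rpow_ne_top_of_nonneg (by positivity) hBt
  have h5 : B ^ (2 / twoStar N σ) ≤ 2 * D := by
    set b := B ^ (2 / twoStar N σ)
    have h6 : b ≤ D + 2⁻¹ * b := h4.trans (add_le_add le_rfl (mul_le_mul_left hn.le _))
    have h7 : b = 2⁻¹ * b + 2⁻¹ * b := by rw [← add_mul, ENNReal.inv_two_add_inv_two, one_mul]
    have h8 : 2⁻¹ * b ≤ D := by
      conv_lhs at h6 => rw [h7]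
      exact (ENNReal.add_le_add_iff_right (ENNReal.mul_ne_top (by simp) hBt')).1 h6
    calc b = 2 * (2⁻¹ * b) := by rw [← mul_assoc, ENNReal.mul_inv_cancel (by simp) (by simp), one_mul]
      _ ≤ _ := mul_le_mul_right h8 _
  have h9 := ENNReal.rpow_le_rpow h5 (z := twoStar N σ / 2) (by positivity)
  rw [← ENNReal.rpow_mul] at h9
  have e : 2 / twoStar N σ * (twoStar N σ / 2) = 1 := by field_simp
  rwa [e, ENNReal.rpow_one] at h9

lemma BK4 (w : WS N k σ ψ u g) (m : ℕ) : AE N k σ (fun x => u x * (1 + u x ^ 2) ^ m) univ ≠ ⊤ := by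
  have hp := twoStar_gt w.hN w.hσ2
  obtain ⟨C, hC, hb⟩ := w.BK3 m
  refine ne_top_of_le_ne_top hC ?_
  set e : ℕ → ℝ := fun n => 1 / ((n:ℝ) + 1) with he
  have he0 : ∀ n, 0 < e n := fun n => by rw [he]; positivity
  have he1 : ∀ n, e n ≤ 1 := fun n => by
    rw [he]; simp only; rw [div_le_one (by positivity)]; linarith [(Nat.cast_nonneg n : (0:ℝ) ≤ n)]
  have het : Tendsto e atTop (𝓝 0) := tendsto_one_div_add_atTop_nhds_zero_nat
  have hm : ∀ n, Measurable (fun x => wt N k σ x * ‖u x * qf (e n) m (u x)‖ₑ ^ twoStar N σ) := fun n => by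
    have : Measurable (fun x => qf (e n) m (u x)) := (qf_smooth (he0 n) m).continuous.measurable.comp w.hu
    exact (measurable_wt N k σ).mul ((w.hu.mul this).enorm.pow_const _)
  have hlim : ∀ x, Tendsto (fun n => wt N k σ x * ‖u x * qf (e n) m (u x)‖ₑ ^ twoStar N σ) atTop
      (𝓝 (wt N k σ x * ‖u x * (1 + u x ^ 2) ^ m‖ₑ ^ twoStar N σ)) := by
    intro x
    have l1 : Tendsto (fun n => qf (e n) m (u x)) atTop (𝓝 ((1 + u x ^ 2) ^ m)) := by
      unfold qf
      have : Tendsto (fun n => (1 + u x ^ 2) / (1 + e n * u x ^ 2)) atTop (𝓝 ((1 + u x ^ 2) / (1 + 0 * u x ^ 2))) :=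
        tendsto_const_nhds.div ((het.mul_const _).const_add _) (by simp)
      have := this.pow m
      simpa using this
    have l2 := ((ENNReal.continuous_rpow_const (y := twoStar N σ)).tendsto _).comp (l1.const_mul (u x)).enorm
    exact ENNReal.Tendsto.const_mul l2 (Or.inr (wt_ne_top x))
  calc AE N k σ (fun x => u x * (1 + u x ^ 2) ^ m) univ
      = ∫⁻ x, liminf (fun n => wt N k σ x * ‖u x * qf (e n) m (u x)‖ₑ ^ twoStar N σ) atTop := by
        rw [AE, Measure.restrict_univ]
        congr 1; ext x
        exact (hlim x).liminf_eq.symm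
    _ ≤ liminf (fun n => ∫⁻ x, wt N k σ x * ‖u x * qf (e n) m (u x)‖ₑ ^ twoStar N σ) atTop := lintegral_liminf_le hm
    _ ≤ C := by
        refine liminf_le_of_le (by isBoundedDefault) fun b hb' => ?_
        obtain ⟨n, hn⟩ := hb'.exists
        refine hn.trans ?_
        have := hb (e n) (he0 n) (he1 n)
        rwa [AE, Measure.restrict_univ] at this

end WS


/-- Mollifier kernels: `ρ` and `κ` with `∇ κ (x) = - ρ(x) x`. -/
structure Ker (N : ℕ) (ρ κ : Euc N → ℝ) : Prop where
  sr : Sm ρ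
  sk : Sm κ
  r0 : ∀ x, 0 ≤ ρ x
  r1 : ∀ x, ρ x ≤ 1
  rz : ∀ x, 1 ≤ ‖x‖ → ρ x = 0
  ro : ∀ x, ‖x‖ ≤ 1 / 2 → ρ x = 1
  k0 : ∀ x, 0 ≤ κ x
  kz : ∀ x, 1 ≤ ‖x‖ → κ x = 0
  kd : ∀ x v, fderiv ℝ κ x v = - ρ x * inner ℝ x v

lemma exists_ker (N : ℕ) : ∃ ρ κ : Euc N → ℝ, Ker N ρ κ := by
  let b : ContDiffBump (0:ℝ) := ⟨1/2, 1, by norm_num, by norm_num⟩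
  have hb : ContDiff ℝ (⊤ : ℕ∞) (b : ℝ → ℝ) := b.contDiff
  have hbc : Continuous (b : ℝ → ℝ) := hb.continuous
  have hbz : ∀ t : ℝ, 1 ≤ t → b t = 0 := fun t ht => b.zero_of_le_dist (by
    rw [dist_zero_right, Real.norm_eq_abs]; exact ht.trans (le_abs_self t))
  obtain ⟨p1, p2⟩ := prim_smooth hb
  set I := fun t => ∫ s in (0:ℝ)..t, b s with hI
  set B : ℝ → ℝ := fun t => (1/2) * (I 1 - I t) with hB
  have hB1 : ContDiff ℝ (⊤ : ℕ∞) B := contDiff_const.mul (contDiff_const.sub p1)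
  have hBd : ∀ t, HasDerivAt B (- (1/2) * b t) t := fun t => by
    have h1 : HasDerivAt I (b t) t := by
      rw [← p2 t]; exact (p1.differentiable (by simp)).differentiableAt.hasDerivAt
    have h2 : HasDerivAt B _ t := (h1.const_sub (I 1)).const_mul (1/2)
    convert h2 using 1; ring
  have hBe : ∀ t, B t = (1/2) * ∫ s in t..1, b s := fun t => by
    rw [hB, hI]; simp only
    rw [intervalIntegral.integral_interval_sub_left (hbc.intervalIntegrable _ _) (hbc.intervalIntegrable _ _)]
  have hBz : ∀ t, 1 ≤ t → B t = 0 := fun t ht => by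
    rw [hBe, intervalIntegral.integral_symm]
    have : ∫ s in (1:ℝ)..t, b s = ∫ s in (1:ℝ)..t, (0:ℝ) := intervalIntegral.integral_congr fun s hs => by
      rw [uIcc_of_le ht] at hs
      exact hbz s hs.1
    rw [this]; simp
  have hB0 : ∀ t, 0 ≤ B t := fun t => by
    rcases le_total 1 t with h | h
    · rw [hBz t h]
    · rw [hBe]
      exact mul_nonneg (by norm_num) (intervalIntegral.integral_nonneg h fun s _ => b.nonneg)
  have hns : ContDiff ℝ (⊤ : ℕ∞) (fun x : Euc N => ‖x‖ ^ 2) := contDiff_norm_sq ℝ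
  have hsq : ∀ x : Euc N, 1 ≤ ‖x‖ → 1 ≤ ‖x‖ ^ 2 := fun x hx => one_le_pow₀ hx
  have hcs : ∀ f : Euc N → ℝ, (∀ x, 1 ≤ ‖x‖ → f x = 0) → HasCompactSupport f := fun f hf =>
    HasCompactSupport.intro (isCompact_closedBall (0 : Euc N) 1) fun x hx => hf x (by
      rw [mem_closedBall, dist_zero_right, not_le] at hx; exact hx.le)
  refine ⟨fun x => b (‖x‖ ^ 2), fun x => B (‖x‖ ^ 2), ⟨hb.comp hns, ?_⟩, ⟨hB1.comp hns, ?_⟩, fun x => b.nonneg,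
    fun x => b.le_one, fun x hx => hbz _ (hsq x hx), fun x hx => ?_, fun x => hB0 _, fun x hx => hBz _ (hsq x hx), fun x v => ?_⟩
  · exact hcs _ fun x hx => hbz _ (hsq x hx)
  · exact hcs _ fun x hx => hBz _ (hsq x hx)
  · refine b.one_of_mem_closedBall ?_
    rw [mem_closedBall, dist_zero_right, Real.norm_of_nonneg (by positivity)]
    show ‖x‖ ^ 2 ≤ 1 / 2
    nlinarith [norm_nonneg x]
  · have h1 : HasFDerivAt (fun x : Euc N => ‖x‖ ^ 2) _ x := (hasFDerivAt_id x).norm_sq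
    have h2 := ((hBd (‖x‖ ^ 2)).comp_hasFDerivAt x h1).fderiv
    have h3 : (fun x : Euc N => B (‖x‖ ^ 2)) = B ∘ (fun x => ‖x‖ ^ 2) := rfl
    rw [h3, h2]
    simp
    ring

namespace Ker
variable {N : ℕ} {ρ κ : Euc N → ℝ}

lemma grad_eta (K : Ker N ρ κ) {s : ℝ} (hs : 0 < s) (x y v : Euc N) :
    inner ℝ v (gradient (fun y => κ (s⁻¹ • (x - y))) y) = s⁻¹ * (ρ (s⁻¹ • (x - y)) * inner ℝ v (s⁻¹ • (x - y))) := by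
  rw [real_inner_comm, grad_eq]
  have h1 : HasFDerivAt (fun y : Euc N => s⁻¹ • (x - y)) (s⁻¹ • (-ContinuousLinearMap.id ℝ (Euc N))) y :=
    ((hasFDerivAt_id y).const_sub x).const_smul s⁻¹
  have h2 := ((K.sk.diff (s⁻¹ • (x - y))).hasFDerivAt.comp y h1).fderiv
  have h3 : (fun y : Euc N => κ (s⁻¹ • (x - y))) = κ ∘ (fun y => s⁻¹ • (x - y)) := rfl
  rw [h3, h2]
  simp only [ContinuousLinearMap.comp_apply, ContinuousLinearMap.smul_apply, ContinuousLinearMap.neg_apply,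
    ContinuousLinearMap.id_apply, map_smul, map_neg, K.kd, smul_eq_mul]
  rw [inner_smul_right, inner_neg_right, real_inner_comm v]; ring

lemma rho_norm (K : Ker N ρ κ) (X : Euc N) : ρ X * ‖X‖ ≤ 1 := by
  rcases le_total 1 ‖X‖ with h | h
  · rw [K.rz X h]; simp
  · have := K.r0 X; have := K.r1 X
    nlinarith [norm_nonneg X]

lemma grad_bd (K : Ker N ρ κ) {s : ℝ} (hs : 0 < s) (x y : Euc N) :
    ‖gradient (fun y => κ (s⁻¹ • (x - y))) y‖ ≤ s⁻¹ := by
  set w := gradient (fun y => κ (s⁻¹ • (x - y))) y with hw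
  rcases eq_or_ne w 0 with h | h
  · rw [h, norm_zero]; positivity
  have h1 := K.grad_eta hs x y w
  rw [← hw, real_inner_self_eq_norm_sq] at h1
  have h2 := real_inner_le_norm w (s⁻¹ • (x - y))
  have h3 := K.rho_norm (s⁻¹ • (x - y))
  have h4 := K.r0 (s⁻¹ • (x - y))
  have hw0 : 0 < ‖w‖ := norm_pos_iff.2 h
  have hs' : 0 < s⁻¹ := by positivity
  have h5 : ‖w‖ ^ 2 ≤ s⁻¹ * ‖w‖ := by
    rw [h1]
    have : ρ (s⁻¹ • (x - y)) * inner ℝ w (s⁻¹ • (x - y)) ≤ ‖w‖ := by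
      calc _ ≤ ρ (s⁻¹ • (x - y)) * (‖w‖ * ‖s⁻¹ • (x - y)‖) := by gcongr
        _ = ‖w‖ * (ρ (s⁻¹ • (x - y)) * ‖s⁻¹ • (x - y)‖) := by ring
        _ ≤ ‖w‖ * 1 := by gcongr
        _ = _ := mul_one _
    gcongr
  nlinarith

lemma out {s : ℝ} (hs : 0 < s) {x y : Euc N} (h : s ≤ dist y x) : 1 ≤ ‖s⁻¹ • (x - y)‖ := by
  rw [norm_smul, norm_inv, Real.norm_of_nonneg hs.le, ← dist_eq_norm, dist_comm, ← div_eq_inv_mul, le_div_iff₀ hs]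
  linarith

lemma grad_zero (K : Ker N ρ κ) {s : ℝ} (hs : 0 < s) (x y : Euc N) (h : s ≤ dist y x) :
    gradient (fun y => κ (s⁻¹ • (x - y))) y = 0 := by
  have h1 := K.grad_eta hs x y (gradient (fun y => κ (s⁻¹ • (x - y))) y)
  rw [K.rz _ (out hs h), zero_mul, mul_zero] at h1
  exact inner_self_eq_zero.1 h1

lemma k_lip (K : Ker N ρ κ) (x y : Euc N) : |κ x - κ y| ≤ ‖x - y‖ := by
  have h : LipschitzWith 1 κ := by
    refine lipschitzWith_of_nnnorm_fderiv_le K.sk.diff fun x => ?_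
    rw [← NNReal.coe_le_coe, coe_nnnorm]
    refine ContinuousLinearMap.opNorm_le_bound _ (by simp) fun v => ?_
    rw [K.kd, norm_mul, norm_neg, Real.norm_of_nonneg (K.r0 x)]
    calc _ ≤ ρ x * (‖x‖ * ‖v‖) := mul_le_mul_of_nonneg_left (norm_inner_le_norm _ _) (K.r0 x)
      _ = (ρ x * ‖x‖) * ‖v‖ := by ring
      _ ≤ 1 * ‖v‖ := by gcongr; exact K.rho_norm x
      _ = _ := by simp
  have := h.dist_le_mul x y
  rwa [NNReal.coe_one, one_mul, Real.dist_eq, dist_eq_norm] at this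

lemma cov {s : ℝ} (hs : 0 < s) (x : Euc N) (G : Euc N → ℝ) :
    ∫ X, G X = (s ^ N)⁻¹ * ∫ y, G (s⁻¹ • (x - y)) := by
  have h1 := Measure.integral_comp_smul (volume : Measure (Euc N)) (fun Y => G (s⁻¹ • Y)) s
  have h2 := integral_sub_left_eq_self (fun y => G (s⁻¹ • (x - (x - y)))) (volume : Measure (Euc N)) x
  simp only [sub_sub_cancel] at h2
  rw [← h2, smul_eq_mul, abs_of_nonneg (by positivity), finrank_euclideanSpace_fin] at h1
  rw [← h1]
  congr 1; ext X
  rw [smul_smul, inv_mul_cancel₀ hs.ne', one_smul]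

lemma Mo_deriv (K : Ker N ρ κ) {φ : Euc N → ℝ} (hφ : Sm φ) (x : Euc N) {s : ℝ} (hs : 0 < s) :
    HasDerivAt (fun s => Mo ρ s φ x)
      (- ((s ^ N)⁻¹ * (s * ∫ y, inner ℝ (gradient φ y) (gradient (fun y => κ (s⁻¹ • (x - y))) y)))) s := by
  obtain ⟨C, hC⟩ := hφ.contG.bounded_above_of_compact_support hφ.supG
  have hC0 : 0 ≤ C := (norm_nonneg _).trans (hC 0)
  have hcx : ∀ s : ℝ, Continuous (fun X : Euc N => x - s • X) := fun s => by fun_prop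
  have key := hasDerivAt_integral_of_dominated_loc_of_deriv_le (μ := (volume : Measure (Euc N)))
    (F := fun s X => ρ X * φ (x - s • X)) (x₀ := s) (s := univ) (bound := fun X => C * (ρ X * ‖X‖))
    (F' := fun s X => ρ X * (- inner ℝ (gradient φ (x - s • X)) X)) univ_mem
    (Eventually.of_forall fun t => (K.sr.cont.mul (hφ.cont.comp (hcx t))).aestronglyMeasurable)
    ((K.sr.cont.mul (hφ.cont.comp (hcx s))).integrable_of_hasCompactSupport K.sr.2.mul_right)
    (K.sr.cont.mul ((hφ.contG.comp (hcx s)).inner continuous_id).neg).aestronglyMeasurable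
    (ae_of_all _ fun X t _ => ?_)
    (((K.sr.cont.mul continuous_norm).integrable_of_hasCompactSupport K.sr.2.mul_right).const_mul C)
    (ae_of_all _ fun X t _ => ?_)
  · have h1 := key.2
    have h2 : ∫ X, ρ X * (- inner ℝ (gradient φ (x - s • X)) X) =
        - ((s ^ N)⁻¹ * (s * ∫ y, inner ℝ (gradient φ y) (gradient (fun y => κ (s⁻¹ • (x - y))) y))) := by
      rw [cov hs x, ← integral_const_mul, ← integral_const_mul, ← integral_const_mul, ← integral_neg]
      congr 1; ext y
      rw [K.grad_eta hs, smul_smul, mul_inv_cancel₀ hs.ne', one_smul, sub_sub_cancel]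
      field_simp
    rw [h2] at h1
    refine h1.congr_of_eventuallyEq ?_
    filter_upwards [lt_mem_nhds hs] with t ht
    exact Mo_eq ht φ x
  · rw [norm_mul, norm_neg, Real.norm_of_nonneg (K.r0 X)]
    calc _ ≤ ρ X * (‖gradient φ (x - t • X)‖ * ‖X‖) := mul_le_mul_of_nonneg_left (norm_inner_le_norm _ _) (K.r0 X)
      _ ≤ ρ X * (C * ‖X‖) := mul_le_mul_of_nonneg_left (mul_le_mul_of_nonneg_right (hC _) (norm_nonneg _)) (K.r0 X)
      _ = _ := by ring
  · have h1 : HasDerivAt (fun t : ℝ => x - t • X) (-X) t := by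
      have := ((hasDerivAt_id t).smul_const X).const_sub x
      simpa using this
    have h2 := (hφ.diff (x - t • X)).hasFDerivAt.comp_hasDerivAt t h1
    have h3 := h2.const_mul (ρ X)
    simp only [map_neg] at h3
    rw [grad_eq]
    exact h3

end Ker


/-- `L^q` convergence implies `L^1` convergence on balls. -/
lemma L1_ball {N : ℕ} {F : Type*} [NormedAddCommGroup F] {h : ℕ → Euc N → F} {q : ℝ≥0∞} (hq : 1 ≤ q)
    (hm : ∀ j, AEStronglyMeasurable (h j) volume) (hL : Tendsto (fun j => eLpNorm (h j) q volume) atTop (𝓝 0))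
    (x : Euc N) (R : ℝ) : Tendsto (fun j => eLpNorm (h j) 1 (volume.restrict (closedBall x R))) atTop (𝓝 0) := by
  set c : ℝ≥0∞ := (volume.restrict (closedBall x R)) univ ^ (1 / (1:ℝ≥0∞).toReal - 1 / q.toReal) with hc
  have hct : c ≠ ⊤ := by
    refine ENNReal.rpow_ne_top_of_nonneg ?_ ?_
    · rcases eq_or_ne q ⊤ with h | h
      · simp [h]
      · have : 1 ≤ q.toReal := by
          rw [← ENNReal.toReal_one]; exact (ENNReal.toReal_le_toReal (by simp) h).2 hq
        have : 1 / q.toReal ≤ 1 := by rw [div_le_one (by linarith)]; exact this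
        simpa using this
    · rw [Measure.restrict_apply_univ]; exact (isCompact_closedBall x R).measure_lt_top.ne
  have h2 : Tendsto (fun j => eLpNorm (h j) q volume * c) atTop (𝓝 0) := by
    have := ENNReal.Tendsto.mul_const (b := c) hL (Or.inr hct)
    rwa [zero_mul] at this
  refine tendsto_of_tendsto_of_tendsto_of_le_of_le tendsto_const_nhds h2 (fun j => zero_le) fun j => ?_
  calc _ ≤ eLpNorm (h j) q (volume.restrict (closedBall x R)) * c :=
        eLpNorm_le_eLpNorm_mul_rpow_measure_univ hq (hm j).restrict
    _ ≤ _ := mul_le_mul_left (eLpNorm_restrict_le _ _ _ _) _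

lemma bnd_int {N : ℕ} {F : Type*} [NormedAddCommGroup F] {h : Euc N → F} {G : Euc N → ℝ} {M : ℝ} (hM : 0 ≤ M) {B : Set (Euc N)}
    (hB : MeasurableSet B) (h1 : ∀ y, ‖G y‖ ≤ M * ‖h y‖) (h2 : ∀ y, y ∉ B → G y = 0)
    (ht : eLpNorm h 1 (volume.restrict B) ≠ ⊤) :
    |∫ y, G y| ≤ M * (eLpNorm h 1 (volume.restrict B)).toReal := by
  have h3 : ∫ y, G y = ∫ y in B, G y := (setIntegral_eq_integral_of_forall_compl_eq_zero fun y hy => h2 y hy).symm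
  rw [h3]
  have h4 : ‖∫ y in B, G y‖ₑ ≤ ENNReal.ofReal M * eLpNorm h 1 (volume.restrict B) := by
    refine (enorm_integral_le_lintegral_enorm _).trans ?_
    rw [eLpNorm_one_eq_lintegral_enorm, ← lintegral_const_mul' _ _ ENNReal.ofReal_ne_top]
    refine lintegral_mono fun y => ?_
    rw [← ofReal_norm, ← ofReal_norm, ← ENNReal.ofReal_mul hM]
    exact ENNReal.ofReal_le_ofReal (h1 y)
  have h5 := (ENNReal.toReal_le_toReal (by simp) (ENNReal.mul_ne_top ENNReal.ofReal_ne_top ht)).2 h4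
  rwa [ENNReal.toReal_mul, ENNReal.toReal_ofReal hM, toReal_enorm, Real.norm_eq_abs] at h5

lemma int_inner {N : ℕ} {g c : Euc N → Euc N} (hg : MemLp g 2 volume) (hc : MemLp c 2 volume) :
    Integrable (fun x => inner ℝ (g x) (c x)) volume := by
  have h := (hg.norm).integrable_mul hc.norm
  refine h.mono' (hg.1.inner hc.1) (ae_of_all _ fun x => ?_)
  exact norm_inner_le_norm _ _

namespace WS
variable {N k : ℕ} {σ : ℝ} {ψ : ℕ → Euc N → ℝ} {u : Euc N → ℝ} {g : Euc N → Euc N}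

lemma q_one (w : WS N k σ ψ u g) : 1 ≤ ENNReal.ofReal (2 * (N : ℝ) / ((N : ℝ) - 2)) := by
  have h3 : (3:ℝ) ≤ N := by exact_mod_cast w.hN
  rw [ENNReal.one_le_ofReal, le_div_iff₀ (by linarith)]
  linarith

lemma mem_u (w : WS N k σ ψ u g) : MemLp u (ENNReal.ofReal (2 * (N : ℝ) / ((N : ℝ) - 2))) volume := by
  have h1 := w.hLu.eventually (gt_mem_nhds (zero_lt_one))
  obtain ⟨n, hn⟩ := h1.exists
  have h2 : MemLp (fun x => u x - ψ n x) (ENNReal.ofReal (2 * (N : ℝ) / ((N : ℝ) - 2))) volume :=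
    ⟨(w.hu.sub (w.hψ n).cont.measurable).aestronglyMeasurable, hn.trans ENNReal.one_lt_top⟩
  have h3 := h2.add ((w.hψ n).mem _)
  refine h3.ae_eq (ae_of_all _ fun x => ?_)
  simp

lemma loc_u (w : WS N k σ ψ u g) : LocallyIntegrable u volume := w.mem_u.locallyIntegrable w.q_one

lemma u_int (w : WS N k σ ψ u g) {η : Euc N → ℝ} (hη : Continuous η) (hc : HasCompactSupport η) :
    Integrable (fun x => η x * u x) volume := by
  have := w.loc_u.integrable_smul_left_of_hasCompactSupport hη hc
  simpa using this

lemma u_L1 (w : WS N k σ ψ u g) (x : Euc N) (R : ℝ) :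
    Tendsto (fun j => eLpNorm (fun x => u x - ψ j x) 1 (volume.restrict (closedBall x R))) atTop (𝓝 0) :=
  L1_ball w.q_one (fun j => (w.hu.sub (w.hψ j).cont.measurable).aestronglyMeasurable) w.hLu x R

lemma g_L1 (w : WS N k σ ψ u g) (x : Euc N) (R : ℝ) :
    Tendsto (fun j => eLpNorm (fun x => g x - gradient (ψ j) x) 1 (volume.restrict (closedBall x R))) atTop (𝓝 0) :=
  L1_ball (by norm_num) (fun j => w.hg.1.sub (w.hψ j).contG.aestronglyMeasurable) w.hLg x R

lemma conv_test (w : WS N k σ ψ u g) {η : Euc N → ℝ} (hη : Continuous η) (hc : HasCompactSupport η) :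
    Tendsto (fun j => ∫ y, η y * ψ j y) atTop (𝓝 (∫ y, η y * u y)) := by
  obtain ⟨M, hM⟩ := hη.bounded_above_of_compact_support hc
  have hM0 : 0 ≤ M := (norm_nonneg _).trans (hM 0)
  obtain ⟨R, hR⟩ := hc.isCompact.isBounded.subset_closedBall (0 : Euc N)
  have h1 := w.u_L1 0 R
  have h2 : Tendsto (fun j => M * (eLpNorm (fun x => u x - ψ j x) 1 (volume.restrict (closedBall 0 R))).toReal) atTop (𝓝 0) := by
    have := ((ENNReal.tendsto_toReal ENNReal.zero_ne_top).comp h1).const_mul M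
    simpa using this
  rw [tendsto_iff_dist_tendsto_zero]
  refine squeeze_zero' (Eventually.of_forall fun j => dist_nonneg) ?_ h2
  filter_upwards [h1.eventually (gt_mem_nhds (zero_lt_one))] with j hj
  have hi : Integrable (fun y => η y * ψ j y) volume :=
    (hη.mul (w.hψ j).cont).integrable_of_hasCompactSupport hc.mul_right
  rw [dist_comm, Real.dist_eq, ← integral_sub (w.u_int hη hc) hi]
  refine bnd_int hM0 isClosed_closedBall.measurableSet (fun y => ?_) (fun y hy => ?_) (hj.trans ENNReal.one_lt_top).ne
  · rw [← mul_sub, norm_mul]; gcongr; exact hM y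
  · have : η y = 0 := image_eq_zero_of_notMem_tsupport fun h => hy (hR h)
    simp [this]

/-- The right hand side of the Euler-Lagrange equation. -/
def rhs (N k : ℕ) (σ : ℝ) (u : Euc N → ℝ) (x : Euc N) : ℝ :=
  (SS N k σ).toReal * (wr N k σ x * u x ^ (twoStar N σ - 1))

lemma rhs_nonneg (w : WS N k σ ψ u g) (x : Euc N) : 0 ≤ rhs N k σ u x :=
  mul_nonneg ENNReal.toReal_nonneg (mul_nonneg (wr_nonneg x) (Real.rpow_nonneg (w.hu0 x) _))

lemma rhs_meas (w : WS N k σ ψ u g) : Measurable (rhs N k σ u) :=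
  ((wr_meas N k σ).mul (w.hu.pow_const _)).const_mul _

lemma rhs_int (w : WS N k σ ψ u g) {η : Euc N → ℝ} (hη : Sm η) : Integrable (fun x => rhs N k σ u x * η x) volume := by
  have := (nl_int w.hN w.hk w.hσ.le w.hσ2 w.hu w.hu0 w.hAt hη).const_mul (SS N k σ).toReal
  refine this.congr (ae_of_all _ fun x => ?_)
  simp only [rhs]; ring

lemma EL_rhs (w : WS N k σ ψ u g) {η : Euc N → ℝ} (hη : Sm η) :
    ∫ x, inner ℝ (g x) (gradient η x) = ∫ x, rhs N k σ u x * η x := by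
  rw [w.hEL η hη, ← integral_const_mul]
  congr 1; ext x; simp only [rhs]; ring

lemma Mo_deriv (w : WS N k σ ψ u g) {ρ κ : Euc N → ℝ} (K : Ker N ρ κ) (x : Euc N) {s : ℝ} (hs : 0 < s) :
    HasDerivAt (fun s => Mo ρ s u x)
      (- ((s ^ N)⁻¹ * (s * ∫ y, rhs N k σ u y * κ (s⁻¹ • (x - y))))) s := by
  rw [← w.EL_rhs (ker_sm K.sk hs x)]
  have h1 := w.g_L1 x (2 * s)
  set e : ℕ → ℝ := fun j => (eLpNorm (fun x => g x - gradient (ψ j) x) 1 (volume.restrict (closedBall x (2 * s)))).toReal with he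
  have he0 : Tendsto (fun j => ((s/2)^N)⁻¹ * e j) atTop (𝓝 0) := by
    have := ((ENNReal.tendsto_toReal ENNReal.zero_ne_top).comp h1).const_mul ((s/2)^N)⁻¹
    simpa using this
  refine hasDerivAt_of_tendstoUniformlyOn (l := atTop) (s := Ioo (s/2) (2*s)) isOpen_Ioo
    (f := fun j s => Mo ρ s (ψ j) x)
    (f' := fun j s => - ((s ^ N)⁻¹ * (s * ∫ y, inner ℝ (gradient (ψ j) y) (gradient (fun y => κ (s⁻¹ • (x - y))) y))))
    (g' := fun s => - ((s ^ N)⁻¹ * (s * ∫ y, inner ℝ (g y) (gradient (fun y => κ (s⁻¹ • (x - y))) y))))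
    ?_ (Eventually.of_forall fun j t ht => K.Mo_deriv (w.hψ j) x (by linarith [ht.1])) (fun t ht => ?_)
    ⟨by linarith, by linarith⟩
  · rw [Metric.tendstoUniformlyOn_iff]
    intro ε hε
    filter_upwards [he0.eventually (gt_mem_nhds hε), h1.eventually (gt_mem_nhds (zero_lt_one))] with j hj hj1 t ht
    have ht0 : 0 < t := by linarith [ht.1]
    have hη := ker_sm K.sk ht0 x
    refine lt_of_le_of_lt ?_ hj
    rw [Real.dist_eq, neg_sub_neg, ← mul_sub, ← mul_sub, ← integral_sub (int_inner ((w.hψ j).memG 2) (hη.memG 2))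
      (int_inner w.hg (hη.memG 2)), abs_mul, abs_mul, abs_of_pos ht0, abs_of_pos (by positivity)]
    have hb := bnd_int (h := fun x => g x - gradient (ψ j) x) (M := t⁻¹) (B := closedBall x (2*s))
      (G := fun y => inner ℝ (gradient (ψ j) y) (gradient (fun y => κ (t⁻¹ • (x - y))) y) -
         inner ℝ (g y) (gradient (fun y => κ (t⁻¹ • (x - y))) y)) (by positivity)
      isClosed_closedBall.measurableSet (fun y => ?_) (fun y hy => ?_) (hj1.trans ENNReal.one_lt_top).ne
    · calc _ ≤ (t^N)⁻¹ * (t * (t⁻¹ * e j)) := by gcongr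
        _ = (t^N)⁻¹ * e j := by field_simp
        _ ≤ _ := by
          have : 0 ≤ e j := ENNReal.toReal_nonneg
          gcongr
          exact ht.1.le
    · rw [← inner_sub_left]
      refine (norm_inner_le_norm _ _).trans ?_
      rw [norm_sub_rev, mul_comm]
      gcongr
      exact K.grad_bd ht0 x y
    · rw [mem_closedBall, not_le] at hy
      rw [K.grad_zero ht0 x y (by linarith [ht.2])]; simp
  · have ht0 : 0 < t := by linarith [ht.1]
    have := (w.conv_test (ker_sm K.sr ht0 x).cont (ker_sm K.sr ht0 x).2).const_mul (t^N)⁻¹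
    exact this

lemma Mo_anti (w : WS N k σ ψ u g) {ρ κ : Euc N → ℝ} (K : Ker N ρ κ) (x : Euc N) :
    AntitoneOn (fun s => Mo ρ s u x) (Ioi 0) := by
  refine antitoneOn_of_deriv_nonpos (convex_Ioi 0)
    (fun s hs => (w.Mo_deriv K x hs).continuousAt.continuousWithinAt)
    (fun s hs => ?_) (fun s hs => ?_)
  · rw [interior_Ioi] at hs
    exact (w.Mo_deriv K x hs).differentiableAt.differentiableWithinAt
  · rw [interior_Ioi] at hs
    rw [(w.Mo_deriv K x hs).deriv]
    have hs0 : 0 < s := hs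
    have : 0 ≤ ∫ y, rhs N k σ u y * κ (s⁻¹ • (x - y)) := integral_nonneg fun y => mul_nonneg (w.rhs_nonneg y) (K.k0 _)
    have : 0 ≤ (s ^ N)⁻¹ * (s * ∫ y, rhs N k σ u y * κ (s⁻¹ • (x - y))) := by positivity
    linarith

lemma Mo_nonneg (w : WS N k σ ψ u g) {ρ κ : Euc N → ℝ} (K : Ker N ρ κ) (x : Euc N) {s : ℝ} (hs : 0 < s) : 0 ≤ Mo ρ s u x :=
  mul_nonneg (by positivity) (integral_nonneg fun y => mul_nonneg (K.r0 _) (w.hu0 y))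

lemma Mo_pos (w : WS N k σ ψ u g) {ρ κ : Euc N → ℝ} (K : Ker N ρ κ) (x : Euc N) {a : ℝ} (ha : 0 < a) : 0 < Mo ρ a u x := by
  by_contra hcon
  -- then Mo vanishes for all larger radii
  have h0 : ∀ s, a ≤ s → ∫ y, ρ (s⁻¹ • (x - y)) * u y = 0 := fun s hs => by
    have hs0 : 0 < s := by linarith
    have h1 : Mo ρ s u x ≤ Mo ρ a u x := w.Mo_anti K x ha hs0 hs
    have h2 := w.Mo_nonneg K x hs0
    have h3 : Mo ρ s u x = 0 := by linarith
    unfold Mo at h3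
    rcases mul_eq_zero.1 h3 with h | h
    · have : (s^N)⁻¹ ≠ 0 := by positivity
      exact absurd h this
    · exact h
  refine w.hne ?_
  have h4 : ∀ n : ℕ, ∀ᵐ y, ρ ((a + n)⁻¹ • (x - y)) * u y = 0 := fun n => by
    have hn : (0:ℝ) ≤ n := by positivity
    have hs0 : 0 < a + n := by linarith
    have hη := ker_sm K.sr hs0 x
    have := (integral_eq_zero_iff_of_nonneg (fun y => mul_nonneg (K.r0 _) (w.hu0 y)) (w.u_int hη.cont hη.2)).1
      (h0 (a + n) (by linarith))
    exact this
  filter_upwards [ae_all_iff.2 h4] with y hy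
  obtain ⟨n, hn⟩ := exists_nat_gt (2 * ‖x - y‖)
  have h5 := hy n
  rw [K.ro _ ?_, one_mul] at h5
  · exact h5
  · rw [norm_smul, norm_inv, Real.norm_of_nonneg (by positivity), ← div_eq_inv_mul, div_le_iff₀ (by positivity)]
    linarith

end WS


lemma pow_young {f l : ℝ} (hf : 0 ≤ f) (hl : 0 < l) (m : ℕ) : f ≤ l + f ^ (m + 1) * (l ^ m)⁻¹ := by
  rcases le_total f l with h | h
  · have : 0 ≤ f ^ (m + 1) * (l ^ m)⁻¹ := by positivity
    linarith
  · have h1 : l ^ m ≤ f ^ m := by gcongr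
    have h2 : f ≤ f ^ (m + 1) * (l ^ m)⁻¹ := by
      rw [← div_eq_mul_inv, le_div_iff₀ (by positivity), pow_succ']
      gcongr
    linarith

namespace WS
variable {N k : ℕ} {σ : ℝ} {ψ : ℕ → Euc N → ℝ} {u : Euc N → ℝ} {g : Euc N → Euc N}

lemma rhs_high (w : WS N k σ ψ u g) (x0 : Euc N) {d : ℝ} (hd : 0 < d) (hz : zNorm N k x0 = 4 * d) :
    IntegrableOn (fun y => rhs N k σ u y ^ (2 * N)) (closedBall x0 (2 * d)) volume := by
  have hp := twoStar_gt w.hN w.hσ2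
  set v : Euc N → ℝ := fun x => u x * (1 + u x ^ 2) ^ N with hv
  have hvm : Measurable v := w.hu.mul (((w.hu.pow_const 2).const_add 1).pow_const N)
  have hI := AE_int w.hN w.hσ2 hvm (w.BK4 N)
  set S := (SS N k σ).toReal
  have hS : 0 ≤ S := ENNReal.toReal_nonneg
  set A := (2 * d) ^ (-σ) with hA
  set a := (6 * d) ^ (-σ) with ha
  have hA0 : 0 < A := Real.rpow_pos_of_pos (by positivity) _
  have ha0 : 0 < a := Real.rpow_pos_of_pos (by positivity) _
  have hc : IntegrableOn (fun _ : Euc N => (1:ℝ)) (closedBall x0 (2 * d)) volume :=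
    integrableOn_const (isCompact_closedBall x0 (2*d)).measure_lt_top.ne
  have h1 : IntegrableOn (fun y => (S * A) ^ (2 * N) * (1 + a⁻¹ * (wr N k σ y * |v y| ^ twoStar N σ)))
      (closedBall x0 (2 * d)) volume := (hc.add (hI.integrableOn.const_mul a⁻¹)).const_mul _
  refine Integrable.mono' h1 (w.rhs_meas.pow_const _).aestronglyMeasurable ?_
  refine (ae_restrict_iff' isClosed_closedBall.measurableSet).2 (ae_of_all _ fun y hy => ?_)
  have hu := w.hu0 y
  rw [mem_closedBall, dist_eq_norm] at hy
  have hz1 := abs_le.1 (zNorm_sub_le (k := k) y x0)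
  have hz2 : 2 * d ≤ zNorm N k y := by linarith [hz1.1]
  have hz3 : zNorm N k y ≤ 6 * d := by linarith [hz1.2]
  have hw1 : wr N k σ y ≤ A := Real.rpow_le_rpow_of_nonpos (by positivity) hz2 (by linarith [w.hσ])
  have hw2 : a ≤ wr N k σ y := Real.rpow_le_rpow_of_nonpos (by linarith) hz3 (by linarith [w.hσ])
  have hw0 := wr_nonneg (k := k) (σ := σ) y
  rw [Real.norm_of_nonneg (pow_nonneg (w.rhs_nonneg y) _)]
  have hup := Real.rpow_nonneg hu (twoStar N σ - 1)
  have key : (u y ^ (twoStar N σ - 1)) ^ (2 * N) ≤ 1 + |v y| ^ twoStar N σ := by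
    have hvp : 0 ≤ |v y| ^ twoStar N σ := Real.rpow_nonneg (abs_nonneg _) _
    rcases le_total (u y) 1 with h | h
    · have : (u y ^ (twoStar N σ - 1)) ^ (2 * N) ≤ 1 :=
        pow_le_one₀ hup (Real.rpow_le_one hu h (by linarith))
      linarith
    · have h2 : u y ^ (2 * N) ≤ v y := by
        rw [hv, pow_mul]
        have : (u y ^ 2) ^ N ≤ (1 + u y ^ 2) ^ N := by gcongr; linarith
        have h0 : 0 ≤ (u y ^ 2) ^ N := by positivity
        simp only
        nlinarith
      have h2' : (0:ℝ) ≤ u y ^ (2 * N) := by positivity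
      have hcm : (u y ^ (twoStar N σ - 1)) ^ (2 * N) = (u y ^ (2 * N)) ^ (twoStar N σ - 1) := by
        rw [← Real.rpow_natCast (u y ^ (twoStar N σ - 1)), ← Real.rpow_mul hu, mul_comm, Real.rpow_mul hu, Real.rpow_natCast]
      rw [abs_of_nonneg (h2'.trans h2), hcm]
      have h3 : (u y ^ (2 * N)) ^ (twoStar N σ - 1) ≤ (u y ^ (2 * N)) ^ (twoStar N σ) :=
        Real.rpow_le_rpow_of_exponent_le (one_le_pow₀ h) (by linarith)
      have h4 : (u y ^ (2 * N)) ^ (twoStar N σ) ≤ v y ^ twoStar N σ := Real.rpow_le_rpow h2' h2 (by linarith)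
      linarith
  have hvp : 0 ≤ |v y| ^ twoStar N σ := Real.rpow_nonneg (abs_nonneg _) _
  have h5 : |v y| ^ twoStar N σ ≤ a⁻¹ * (wr N k σ y * |v y| ^ twoStar N σ) := by
    rw [← mul_assoc]
    have : 1 ≤ a⁻¹ * wr N k σ y := by
      rw [← div_eq_inv_mul, le_div_iff₀ ha0]; linarith
    nlinarith
  calc rhs N k σ u y ^ (2 * N) = (S * wr N k σ y) ^ (2 * N) * (u y ^ (twoStar N σ - 1)) ^ (2 * N) := by
        rw [← mul_pow, rhs, mul_assoc]
    _ ≤ (S * A) ^ (2 * N) * (1 + |v y| ^ twoStar N σ) := by gcongr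
    _ ≤ _ := by gcongr

/-- Morrey-type growth bound for the right-hand side. -/
lemma rhs_growth (w : WS N k σ ψ u g) (x0 : Euc N) {d : ℝ} (hd : 0 < d) (hz : zNorm N k x0 = 4 * d) :
    ∃ C : ℝ, 0 ≤ C ∧ ∀ x ∈ closedBall x0 d, ∀ s, 0 < s → s ≤ d →
      IntegrableOn (rhs N k σ u) (closedBall x s) volume ∧
      ∫ y in closedBall x s, rhs N k σ u y ≤ C * (Real.sqrt s) ^ (2 * N - 1) := by
  have h1 := w.rhs_high x0 hd hz
  set F := ∫ y in closedBall x0 (2 * d), rhs N k σ u y ^ (2 * N) with hF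
  have hN := w.hN
  have hF0 : 0 ≤ F := integral_nonneg fun y => pow_nonneg (w.rhs_nonneg y) _
  refine ⟨(volume.real (ball (0 : Euc N) 1)) + F, by positivity, fun x hx s hs hsd => ?_⟩
  have hsub : closedBall x s ⊆ closedBall x0 (2 * d) := closedBall_subset_closedBall' (by
    rw [mem_closedBall] at hx; linarith)
  have h2 := h1.mono_set hsub
  set r := Real.sqrt s with hr
  have hr0 : 0 < r := Real.sqrt_pos.2 hs
  have hsr : s = r ^ 2 := (Real.sq_sqrt hs.le).symm
  have hc : IntegrableOn (fun _ : Euc N => r⁻¹) (closedBall x s) volume :=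
    integrableOn_const (isCompact_closedBall x s).measure_lt_top.ne
  have h3 : IntegrableOn (fun y => r⁻¹ + rhs N k σ u y ^ (2 * N) * r ^ (2 * N - 1)) (closedBall x s) volume :=
    hc.add (h2.mul_const _)
  have hpt : ∀ y, rhs N k σ u y ≤ r⁻¹ + rhs N k σ u y ^ (2 * N) * r ^ (2 * N - 1) := fun y => by
    have := pow_young (w.rhs_nonneg y) (inv_pos.2 hr0) (2 * N - 1)
    rw [inv_pow, inv_inv, show 2 * N - 1 + 1 = 2 * N by omega] at this
    exact this
  have h4 : IntegrableOn (rhs N k σ u) (closedBall x s) volume := by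
    refine Integrable.mono' h3 w.rhs_meas.aestronglyMeasurable (ae_of_all _ fun y => ?_)
    rw [Real.norm_of_nonneg (w.rhs_nonneg y)]
    exact hpt y
  refine ⟨h4, (setIntegral_mono h4 h3 hpt).trans ?_⟩
  rw [integral_add hc (h2.mul_const _), integral_mul_const, setIntegral_const, smul_eq_mul,
    Measure.addHaar_real_closedBall _ _ hs.le, finrank_euclideanSpace_fin, add_mul]
  have h5 : ∫ y in closedBall x s, rhs N k σ u y ^ (2 * N) ≤ F :=
    setIntegral_mono_set h1 (ae_of_all _ fun y => pow_nonneg (w.rhs_nonneg y) _) (HasSubset.Subset.eventuallyLE hsub)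
  have h6 : s ^ N * volume.real (ball (0 : Euc N) 1) * r⁻¹ = volume.real (ball (0 : Euc N) 1) * r ^ (2 * N - 1) := by
    have : r ^ (2 * N) = r ^ (2 * N - 1) * r := by rw [← pow_succ]; congr 1; omega
    rw [hsr, ← pow_mul, this]; field_simp
  rw [h6]
  gcongr

lemma D_bound (w : WS N k σ ψ u g) {ρ κ : Euc N → ℝ} (K : Ker N ρ κ) (x x' : Euc N) {s : ℝ} (hs : 0 < s)
    (h1 : IntegrableOn (rhs N k σ u) (closedBall x s) volume) (h2 : IntegrableOn (rhs N k σ u) (closedBall x' s) volume) :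
    |(∫ y, rhs N k σ u y * κ (s⁻¹ • (x - y))) - ∫ y, rhs N k σ u y * κ (s⁻¹ • (x' - y))| ≤
      s⁻¹ * ‖x - x'‖ * ((∫ y in closedBall x s, rhs N k σ u y) + ∫ y in closedBall x' s, rhs N k σ u y) := by
  have mb : ∀ x : Euc N, MeasurableSet (closedBall x s) := fun x => isClosed_closedBall.measurableSet
  rw [← integral_sub (w.rhs_int (ker_sm K.sk hs x)) (w.rhs_int (ker_sm K.sk hs x')), ← integral_indicator (mb x),
    ← integral_indicator (mb x'), ← integral_add (h1.integrable_indicator (mb x)) (h2.integrable_indicator (mb x')),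
    ← integral_const_mul, ← Real.norm_eq_abs]
  refine norm_integral_le_of_norm_le (((h1.integrable_indicator (mb x)).add (h2.integrable_indicator (mb x'))).const_mul _)
    (ae_of_all _ fun y => ?_)
  have hf := w.rhs_nonneg y
  have i1 : 0 ≤ (closedBall x s).indicator (rhs N k σ u) y := indicator_nonneg (fun y _ => w.rhs_nonneg y) y
  have i2 : 0 ≤ (closedBall x' s).indicator (rhs N k σ u) y := indicator_nonneg (fun y _ => w.rhs_nonneg y) y
  have hk : |κ (s⁻¹ • (x - y)) - κ (s⁻¹ • (x' - y))| ≤ s⁻¹ * ‖x - x'‖ := by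
    refine (K.k_lip _ _).trans ?_
    rw [← smul_sub, norm_smul, norm_inv, Real.norm_of_nonneg hs.le, sub_sub_sub_cancel_right]
  by_cases hy : y ∈ closedBall x s ∨ y ∈ closedBall x' s
  · have hle : rhs N k σ u y ≤ (closedBall x s).indicator (rhs N k σ u) y + (closedBall x' s).indicator (rhs N k σ u) y := by
      rcases hy with h | h
      · rw [indicator_of_mem h]; linarith
      · rw [indicator_of_mem h (rhs N k σ u)]; linarith
    rw [← mul_sub, norm_mul, Real.norm_of_nonneg hf, mul_comm, Real.norm_eq_abs]
    gcongr
  · push_neg at hy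
    have e1 : κ (s⁻¹ • (x - y)) = 0 := K.kz _ (Ker.out hs (by have := hy.1; rw [mem_closedBall, not_le] at this; exact this.le))
    have e2 : κ (s⁻¹ • (x' - y)) = 0 := K.kz _ (Ker.out hs (by have := hy.2; rw [mem_closedBall, not_le] at this; exact this.le))
    rw [e1, e2]
    simp only [mul_zero, sub_zero, norm_zero]
    positivity

/-- One-sided comparison of mollifications at two points. -/
lemma Mo_comp (w : WS N k σ ψ u g) {ρ κ : Euc N → ℝ} (K : Ker N ρ κ) (x0 : Euc N) {d : ℝ} (hd : 0 < d)
    (hz : zNorm N k x0 = 4 * d) : ∃ M : ℝ, 0 ≤ M ∧ ∀ x ∈ closedBall x0 d, ∀ x' ∈ closedBall x0 d, ∀ a, 0 < a → a ≤ d →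
      Mo ρ a u x - Mo ρ a u x' ≤ Mo ρ d u x - Mo ρ d u x' + M * ‖x - x'‖ := by
  obtain ⟨C, hC, hg⟩ := w.rhs_growth x0 hd hz
  have hN := w.hN
  refine ⟨4 * C * Real.sqrt d, by positivity, fun x hx x' hx' a ha had => ?_⟩
  set E : ℝ → ℝ := fun s => Mo ρ s u x - Mo ρ s u x' + 4 * C * ‖x - x'‖ * Real.sqrt s with hE
  have hder : ∀ s, 0 < s → HasDerivAt E (- ((s ^ N)⁻¹ * (s * ∫ y, rhs N k σ u y * κ (s⁻¹ • (x - y)))) -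
      - ((s ^ N)⁻¹ * (s * ∫ y, rhs N k σ u y * κ (s⁻¹ • (x' - y)))) + 4 * C * ‖x - x'‖ * (1 / (2 * Real.sqrt s))) s := fun s hs =>
    ((w.Mo_deriv K x hs).sub (w.Mo_deriv K x' hs)).add ((Real.hasDerivAt_sqrt hs.ne').const_mul _)
  have hmono : MonotoneOn E (Icc a d) := by
    refine monotoneOn_of_deriv_nonneg (convex_Icc a d) (fun s hs => (hder s (ha.trans_le hs.1)).continuousAt.continuousWithinAt)
      (fun s hs => ?_) (fun s hs => ?_)
    · rw [interior_Icc] at hs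
      exact (hder s (ha.trans hs.1)).differentiableAt.differentiableWithinAt
    · rw [interior_Icc] at hs
      have hs0 := ha.trans hs.1
      rw [(hder s hs0).deriv]
      obtain ⟨i1, b1⟩ := hg x hx s hs0 hs.2.le
      obtain ⟨i2, b2⟩ := hg x' hx' s hs0 hs.2.le
      have hb := w.D_bound K x x' hs0 i1 i2
      set J := ∫ y, rhs N k σ u y * κ (s⁻¹ • (x - y))
      set J' := ∫ y, rhs N k σ u y * κ (s⁻¹ • (x' - y))
      set r := Real.sqrt s with hr
      have hr0 : 0 < r := Real.sqrt_pos.2 hs0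
      have hsr : s = r ^ 2 := (Real.sq_sqrt hs0.le).symm
      have h3 : J - J' ≤ s⁻¹ * ‖x - x'‖ * (2 * C * r ^ (2 * N - 1)) := by
        refine (le_abs_self _).trans (hb.trans ?_)
        gcongr
        linarith
      have h4 : (s ^ N)⁻¹ * (s * (J - J')) ≤ (s ^ N)⁻¹ * (s * (s⁻¹ * ‖x - x'‖ * (2 * C * r ^ (2 * N - 1)))) := by gcongr
      have h5 : (s ^ N)⁻¹ * (s * (s⁻¹ * ‖x - x'‖ * (2 * C * r ^ (2 * N - 1)))) = 4 * C * ‖x - x'‖ * (1 / (2 * r)) := by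
        have : r ^ (2 * N) = r ^ (2 * N - 1) * r := by rw [← pow_succ]; congr 1; omega
        have e : s ^ N = r ^ (2 * N - 1) * r := by rw [hsr, ← pow_mul, this]
        rw [e]; field_simp; ring
      have h6 : (s ^ N)⁻¹ * (s * (J - J')) = (s ^ N)⁻¹ * (s * J) - (s ^ N)⁻¹ * (s * J') := by ring
      linarith
  have h7 := hmono ⟨le_rfl, had⟩ ⟨had, le_rfl⟩ had
  simp only [hE] at h7
  have h8 : 0 ≤ 4 * C * ‖x - x'‖ * Real.sqrt a := by positivity
  nlinarith

/-- Mollifications at a fixed scale are locally Lipschitz. -/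
lemma Mo_lip (w : WS N k σ ψ u g) {ρ κ : Euc N → ℝ} (K : Ker N ρ κ) (x0 : Euc N) {d : ℝ} (hd : 0 < d) :
    ∃ L : ℝ, 0 ≤ L ∧ ∀ x ∈ closedBall x0 d, ∀ x' ∈ closedBall x0 d, Mo ρ d u x - Mo ρ d u x' ≤ L * ‖x - x'‖ := by
  obtain ⟨C, hC⟩ := ContDiff.lipschitzWith_of_hasCompactSupport K.sr.2 K.sr.1 (by simp)
  have hi : IntegrableOn u (closedBall x0 (2 * d)) volume := w.loc_u.integrableOn_isCompact (isCompact_closedBall _ _)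
  have hI : 0 ≤ ∫ y in closedBall x0 (2 * d), u y := integral_nonneg fun y => w.hu0 y
  have mb : MeasurableSet (closedBall x0 (2 * d)) := isClosed_closedBall.measurableSet
  refine ⟨(d ^ N)⁻¹ * (C * d⁻¹ * ∫ y in closedBall x0 (2 * d), u y), by positivity, fun x hx x' hx' => ?_⟩
  have s1 := ker_sm K.sr hd x
  have s2 := ker_sm K.sr hd x'
  unfold Mo
  rw [← mul_sub, mul_assoc]
  refine mul_le_mul_of_nonneg_left ?_ (by positivity)
  rw [← integral_sub (w.u_int s1.cont s1.2) (w.u_int s2.cont s2.2), ← integral_indicator mb]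
  refine (le_abs_self _).trans ?_
  rw [← Real.norm_eq_abs, mul_right_comm, ← integral_const_mul]
  refine norm_integral_le_of_norm_le ((hi.integrable_indicator mb).const_mul _) (ae_of_all _ fun y => ?_)
  by_cases hy : y ∈ closedBall x0 (2 * d)
  · rw [indicator_of_mem hy, ← sub_mul, norm_mul, Real.norm_of_nonneg (w.hu0 y)]
    have := hC.dist_le_mul (d⁻¹ • (x - y)) (d⁻¹ • (x' - y))
    rw [dist_eq_norm, dist_eq_norm, ← smul_sub, norm_smul, norm_inv, Real.norm_of_nonneg hd.le, sub_sub_sub_cancel_right,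
      ← mul_assoc] at this
    exact mul_le_mul_of_nonneg_right this (w.hu0 y)
  · rw [mem_closedBall, not_le] at hy
    have far : ∀ x ∈ closedBall x0 d, ρ (d⁻¹ • (x - y)) = 0 := fun x hx => K.rz _ (Ker.out hd (by
      rw [mem_closedBall] at hx
      have := dist_triangle y x x0
      linarith))
    rw [far x hx, far x' hx']
    simp only [zero_mul, sub_zero, norm_zero]
    have : 0 ≤ (closedBall x0 (2 * d)).indicator u y := indicator_nonneg (fun y _ => w.hu0 y) y
    positivity

end WS


namespace Ker
variable {N : ℕ} {ρ κ : Euc N → ℝ}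

lemma c_pos (K : Ker N ρ κ) : 0 < ∫ X, ρ X := by
  refine (integral_pos_iff_support_of_nonneg K.r0 (K.sr.cont.integrable_of_hasCompactSupport K.sr.2)).2 ?_
  have h : closedBall (0 : Euc N) (1/2) ⊆ Function.support ρ := fun x hx => by
    rw [mem_closedBall, dist_zero_right] at hx
    rw [Function.mem_support, K.ro x hx]; norm_num
  exact (measure_closedBall_pos volume (0 : Euc N) (by norm_num : (0:ℝ) < 1/2)).trans_le (measure_mono h)

end Ker

/-- scales -/
def sc (n : ℕ) : ℝ := 1 / ((n : ℝ) + 1)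
lemma sc_pos (n : ℕ) : 0 < sc n := by unfold sc; positivity
lemma sc_tendsto : Tendsto sc atTop (𝓝 0) := tendsto_one_div_add_atTop_nhds_zero_nat
lemma sc_anti {m n : ℕ} (h : m ≤ n) : sc n ≤ sc m := by
  unfold sc
  have : (m:ℝ) ≤ n := by exact_mod_cast h
  gcongr

/-- The precise representative (up to a constant factor). -/
def Wrep {N : ℕ} (ρ u : Euc N → ℝ) (x : Euc N) : ℝ := ⨆ n : ℕ, Mo ρ (sc n) u x

namespace WS
variable {N k : ℕ} {σ : ℝ} {ψ : ℕ → Euc N → ℝ} {u : Euc N → ℝ} {g : Euc N → Euc N}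

lemma Mo_ae (w : WS N k σ ψ u g) {ρ κ : Euc N → ℝ} (K : Ker N ρ κ) :
    ∀ᵐ x, Tendsto (fun n => Mo ρ (sc n) u x) atTop (𝓝 ((∫ X, ρ X) * u x)) := by
  have hL := IsUnifLocDoublingMeasure.ae_tendsto_average_norm_sub (volume : Measure (Euc N)) w.loc_u 1
  filter_upwards [hL] with x hx
  have h1 := hx (fun _ : ℕ => x) sc (tendsto_nhdsWithin_iff.2 ⟨sc_tendsto, Eventually.of_forall fun n => sc_pos n⟩)
    (Eventually.of_forall fun n => mem_closedBall_self (by have := sc_pos n; linarith))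
  set V := volume.real (ball (0 : Euc N) 1) with hV
  have hV0 : 0 < V := by
    rw [hV, measureReal_def]
    exact ENNReal.toReal_pos (measure_ball_pos volume _ one_pos).ne' measure_ball_lt_top.ne
  have h2 := h1.const_mul V
  rw [mul_zero] at h2
  rw [tendsto_iff_dist_tendsto_zero]
  refine squeeze_zero (fun n => dist_nonneg) (fun n => ?_) h2
  have ha := sc_pos n
  set a := sc n
  have sk := ker_sm K.sr ha x
  have hi : IntegrableOn u (closedBall x a) volume := w.loc_u.integrableOn_isCompact (isCompact_closedBall _ _)
  have hc : IntegrableOn (fun _ : Euc N => u x) (closedBall x a) volume :=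
    integrableOn_const (isCompact_closedBall x a).measure_lt_top.ne
  have hi2 : IntegrableOn (fun y => ‖u y - u x‖) (closedBall x a) volume := (hi.sub hc).norm
  have mb : MeasurableSet (closedBall x a) := isClosed_closedBall.measurableSet
  have e1 : (∫ X, ρ X) * u x = (a ^ N)⁻¹ * ∫ y, ρ (a⁻¹ • (x - y)) * u x := by
    rw [integral_mul_const, Ker.cov ha x]; ring
  have hi3 : Integrable (fun y => ρ (a⁻¹ • (x - y)) * u x) volume :=
    (sk.cont.integrable_of_hasCompactSupport sk.2).mul_const _
  rw [Real.dist_eq, e1, Mo, ← mul_sub, ← integral_sub (w.u_int sk.cont sk.2) hi3, abs_mul,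
    abs_of_pos (by positivity), setAverage_eq, Measure.addHaar_real_closedBall _ _ ha.le, finrank_euclideanSpace_fin,
    smul_eq_mul, ← hV]
  have e2 : V * ((a ^ N * V)⁻¹ * ∫ y in closedBall x a, ‖u y - u x‖) = (a ^ N)⁻¹ * ∫ y in closedBall x a, ‖u y - u x‖ := by
    field_simp
  rw [e2]
  refine mul_le_mul_of_nonneg_left ?_ (by positivity)
  rw [← Real.norm_eq_abs, ← integral_indicator mb]
  refine norm_integral_le_of_norm_le (hi2.integrable_indicator mb) (ae_of_all _ fun y => ?_)
  by_cases hy : y ∈ closedBall x a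
  · rw [indicator_of_mem hy, ← mul_sub, norm_mul, Real.norm_of_nonneg (K.r0 _)]
    have := K.r1 (a⁻¹ • (x - y))
    nlinarith [norm_nonneg (u y - u x)]
  · rw [indicator_of_notMem hy]
    rw [mem_closedBall, not_le] at hy
    rw [K.rz _ (Ker.out ha hy.le)]; simp

lemma Mo_mono (w : WS N k σ ψ u g) {ρ κ : Euc N → ℝ} (K : Ker N ρ κ) (x : Euc N) : Monotone (fun n => Mo ρ (sc n) u x) :=
  fun m n h => w.Mo_anti K x (sc_pos n) (sc_pos m) (sc_anti h)

lemma W_loc (w : WS N k σ ψ u g) {ρ κ : Euc N → ℝ} (K : Ker N ρ κ) (x0 : Euc N) {d : ℝ} (hd : 0 < d)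
    (hz : zNorm N k x0 = 4 * d) : (∀ x ∈ closedBall x0 d, Tendsto (fun n => Mo ρ (sc n) u x) atTop (𝓝 (Wrep ρ u x))) ∧
      ∃ L : ℝ≥0, LipschitzOnWith L (Wrep ρ u) (closedBall x0 d) := by
  obtain ⟨M, hM, h1⟩ := w.Mo_comp K x0 hd hz
  obtain ⟨L, hL, h2⟩ := w.Mo_lip K x0 hd
  have hlip : ∀ x ∈ closedBall x0 d, ∀ x' ∈ closedBall x0 d, ∀ a, 0 < a → a ≤ d →
      Mo ρ a u x - Mo ρ a u x' ≤ (L + M) * ‖x - x'‖ := fun x hx x' hx' a ha had => by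
    have := h1 x hx x' hx' a ha had
    have := h2 x hx x' hx'
    linarith
  have hev : ∀ᶠ n in atTop, sc n ≤ d := (sc_tendsto.eventually (gt_mem_nhds hd)).mono fun n hn => le_of_lt hn
  obtain ⟨x1, hx1, ht1⟩ : ∃ x1 ∈ closedBall x0 d, Tendsto (fun n => Mo ρ (sc n) u x1) atTop (𝓝 ((∫ X, ρ X) * u x1)) := by
    by_contra hcon
    push_neg at hcon
    have h3 : volume (closedBall x0 d) = 0 := measure_mono_null (fun x hx => hcon x hx) (w.Mo_ae K)
    exact (measure_closedBall_pos volume x0 hd).ne' h3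
  have hb1 : ∀ n, Mo ρ (sc n) u x1 ≤ (∫ X, ρ X) * u x1 := fun n => (w.Mo_mono K x1).ge_of_tendsto ht1 n
  have hbdd : ∀ x ∈ closedBall x0 d, BddAbove (range fun n => Mo ρ (sc n) u x) := fun x hx => by
    refine ⟨(∫ X, ρ X) * u x1 + (L + M) * ‖x - x1‖, ?_⟩
    rintro _ ⟨n, rfl⟩
    obtain ⟨m, hm1, hm2⟩ := (hev.and (eventually_ge_atTop n)).exists
    have := hlip x hx x1 hx1 (sc m) (sc_pos m) hm1
    have := hb1 m
    have : Mo ρ (sc n) u x ≤ Mo ρ (sc m) u x := w.Mo_mono K x hm2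
    simp only
    linarith
  have hT : ∀ x ∈ closedBall x0 d, Tendsto (fun n => Mo ρ (sc n) u x) atTop (𝓝 (Wrep ρ u x)) := fun x hx =>
    tendsto_atTop_ciSup (w.Mo_mono K x) (hbdd x hx)
  refine ⟨hT, ⟨L + M, by positivity⟩, ?_⟩
  have hone : ∀ x ∈ closedBall x0 d, ∀ x' ∈ closedBall x0 d, Wrep ρ u x - Wrep ρ u x' ≤ (L + M) * ‖x - x'‖ := fun x hx x' hx' => by
    refine le_of_tendsto ((hT x hx).sub (hT x' hx')) ?_
    filter_upwards [hev] with n hn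
    exact hlip x hx x' hx' (sc n) (sc_pos n) hn
  refine LipschitzOnWith.of_dist_le_mul fun x hx x' hx' => ?_
  rw [Real.dist_eq, dist_eq_norm, abs_le]
  have a1 := hone x hx x' hx'
  have a2 := hone x' hx' x hx
  rw [norm_sub_rev] at a2
  show -((L + M) * ‖x - x'‖) ≤ _ ∧ _ ≤ (L + M) * ‖x - x'‖
  constructor <;> linarith

/-- Weak derivative identity. -/
lemma weak_der (w : WS N k σ ψ u g) {η : Euc N → ℝ} (hη : Sm η) (v : Euc N) :
    ∫ x, fderiv ℝ η x v * u x = - ∫ x, η x * inner ℝ (g x) v := by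
  have hc : Continuous (fun x => fderiv ℝ η x v) := hη.contD.clm_apply continuous_const
  have hs : HasCompactSupport (fun x => fderiv ℝ η x v) := hη.2.fderiv_apply ℝ v
  have t1 := w.conv_test hc hs
  have hb : MemLp (fun x => η x • v) 2 volume :=
    (hη.cont.smul continuous_const).memLp_of_hasCompactSupport hη.2.smul_right
  have t2 := (inner_conv hb w.hg (fun j => (w.hψ j).memG 2) w.hLg).neg
  have e : ∀ j, ∫ y, fderiv ℝ η y v * ψ j y = - ∫ y, inner ℝ (η y • v) (gradient (ψ j) y) := fun j => by
    have hj := w.hψ j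
    have hcj : Continuous (fun x => fderiv ℝ (ψ j) x v) := hj.contD.clm_apply continuous_const
    have i1 : Integrable (fun x => fderiv ℝ (ψ j) x v * η x) volume :=
      (hcj.mul hη.cont).integrable_of_hasCompactSupport hη.2.mul_left
    have i2 : Integrable (fun x => ψ j x * fderiv ℝ η x v) volume :=
      (hj.cont.mul hc).integrable_of_hasCompactSupport hs.mul_left
    have i3 : Integrable (fun x => ψ j x * η x) volume :=
      (hj.cont.mul hη.cont).integrable_of_hasCompactSupport hη.2.mul_left
    have := integral_mul_fderiv_eq_neg_fderiv_mul_of_integrable i1 i2 i3 (fun x _ => hj.diff x) (fun x _ => hη.diff x)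
    calc _ = ∫ y, ψ j y * fderiv ℝ η y v := by congr 1; ext y; ring
      _ = _ := this
      _ = _ := by
        congr 2; ext y
        rw [inner_smul_left, real_inner_comm, grad_eq]; simp [mul_comm]
  simp only [e] at t1
  rw [tendsto_nhds_unique t1 t2]
  congr 2; ext y
  rw [inner_smul_left, real_inner_comm]; simp

lemma fd_loc (w : WS N k σ ψ u g) {V : Euc N → ℝ} {x0 : Euc N} {d : ℝ} {L : ℝ≥0} (hV : LipschitzOnWith L V (ball x0 d))
    (hVu : ∀ᵐ x, x ∈ ball x0 d → V x = u x) :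
    ∀ᵐ x, x ∈ ball x0 d → fderiv ℝ V x = innerSL ℝ (g x) := by
  obtain ⟨G, hG, hGV⟩ := hV.extend_real
  have hlg : LocallyIntegrable g volume := w.hg.locallyIntegrable (by norm_num)
  have key : ∀ v : Euc N, ∀ᵐ x, x ∈ ball x0 d → lineDeriv ℝ G x v - inner ℝ (g x) v = 0 := fun v => by
    have hm : Measurable (fun x => lineDeriv ℝ G x v) := measurable_lineDeriv hG.continuous
    have l1 : LocallyIntegrable (fun x => lineDeriv ℝ G x v) volume := by
      have hcl : LocallyIntegrable (fun x : Euc N => (L:ℝ) * ‖v‖) volume := locallyIntegrable_const _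
      refine hcl.mono hm.aestronglyMeasurable (ae_of_all _ fun x => ?_)
      rw [Real.norm_of_nonneg (by positivity : (0:ℝ) ≤ L * ‖v‖)]
      exact norm_lineDeriv_le_of_lipschitz ℝ hG
    have l2 : LocallyIntegrable (fun x => inner ℝ (g x) v) volume := by
      have hcl : LocallyIntegrable (fun x : Euc N => ‖v‖ * ‖g x‖) volume := (w.hg.norm.locallyIntegrable (by norm_num)).smul ‖v‖
      refine hcl.mono (w.hg.1.inner aestronglyMeasurable_const) (ae_of_all _ fun x => ?_)
      rw [norm_mul, norm_norm, norm_norm, mul_comm]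
      exact norm_inner_le_norm _ _
    refine IsOpen.ae_eq_zero_of_integral_contDiff_smul_eq_zero isOpen_ball ((l1.sub l2).locallyIntegrableOn _) fun η h1 h2 h3 => ?_
    have hη : Sm η := ⟨h1, h2⟩
    obtain ⟨C, hC⟩ := ContDiff.lipschitzWith_of_hasCompactSupport h2 h1 (by simp)
    have i1 : Integrable (fun x => η x * lineDeriv ℝ G x v) volume := by
      simpa using l1.integrable_smul_left_of_hasCompactSupport hη.cont h2
    have i2 : Integrable (fun x => η x * inner ℝ (g x) v) volume := by
      simpa using l2.integrable_smul_left_of_hasCompactSupport hη.cont h2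
    have e1 := LipschitzWith.integral_lineDeriv_mul_eq (μ := (volume : Measure (Euc N))) hG hC h2 v
    have e2 : ∫ x, lineDeriv ℝ η x (-v) * G x = - ∫ x, fderiv ℝ η x v * u x := by
      rw [← integral_neg]
      refine integral_congr_ae ?_
      filter_upwards [hVu] with x hx
      rw [(hη.diff x).lineDeriv_eq_fderiv, map_neg, neg_mul]
      by_cases hxB : x ∈ ball x0 d
      · rw [← hGV hxB, hx hxB]
      · have : fderiv ℝ η x = 0 := by
          by_contra hne
          exact hxB (h3 (support_fderiv_subset ℝ hne))
        rw [this]; simp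
    have e3 : ∫ x, η x • (lineDeriv ℝ G x v - inner ℝ (g x) v) =
        (∫ x, η x * lineDeriv ℝ G x v) - ∫ x, η x * inner ℝ (g x) v := by
      rw [← integral_sub i1 i2]
      congr 1; ext x; simp only [smul_eq_mul]; ring
    have e4 : ∫ x, η x * lineDeriv ℝ G x v = ∫ x, lineDeriv ℝ G x v * η x := by
      congr 1; ext x; ring
    refine Eq.trans ?_ (e3.trans ?_)
    · rfl
    · rw [e4, e1, e2, w.weak_der hη v]; ring
  have key2 : ∀ᵐ x, ∀ i : Fin N, x ∈ ball x0 d →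
      lineDeriv ℝ G x (EuclideanSpace.basisFun (Fin N) ℝ i) - inner ℝ (g x) (EuclideanSpace.basisFun (Fin N) ℝ i) = 0 :=
    ae_all_iff.2 fun i => key _
  filter_upwards [key2, hG.ae_differentiableAt (μ := (volume : Measure (Euc N)))] with x hx hd hxB
  have hloc : V =ᶠ[𝓝 x] G := by
    filter_upwards [isOpen_ball.mem_nhds hxB] with y hy
    exact hGV hy
  rw [hloc.fderiv_eq]
  have : (fderiv ℝ G x : Euc N →ₗ[ℝ] ℝ) = (innerSL ℝ (g x) : Euc N →ₗ[ℝ] ℝ) := by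
    refine (EuclideanSpace.basisFun (Fin N) ℝ).toBasis.ext fun i => ?_
    have := hx i hxB
    rw [hd.lineDeriv_eq_fderiv] at this
    simp only [OrthonormalBasis.coe_toBasis, ContinuousLinearMap.coe_coe, innerSL_apply_apply]
    linarith
  ext v
  exact congrArg (fun l : Euc N →ₗ[ℝ] ℝ => l v) this

end WS


/-- Lower bound: every admissible competitor has energy at least `SS`. -/
lemma comp_lower {N k : ℕ} (hN : 3 ≤ N) (hk : k + 2 ≤ N) {σ : ℝ} (hσ : 0 < σ) (hσ2 : σ < 2) {v : Euc N → ℝ}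
    (hv : MemD12 N v) (h1 : hsInt N k σ v = 1) : (SS N k σ).toReal ≤ gradL2 N v := by
  obtain ⟨φ, hφ, hL, hG⟩ := hv
  have hφ' : ∀ n, Sm (φ n) := hφ
  have hp := twoStar_pos hN hσ2
  have hIntg : Integrable (fun x => zNorm N k x ^ (-σ) * |v x| ^ twoStar N σ) volume := by
    by_contra hcon
    unfold hsInt at h1
    rw [integral_undef hcon] at h1
    norm_num at h1
  have hnn : ∀ x, 0 ≤ zNorm N k x ^ (-σ) * |v x| ^ twoStar N σ := fun x =>
    mul_nonneg (Real.rpow_nonneg (zNorm_nonneg x) _) (Real.rpow_nonneg (abs_nonneg _) _)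
  have hA : AE N k σ v univ = 1 := by
    have h2 := ofReal_integral_eq_lintegral_ofReal hIntg (ae_of_all _ hnn)
    unfold hsInt at h1
    rw [h1, ENNReal.ofReal_one] at h2
    rw [AE, setLIntegral_univ, h2]
    refine lintegral_congr fun x => ?_
    rw [ENNReal.ofReal_mul (Real.rpow_nonneg (zNorm_nonneg x) _), wt, ← rpow_enorm hp.le,
      ← ofReal_norm, Real.norm_of_nonneg (Real.rpow_nonneg (abs_nonneg _) _)]
  have hav : AEStronglyMeasurable (fun x => |v x|) volume := by
    have h3 : AEMeasurable (fun x => ((zNorm N k x ^ (-σ))⁻¹ * (zNorm N k x ^ (-σ) * |v x| ^ twoStar N σ)) ^ (twoStar N σ)⁻¹) volume :=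
      (((wr_meas N k σ).inv.aemeasurable).mul hIntg.1.aemeasurable).pow_const _
    refine (h3.congr ?_).aestronglyMeasurable
    filter_upwards [zNorm_null (show k < N by omega)] with x hx
    have hz : zNorm N k x ^ (-σ) ≠ 0 := (Real.rpow_pos_of_pos hx _).ne'
    rw [inv_mul_cancel_left₀ hz, Real.rpow_rpow_inv (abs_nonneg _) hp.ne']
  have hq : ENNReal.ofReal (2 * (N : ℝ) / ((N : ℝ) - 2)) ≠ 0 := by
    have h3 : (3:ℝ) ≤ N := by exact_mod_cast hN
    have : 0 < 2 * (N : ℝ) / ((N : ℝ) - 2) := div_pos (by linarith) (by linarith)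
    simpa using this
  have hLa : Tendsto (fun n => eLpNorm ((fun x => |φ n x|) - fun x => |v x|)
      (ENNReal.ofReal (2 * (N : ℝ) / ((N : ℝ) - 2))) volume) atTop (𝓝 0) := by
    refine tendsto_of_tendsto_of_tendsto_of_le_of_le tendsto_const_nhds hL (fun n => zero_le) fun n => ?_
    refine eLpNorm_mono fun x => ?_
    simp only [Pi.sub_apply, Real.norm_eq_abs]
    rw [abs_sub_comm (v x)]
    exact abs_abs_sub_abs_le _ _
  obtain ⟨ns, hns, hns2⟩ := (tendstoInMeasure_of_tendsto_eLpNorm hq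
    (fun n => (hφ' n).cont.abs.aestronglyMeasurable) hav hLa).exists_seq_tendsto_ae
  have hae : ∀ᵐ x, Tendsto (fun j => ‖φ (ns j) x‖ₑ) atTop (𝓝 ‖v x‖ₑ) := by
    filter_upwards [hns2] with x hx
    have := hx.enorm
    simpa using this
  have hmf : Measurable (fderiv ℝ v) := measurable_fderiv ℝ v
  have hgm : AEStronglyMeasurable (gradient v) volume := by
    have : gradient v = fun x => (InnerProductSpace.toDual ℝ (Euc N)).symm (fderiv ℝ v x) := rfl
    rw [this]
    exact (InnerProductSpace.toDual ℝ (Euc N)).symm.continuous.comp_aestronglyMeasurable hmf.aestronglyMeasurable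
  have hGg : Tendsto (fun n => eLpNorm (fun x => gradient v x - gradient (φ n) x) 2 volume) atTop (𝓝 0) := by
    refine hG.congr fun n => ?_
    refine eLpNorm_congr_norm_ae (ae_of_all _ fun x => ?_)
    unfold gradient
    rw [← map_sub, LinearIsometryEquiv.norm_map]
  have hD := DE_tendsto hgm (fun j => hφ' (ns j)) (hGg.comp hns.tendsto_atTop)
  have hfin := (SS_le_lim (k := k) hN hk hσ.le hσ2 (fun j => hφ' (ns j)) hae hD).2
  rw [hA, ENNReal.one_rpow, mul_one] at hfin
  have hmem : MemLp (gradient v) 2 volume := by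
    obtain ⟨n, hn⟩ := (hGg.eventually (gt_mem_nhds zero_lt_one)).exists
    have m1 : MemLp (fun x => gradient v x - gradient (φ n) x) 2 volume :=
      ⟨hgm.sub (hφ' n).contG.aestronglyMeasurable, hn.trans ENNReal.one_lt_top⟩
    refine (m1.add ((hφ' n).memG 2)).ae_eq (ae_of_all _ fun x => ?_)
    simp
  have hDt : ∫⁻ x, ‖gradient v x‖ₑ ^ 2 ≠ ⊤ := by
    intro htop
    have := hmem.2
    rw [eLpNorm_two_eq, htop] at this
    simp at this
  have hgl : gradL2 N v = (∫⁻ x, ‖gradient v x‖ₑ ^ 2).toReal := by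
    unfold gradL2
    rw [integral_eq_lintegral_of_nonneg_ae (ae_of_all _ fun x => by positivity) (hmf.norm.pow_const 2).aestronglyMeasurable]
    congr 1
    refine lintegral_congr fun x => ?_
    rw [grad_enorm, ENNReal.ofReal_pow (norm_nonneg _), ofReal_norm]
  rw [hgl]
  exact (ENNReal.toReal_le_toReal (SS_ne_top hN hk hσ.le hσ2) hDt).2 hfin

lemma fderiv_innerSL {N : ℕ} (φ : Euc N → ℝ) (x : Euc N) : fderiv ℝ φ x = innerSL ℝ (gradient φ x) := by
  ext v
  rw [innerSL_apply_apply, grad_eq]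

open Classical in
/-- The positive representative of the minimizer. -/
def Vrep (N k : ℕ) (ρ u : Euc N → ℝ) (x : Euc N) : ℝ := if 0 < zNorm N k x then (∫ X, ρ X)⁻¹ * Wrep ρ u x else 1

namespace WS
variable {N k : ℕ} {σ : ℝ} {ψ : ℕ → Euc N → ℝ} {u : Euc N → ℝ} {g : Euc N → Euc N}

lemma W_tend (w : WS N k σ ψ u g) {ρ κ : Euc N → ℝ} (K : Ker N ρ κ) {x : Euc N} (hx : 0 < zNorm N k x) :
    Tendsto (fun n => Mo ρ (sc n) u x) atTop (𝓝 (Wrep ρ u x)) :=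
  (w.W_loc K x (d := zNorm N k x / 4) (by linarith) (by ring)).1 x (mem_closedBall_self (by linarith))

lemma V_pos (w : WS N k σ ψ u g) {ρ κ : Euc N → ℝ} (K : Ker N ρ κ) (x : Euc N) : 0 < Vrep N k ρ u x := by
  unfold Vrep
  split_ifs with hx
  · have h1 := w.Mo_pos K x (sc_pos 0)
    have h2 := (w.Mo_mono K x).ge_of_tendsto (w.W_tend K hx) 0
    have := K.c_pos
    have : 0 < Wrep ρ u x := h1.trans_le h2
    positivity
  · norm_num

lemma V_ae (w : WS N k σ ψ u g) {ρ κ : Euc N → ℝ} (K : Ker N ρ κ) : ∀ᵐ x, Vrep N k ρ u x = u x := by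
  have hk := w.hk
  filter_upwards [zNorm_null (show k < N by omega), w.Mo_ae K] with x hx h1
  unfold Vrep
  rw [if_pos hx, tendsto_nhds_unique (w.W_tend K hx) h1]
  have := K.c_pos.ne'
  field_simp

lemma V_fd (w : WS N k σ ψ u g) {ρ κ : Euc N → ℝ} (K : Ker N ρ κ) : ∀ᵐ x, fderiv ℝ (Vrep N k ρ u) x = innerSL ℝ (g x) := by
  have hk := w.hk
  have h0 : volume {x | 0 < zNorm N k x ∧ ¬ (fderiv ℝ (Vrep N k ρ u) x = innerSL ℝ (g x))} = 0 := by
    refine measure_null_of_locally_null _ fun x0 hx0 => ?_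
    obtain ⟨d, hd⟩ : ∃ d : ℝ, zNorm N k x0 = 4 * d := ⟨zNorm N k x0 / 4, by ring⟩
    have hd0 : 0 < d := by have := hx0.1; linarith
    obtain ⟨L, hL⟩ := (w.W_loc K x0 hd0 hd).2
    have hc := K.c_pos
    have hpos : ∀ x ∈ ball x0 d, 0 < zNorm N k x := fun x hx => by
      rw [mem_ball, dist_eq_norm] at hx
      have := (abs_le.1 (zNorm_sub_le (k := k) x x0)).1
      linarith
    have hV : LipschitzOnWith (Real.toNNReal (∫ X, ρ X)⁻¹ * L) (Vrep N k ρ u) (ball x0 d) := by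
      refine LipschitzOnWith.of_dist_le_mul fun x hx y hy => ?_
      have h2 := hL.dist_le_mul x (ball_subset_closedBall hx) y (ball_subset_closedBall hy)
      unfold Vrep
      rw [if_pos (hpos x hx), if_pos (hpos y hy), Real.dist_eq, ← mul_sub, abs_mul, abs_of_pos (by positivity), ← Real.dist_eq,
        NNReal.coe_mul, Real.coe_toNNReal _ (by positivity), mul_assoc]
      exact mul_le_mul_of_nonneg_left h2 (by positivity)
    have h3 := w.fd_loc hV (by filter_upwards [w.V_ae K] with x hx _ using hx)
    refine ⟨ball x0 d ∩ {x | 0 < zNorm N k x ∧ ¬ (fderiv ℝ (Vrep N k ρ u) x = innerSL ℝ (g x))},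
      inter_mem (mem_nhdsWithin_of_mem_nhds (ball_mem_nhds x0 hd0)) self_mem_nhdsWithin, ?_⟩
    refine measure_mono_null (fun x hx => ?_) h3
    intro hcon
    exact hx.2.2 (hcon hx.1)
  have h1 : ∀ᵐ x, ¬ (0 < zNorm N k x ∧ ¬ (fderiv ℝ (Vrep N k ρ u) x = innerSL ℝ (g x))) := by
    rw [ae_iff]; simpa using h0
  filter_upwards [h1, zNorm_null (show k < N by omega)] with x hx hz
  by_contra hne
  exact hx ⟨hz, hne⟩

lemma V_mem (w : WS N k σ ψ u g) {ρ κ : Euc N → ℝ} (K : Ker N ρ κ) : MemD12 N (Vrep N k ρ u) := by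
  refine ⟨ψ, w.hψ, w.hLu.congr fun n => ?_, w.hLg.congr fun n => ?_⟩
  · refine eLpNorm_congr_ae ?_
    filter_upwards [w.V_ae K] with x hx
    rw [hx]
  · refine eLpNorm_congr_norm_ae ?_
    filter_upwards [w.V_fd K] with x hx
    rw [hx, fderiv_innerSL, ← map_sub, innerSL_apply_norm]

lemma V_hs (w : WS N k σ ψ u g) {ρ κ : Euc N → ℝ} (K : Ker N ρ κ) : hsInt N k σ (Vrep N k ρ u) = 1 := by
  have h1 := AE_real (k := k) w.hN w.hσ2 w.hu
  rw [w.A_one, ENNReal.toReal_one] at h1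
  rw [← h1]
  refine integral_congr_ae ?_
  filter_upwards [w.V_ae K] with x hx
  rw [hx, wr]

lemma V_grad (w : WS N k σ ψ u g) {ρ κ : Euc N → ℝ} (K : Ker N ρ κ) : gradL2 N (Vrep N k ρ u) = (SS N k σ).toReal := by
  rw [← w.g_sq]
  refine integral_congr_ae ?_
  filter_upwards [w.V_fd K] with x hx
  rw [hx, innerSL_apply_norm]

end WS

/-- For `N ≥ 3`, `0 ≤ k ≤ N-2` and `σ ∈ (0,2)`, the best Hardy–Sobolev
constant `S_{N,σ}` is attained, and the minimizer can be chosen positive. -/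
theorem statement3 (N k : ℕ) (σ : ℝ) (hN : 3 ≤ N) (hk : k ≤ N - 2)
    (hσ : σ ∈ Set.Ioo (0 : ℝ) 2) :
    ∃ w : Euc N → ℝ, MemD12 N w ∧ (∀ x, 0 < w x) ∧
      hsInt N k σ w = 1 ∧ gradL2 N w = Sconst N k σ := by
  have hk' : k + 2 ≤ N := by omega
  obtain ⟨ψ, u, g, w⟩ := exists_WS hN hk' hσ.1 hσ.2
  obtain ⟨ρ, κ, K⟩ := exists_ker N
  refine ⟨Vrep N k ρ u, w.V_mem K, w.V_pos K, w.V_hs K, ?_⟩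
  have hleast : IsLeast {s : ℝ | ∃ v, MemD12 N v ∧ hsInt N k σ v = 1 ∧ s = gradL2 N v} (gradL2 N (Vrep N k ρ u)) := by
    refine ⟨⟨_, w.V_mem K, w.V_hs K, rfl⟩, ?_⟩
    rintro s ⟨v, hv, hv1, rfl⟩
    rw [w.V_grad K]
    exact comp_lower hN hk' hσ.1 hσ.2 hv hv1
  exact hleast.csInf_eq.symm
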